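/- arXiv:1211.4065 — 2 statements merged into one kernel-verified Lean document; each statement's English description precedes it below -/
import Mathlib

section
/- For every p ∈ (1,∞) there is a constant C_p such that: for every smooth vector field f : 𝕋³ → ℝ³ with ∫_{𝕋³} f dx = 0 there exists a symmetric tensor field Q^{jl} = Q^{lj} on 𝕋³, depending linearly on f, such that ∂_j Q^{jl} = f^l and ‖Q‖_{L^p(𝕋³)} + ‖∇Q‖_{L^p(𝕋³)} ≤ C_p ‖f‖_{L^p(𝕋³)}; moreover, if p > 3 then in addition ‖Q‖_{C⁰(𝕋³)} ≤ C_p ‖f‖_{L^p(𝕋³)}. -/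
noncomputable section

open MeasureTheory

/-- Points of space ℝ³. -/
abbrev Spc : Type := Fin 3 → ℝ

/-- ℤ³-periodicity of a function on ℝ³. -/
def Per {α : Type*} (f : Spc → α) : Prop :=
  ∀ (x : Spc) (k : Fin 3 → ℤ), f (fun i => x i + (k i : ℝ)) = f x

/-- Spatial partial derivative in direction `j`. -/
def pd {E : Type*} [NormedAddCommGroup E] [NormedSpace ℝ E]
    (j : Fin 3) (f : Spc → E) (x : Spc) : E :=
  fderiv ℝ f x (Pi.single j 1)

/-- Time derivative. -/
def pt {E : Type*} [NormedAddCommGroup E] [NormedSpace ℝ E]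
    (f : ℝ → Spc → E) (t : ℝ) (x : Spc) : E :=
  deriv (fun s => f s x) t

/-- The fundamental domain [0,1)³ of the torus. -/
def Tdom : Set Spc := Set.univ.pi fun _ => Set.Ico (0 : ℝ) 1


section Torus
open Set
set_option linter.unusedSectionVars false

variable {E : Type*} [NormedAddCommGroup E] [NormedSpace ℝ E]

/-- Projection to the torus. -/
def tor (x : Spc) : UnitAddTorus (Fin 3) := fun i => (x i : UnitAddCircle)

/-- Descend a function to the torus. -/
def tlift {α : Type*} (g : Spc → α) (y : UnitAddTorus (Fin 3)) : α :=
  g (fun i => (AddCircle.equivIco 1 0 (y i)).1)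

lemma tlift_tor {α : Type*} {g : Spc → α} (hg : Per g) (x : Spc) : tlift g (tor x) = g x := by
  unfold tlift tor
  have h : ∀ i, ∃ n : ℤ, (AddCircle.equivIco 1 0 ((x i : ℝ) : AddCircle (1:ℝ))).1 = x i + n := by
    intro i
    have h1 : (((AddCircle.equivIco 1 0 ((x i : ℝ) : AddCircle (1:ℝ))).1 : ℝ) : AddCircle (1:ℝ))
        = ((x i : ℝ) : AddCircle (1:ℝ)) := AddCircle.coe_equivIco
    have h2 := (AddCircle.coe_eq_zero_iff (p := (1:ℝ))
      (x := (AddCircle.equivIco 1 0 ((x i : ℝ) : AddCircle (1:ℝ))).1 - x i)).1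
      (by rw [AddCircle.coe_sub, h1, sub_self])
    obtain ⟨n, hn⟩ := h2
    refine ⟨n, ?_⟩
    simp only [zsmul_eq_mul, mul_one] at hn
    linarith
  choose n hn using h
  rw [← hg x n]
  congr 1
  funext i
  exact hn i

lemma Tdom_meas : MeasurableSet Tdom :=
  MeasurableSet.univ_pi fun _ => measurableSet_Ico

lemma Tdom_ae_Icc : Tdom =ᵐ[volume] Icc (0 : Spc) 1 := by
  have := Measure.univ_pi_Ico_ae_eq_Icc (μ := fun _ : Fin 3 => (volume : Measure ℝ)) (f := (0 : Spc)) (g := 1)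
  exact this

lemma Tdom_ae_Ioc : Tdom =ᵐ[volume] {x : Spc | ∀ i, x i ∈ Ioc ((0:Spc) i) ((0:Spc) i + 1)} := by
  refine Tdom_ae_Icc.trans ?_
  have := Measure.univ_pi_Ioc_ae_eq_Icc (μ := fun _ : Fin 3 => (volume : Measure ℝ)) (f := (0 : Spc)) (g := 1)
  have e : {x : Spc | ∀ i, x i ∈ Ioc ((0:Spc) i) ((0:Spc) i + 1)}
      = Set.univ.pi fun i => Ioc ((0:Spc) i) ((1:Spc) i) := by
    ext x
    simp [Set.mem_pi]
  rw [e]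
  exact this.symm

lemma Tdom_subset_Icc : Tdom ⊆ Icc (0 : Spc) 1 := by
  intro x hx
  exact ⟨fun i => (hx i trivial).1, fun i => (hx i trivial).2.le⟩

instance : IsProbabilityMeasure ((volume : Measure Spc).restrict Tdom) := by
  constructor
  rw [Measure.restrict_apply_univ, measure_congr Tdom_ae_Icc, Real.volume_Icc_pi]
  simp

lemma cont_intT {g : Spc → E} (hg : Continuous g) : IntegrableOn g Tdom :=
  (hg.continuousOn.integrableOn_compact isCompact_Icc).mono_set Tdom_subset_Icc

lemma int_cube {g : Spc → E} (hg : Per g) (a : Spc) :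
    ∫ x in Tdom, g x = ∫ x in {x : Spc | ∀ i, x i ∈ Ioc (a i) (a i + 1)}, g x := by
  have h0 := UnitAddTorus.integral_preimage (tlift g) (0 : Spc)
  have h1 := UnitAddTorus.integral_preimage (tlift g) a
  have e : ∀ x : Spc, tlift g (fun i => (x i : UnitAddCircle)) = g x := tlift_tor hg
  simp only [e] at h0 h1
  rw [← h1, h0, setIntegral_congr_set Tdom_ae_Ioc]

lemma int_translate {g : Spc → E} (hg : Per g) (a : Spc) :
    ∫ x in Tdom, g (x + a) = ∫ x in Tdom, g x := by
  rw [int_cube hg a, setIntegral_congr_set Tdom_ae_Ioc]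
  rw [← (measurePreserving_add_right volume a).setIntegral_preimage_emb
    (measurableEmbedding_addRight a) g]
  congr 2
  ext x
  simp [add_comm]

lemma Per.pd {g : Spc → E} (hg : Per g) (j : Fin 3) : Per (pd j g) := by
  intro x k
  have : g = fun y => g (y + fun i => (k i : ℝ)) := by
    funext y; exact (hg y k).symm
  unfold _root_.pd
  conv_rhs => rw [this]
  rw [fderiv_comp_add_right]
  rfl

lemma Per.fderiv {g : Spc → E} (hg : Per g) : Per (fderiv ℝ g) := by
  intro x k
  have : g = fun y => g (y + fun i => (k i : ℝ)) := by
    funext y; exact (hg y k).symm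
  conv_rhs => rw [this]
  rw [fderiv_comp_add_right]
  rfl

lemma ContDiff.pdi {g : Spc → E} (hg : ContDiff ℝ (⊤ : ℕ∞) g) (j : Fin 3) :
    ContDiff ℝ (⊤ : ℕ∞) (pd j g) := by
  unfold pd
  exact (hg.fderiv_right (m := (⊤ : ℕ∞)) (by simp)).clm_apply contDiff_const

lemma int_pd {g : Spc → E} (hg : ContDiff ℝ 1 g) (hp : Per g) (j : Fin 3) :
    ∫ x in Tdom, pd j g x = 0 := by
  have hd : ∀ x, HasFDerivAt g (fderiv ℝ g x) x := fun x =>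
    (hg.differentiable (by simp) x).hasFDerivAt
  rw [setIntegral_congr_set Tdom_ae_Icc]
  have hsum : ∀ x, (∑ i : Fin 3, (if i = j then fderiv ℝ g x else 0) (Pi.single i 1)) = pd j g x := by
    intro x
    rw [Finset.sum_eq_single j]
    · simp [pd]
    · intro b _ hb; simp [hb]
    · simp
  have hc : Continuous (pd j g) := by
    unfold pd
    exact (hg.continuous_fderiv (by simp)).clm_apply continuous_const
  have := integral_divergence_of_hasFDerivAt_off_countable' (0 : Spc) 1 (by intro i; simp)
    (fun i => if i = j then g else 0) (fun i x => if i = j then fderiv ℝ g x else 0) ∅ (by simp)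
    (by intro i; split_ifs; exacts [hg.continuous.continuousOn, continuousOn_const])
    (by intro x _ i; split_ifs; exacts [hd x, hasFDerivAt_const _ _])
    (by
      simp only [hsum]
      exact hc.continuousOn.integrableOn_compact isCompact_Icc)
  simp only [hsum] at this
  rw [this]
  apply Finset.sum_eq_zero
  intro i _
  split_ifs with h
  · rw [sub_eq_zero]
    congr 1
    funext x
    rw [← hp (i.insertNth ((0:Spc) i) x) (Pi.single i 1)]
    congr 1
    funext m
    rcases Fin.eq_self_or_eq_succAbove i m with rfl | ⟨l, rfl⟩
    · simp
    · simp
  · simp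

end Torus


section Energy

lemma pd_mul {f g : Spc → ℝ} {x : Spc} (hf : DifferentiableAt ℝ f x) (hg : DifferentiableAt ℝ g x)
    (j : Fin 3) : pd j (fun y => f y * g y) x = pd j f x * g x + f x * pd j g x := by
  unfold pd
  rw [fderiv_fun_mul hf hg]
  simp only [add_apply, smul_apply, smul_eq_mul]
  ring

lemma pd_add {f g : Spc → ℝ} {x : Spc} (hf : DifferentiableAt ℝ f x) (hg : DifferentiableAt ℝ g x)
    (j : Fin 3) : pd j (fun y => f y + g y) x = pd j f x + pd j g x := by
  unfold pd
  rw [fderiv_fun_add hf hg]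
  rfl

lemma pd_sub {f g : Spc → ℝ} {x : Spc} (hf : DifferentiableAt ℝ f x) (hg : DifferentiableAt ℝ g x)
    (j : Fin 3) : pd j (fun y => f y - g y) x = pd j f x - pd j g x := by
  unfold pd
  rw [fderiv_fun_sub hf hg]
  rfl

/-- squared gradient -/
def gr (u : Spc → ℝ) (x : Spc) : ℝ := ∑ m, (pd m u x) ^ 2

/-- Laplacian -/
def lap (u : Spc → ℝ) (x : Spc) : ℝ := ∑ m, pd m (pd m u) x

/-- The regularized square modulus. -/
def sqm (ε : ℝ) (u w : Spc → ℝ) (x : Spc) : ℝ := u x ^ 2 + w x ^ 2 + ε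

variable {u w : Spc → ℝ} {ε : ℝ}

lemma gr_nonneg (u : Spc → ℝ) (x : Spc) : 0 ≤ gr u x :=
  Finset.sum_nonneg fun _ _ => sq_nonneg _

lemma sqm_pos (hε : 0 < ε) (x : Spc) : 0 < sqm ε u w x := by
  unfold sqm; positivity

abbrev Sm (u : Spc → ℝ) : Prop := ContDiff ℝ (⊤ : ℕ∞) u

lemma Sm.diff (hu : Sm u) (x : Spc) : DifferentiableAt ℝ u x :=
  hu.differentiable (by simp) x

lemma Sm.one {E : Type*} [NormedAddCommGroup E] [NormedSpace ℝ E] {u : Spc → E}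
    (hu : ContDiff ℝ (⊤ : ℕ∞) u) : ContDiff ℝ 1 u :=
  hu.of_le (by exact_mod_cast le_top)

lemma Sm.gr (hu : Sm u) : Sm (gr u) := by
  unfold _root_.gr
  exact ContDiff.sum fun m _ => (hu.pdi m).pow 2

lemma Sm.lap (hu : Sm u) : Sm (lap u) := by
  unfold _root_.lap
  exact ContDiff.sum fun m _ => (hu.pdi m).pdi m

lemma Sm.sqm (hu : Sm u) (hw : Sm w) : Sm (sqm ε u w) := by
  unfold _root_.sqm
  exact ((hu.pow 2).add (hw.pow 2)).add contDiff_const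

lemma Sm.sqpow (hu : Sm u) (hw : Sm w) (hε : 0 < ε) (a : ℝ) : Sm (fun x => _root_.sqm ε u w x ^ a) :=
  (Sm.sqm hu hw).rpow_const_of_ne fun x => (sqm_pos hε x).ne'

lemma Per.sqm (hu : Per u) (hw : Per w) : Per (sqm ε u w) := by
  intro x k; simp only [_root_.sqm, hu x k, hw x k]

lemma Per.gr (hu : Per u) : Per (gr u) := by
  intro x k; simp only [_root_.gr, hu.pd _ x k]

lemma Per.lap (hu : Per u) : Per (lap u) := by
  intro x k; simp only [_root_.lap, (hu.pd _).pd _ x k]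

lemma pd_sqpow (hu : Sm u) (hw : Sm w) (hε : 0 < ε) (a : ℝ) (m : Fin 3) (x : Spc) :
    pd m (fun x => sqm ε u w x ^ a) x
      = sqm ε u w x ^ a * (2 * a * ((u x * pd m u x + w x * pd m w x) / sqm ε u w x)) := by
  have hs := sqm_pos (u := u) (w := w) hε x
  have h1 : HasFDerivAt (sqm ε u w) (fderiv ℝ (sqm ε u w) x) x :=
    ((Sm.sqm hu hw).diff x).hasFDerivAt
  have h2 := h1.rpow_const (p := a) (Or.inl hs.ne')
  have h3 : pd m (sqm ε u w) x = 2 * (u x * pd m u x + w x * pd m w x) := by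
    have e : sqm ε u w = fun y => (fun y => u y * u y) y + (fun y => w y * w y + ε) y := by
      funext y; simp only [sqm]; ring
    rw [e, pd_add (Sm.diff (hu.mul hu) x) (Sm.diff ((hw.mul hw).add contDiff_const) x)]
    rw [pd_add (Sm.diff (hw.mul hw) x) (differentiableAt_const _),
      pd_mul (hu.diff x) (hu.diff x), pd_mul (hw.diff x) (hw.diff x)]
    have : pd m (fun _ : Spc => ε) x = 0 := by simp [pd]
    rw [this]; ring
  unfold pd at h3 ⊢
  rw [h2.fderiv, smul_apply, h3, Real.rpow_sub_one hs.ne', smul_eq_mul]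
  field_simp

/-- integral of a sum of partials vanishes, giving equalities -/
lemma int_sum_pd (g : Fin 3 → Spc → ℝ) (hg : ∀ m, Sm (g m)) (hp : ∀ m, Per (g m)) :
    ∫ x in Tdom, ∑ m, pd m (g m) x = 0 := by
  rw [integral_finsetSum]
  · exact Finset.sum_eq_zero fun m _ => int_pd (Sm.one (hg m)) (hp m) m
  · intro m _
    exact cont_intT ((hg m).pdi m).continuous

lemma energy_id (hu : Sm u) (hw : Sm w) (pu : Per u) (pw : Per w) (hε : 0 < ε) (a : ℝ) :
    ∫ x in Tdom, (sqm ε u w x ^ a * (u x * lap u x + w x * lap w x)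
      + sqm ε u w x ^ a * (gr u x + gr w x + 2 * a *
        ((∑ m, (u x * pd m u x + w x * pd m w x) ^ 2) / sqm ε u w x))) = 0 := by
  have hS := Sm.sqpow (ε := ε) hu hw hε a
  rw [← int_sum_pd (fun m x => sqm ε u w x ^ a * (u x * pd m u x + w x * pd m w x))]
  · congr 1
    funext x
    have : ∀ m, pd m (fun x => sqm ε u w x ^ a * (u x * pd m u x + w x * pd m w x)) x =
        sqm ε u w x ^ a * (2 * a * ((u x * pd m u x + w x * pd m w x) / sqm ε u w x))
          * (u x * pd m u x + w x * pd m w x)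
        + sqm ε u w x ^ a * (pd m u x * pd m u x + u x * pd m (pd m u) x
          + (pd m w x * pd m w x + w x * pd m (pd m w) x)) := by
      intro m
      have hu' := hu.pdi m
      have hw' := hw.pdi m
      rw [pd_mul (hS.diff x) (Sm.diff ((hu.mul hu').add (hw.mul hw')) x), pd_sqpow hu hw hε,
        pd_add (Sm.diff (hu.mul hu') x) (Sm.diff (hw.mul hw') x),
        pd_mul (hu.diff x) (Sm.diff hu' x), pd_mul (hw.diff x) (Sm.diff hw' x)]
    simp only [this, gr, lap, Fin.sum_univ_three]
    ring
  · intro m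
    exact hS.mul ((hu.mul (hu.pdi m)).add (hw.mul (hw.pdi m)))
  · intro m x k
    simp only [pu.sqm pw x k, pu x k, pw x k, pu.pd m x k, pw.pd m x k]

lemma energyA (hu : Sm u) (hw : Sm w) (pu : Per u) (pw : Per w) (hε : 0 < ε) {a : ℝ} (ha : a ≤ 0) :
    -∫ x in Tdom, sqm ε u w x ^ a * (gr u x + gr w x)
      ≤ ∫ x in Tdom, sqm ε u w x ^ a * (u x * lap u x + w x * lap w x) := by
  have hS := Sm.sqpow (ε := ε) hu hw hε a
  have h := energy_id hu hw pu pw hε a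
  have c1 : Sm (fun x => sqm ε u w x ^ a * (u x * lap u x + w x * lap w x)) :=
    hS.mul ((hu.mul hu.lap).add (hw.mul hw.lap))
  have c2 : Sm (fun x => sqm ε u w x ^ a * (gr u x + gr w x)) :=
    hS.mul (hu.gr.add hw.gr)
  have i2 : IntegrableOn (fun x => -(sqm ε u w x ^ a * (gr u x + gr w x))) Tdom :=
    cont_intT c2.continuous.neg
  rw [← integral_neg]
  rw [← sub_nonneg, ← integral_sub (cont_intT c1.continuous) i2, ← h]
  have c3 : Sm (fun x => (sqm ε u w x ^ a * (u x * lap u x + w x * lap w x)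
      + sqm ε u w x ^ a * (gr u x + gr w x + 2 * a *
        ((∑ m, (u x * pd m u x + w x * pd m w x) ^ 2) / sqm ε u w x)))) := by
    refine c1.add (hS.mul ((hu.gr.add hw.gr).add (contDiff_const.mul (ContDiff.div ?_ (Sm.sqm hu hw) ?_))))
    · exact ContDiff.sum fun m _ => ((hu.mul (hu.pdi m)).add (hw.mul (hw.pdi m))).pow 2
    · exact fun x => (sqm_pos hε x).ne'
  apply integral_mono (cont_intT c3.continuous)
    ((cont_intT c1.continuous).sub i2)
  intro x
  have hs := sqm_pos (u := u) (w := w) hε x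
  have h1 : 0 ≤ sqm ε u w x ^ a := Real.rpow_nonneg hs.le _
  have h2 : 0 ≤ (∑ m, (u x * pd m u x + w x * pd m w x) ^ 2) / sqm ε u w x :=
    div_nonneg (Finset.sum_nonneg fun _ _ => sq_nonneg _) hs.le
  have h3 : sqm ε u w x ^ a * (2 * a * ((∑ m, (u x * pd m u x + w x * pd m w x) ^ 2) / sqm ε u w x)) ≤ 0 :=
    mul_nonpos_of_nonneg_of_nonpos h1 (mul_nonpos_of_nonpos_of_nonneg (by linarith) h2)
  simp only [Pi.sub_apply, mul_add] at h3 ⊢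
  linarith

lemma energyB (hu : Sm u) (pu : Per u) (hε : 0 < ε) {a : ℝ} (ha : a ≤ 0) :
    ∫ x in Tdom, sqm ε u 0 x ^ a * (u x * lap u x)
      ≤ - ((1 + 2 * a) * ∫ x in Tdom, sqm ε u 0 x ^ a * gr u x) := by
  have hw : Sm (0 : Spc → ℝ) := contDiff_const
  have pw : Per (0 : Spc → ℝ) := fun _ _ => rfl
  have hS := Sm.sqpow (ε := ε) hu hw hε a
  have h := energy_id hu hw pu pw hε a
  have c1 : Sm (fun x => sqm ε u 0 x ^ a * (u x * lap u x)) :=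
    hS.mul ((hu.mul hu.lap))
  have c2 : Sm (fun x => sqm ε u 0 x ^ a * gr u x) := hS.mul hu.gr
  have c3 : Sm (fun x => (sqm ε u 0 x ^ a * (u x * lap u x + (0 : Spc → ℝ) x * lap 0 x)
      + sqm ε u 0 x ^ a * (gr u x + gr 0 x + 2 * a *
        ((∑ m, (u x * pd m u x + (0 : Spc → ℝ) x * pd m 0 x) ^ 2) / sqm ε u 0 x)))) := by
    refine (hS.mul ((hu.mul hu.lap).add (hw.mul hw.lap))).add
      (hS.mul ((hu.gr.add hw.gr).add (contDiff_const.mul (ContDiff.div ?_ (Sm.sqm hu hw) ?_))))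
    · exact ContDiff.sum fun m _ => ((hu.mul (hu.pdi m)).add (hw.mul (hw.pdi m))).pow 2
    · exact fun x => (sqm_pos hε x).ne'
  have i2 : IntegrableOn (fun x => -((1 + 2 * a) * (sqm ε u 0 x ^ a * gr u x))) Tdom :=
    cont_intT (continuous_const.mul c2.continuous).neg
  rw [← integral_const_mul, ← integral_neg]
  rw [← sub_nonpos, ← integral_sub (cont_intT c1.continuous) i2, ← h]
  apply integral_mono ((cont_intT c1.continuous).sub i2) (cont_intT c3.continuous)
  intro x
  have hs := sqm_pos (u := u) (w := 0) hε x
  have h1 : 0 ≤ sqm ε u 0 x ^ a := Real.rpow_nonneg hs.le _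
  have h0 : ∀ m, pd m (0 : Spc → ℝ) x = 0 := by intro m; simp [pd]
  have h2 : (∑ m, (u x * pd m u x + (0 : Spc → ℝ) x * pd m 0 x) ^ 2) / sqm ε u 0 x ≤ gr u x := by
    rw [div_le_iff₀ hs]
    simp only [gr, h0, Fin.sum_univ_three, sqm, Pi.zero_apply]
    nlinarith [mul_nonneg hε.le (sq_nonneg (pd 0 u x)), mul_nonneg hε.le (sq_nonneg (pd 1 u x)),
      mul_nonneg hε.le (sq_nonneg (pd 2 u x))]
  have h3 : gr (0 : Spc → ℝ) x = 0 := by simp [gr, h0]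
  have h4 : sqm ε u 0 x ^ a * (2 * a * gr u x) ≤ sqm ε u 0 x ^ a * (2 * a *
        ((∑ m, (u x * pd m u x + (0 : Spc → ℝ) x * pd m 0 x) ^ 2) / sqm ε u 0 x)) :=
    mul_le_mul_of_nonneg_left (mul_le_mul_of_nonpos_left h2 (by linarith)) h1
  simp only [h3, Pi.zero_apply, zero_mul, add_zero] at h4 ⊢
  simp only [Pi.sub_apply, mul_add] at h4 ⊢
  linarith

lemma ell_alg {κ δ θ η G U P A B : ℝ} (hδ : 0 < δ) (hk : κ = 1 - δ) (hk0 : 0 ≤ κ)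
    (hθ0 : 0 ≤ θ) (hθ1 : θ ≤ 1)
    (hη : |η| ≤ 1 / 2) (hG : 0 ≤ G) (hU : 0 ≤ U)
    (hP : |P| ≤ δ / 4 * G + U / δ) (hA : |A| ≤ δ / 4 * G + U / δ) (hB : |B| ≤ U) :
    δ / 2 * G - 2 / δ * U ≤ G - κ * (θ * G + η * P) - A + κ * (η * B + θ * A) := by
  have hκ1 : κ ≤ 1 := by linarith
  have e1 : κ * (η * P) ≤ 1 / 2 * (δ / 4 * G + U / δ) := by
    calc κ * (η * P) ≤ |κ * (η * P)| := le_abs_self _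
      _ = κ * (|η| * |P|) := by rw [abs_mul, abs_mul, abs_of_nonneg hk0]
      _ ≤ 1 * (1 / 2 * (δ / 4 * G + U / δ)) := by gcongr
      _ = _ := by ring
  have e2 : -(κ * (η * B)) ≤ 1 / 2 * U := by
    calc -(κ * (η * B)) ≤ |κ * (η * B)| := neg_le_abs _
      _ = κ * (|η| * |B|) := by rw [abs_mul, abs_mul, abs_of_nonneg hk0]
      _ ≤ 1 * (1 / 2 * U) := by gcongr
      _ = _ := by ring
  have e3 : (1 - κ * θ) * A ≤ δ / 4 * G + U / δ := by
    have h1 : κ * θ ≤ 1 := by nlinarith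
    have h2 : 0 ≤ κ * θ := by positivity
    calc (1 - κ * θ) * A ≤ |(1 - κ * θ) * A| := le_abs_self _
      _ = (1 - κ * θ) * |A| := by rw [abs_mul, abs_of_nonneg (by linarith : 0 ≤ 1 - κ * θ)]
      _ ≤ 1 * (δ / 4 * G + U / δ) := by
        gcongr
        linarith
      _ = _ := by ring
  have e4 : κ * (θ * G) ≤ κ * G := by
    gcongr; nlinarith
  have e5 : U ≤ U / δ := by
    rw [le_div_iff₀ hδ]; nlinarith
  have e6 : 2 / δ * U = 2 * (U / δ) := by ring
  have hdG : 0 ≤ δ * G := by positivity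
  rw [e6]
  subst hk
  nlinarith

lemma elliptic (hu : Sm u) (hw : Sm w) (pu : Per u) (pw : Per w) (hε : 0 < ε) {a δ : ℝ}
    (ha : a ≤ 0) (hδ : 0 < δ) (had : 1 + 2 * a = δ) (i j : Fin 3)
    (heq : ∀ x, lap w x = pd i (pd j u) x) :
    ∫ x in Tdom, sqm ε u w x ^ a * gr w x ≤ 4 / δ ^ 2 * ∫ x in Tdom, sqm ε u w x ^ a * gr u x := by
  have hS := Sm.sqpow (ε := ε) hu hw hε a
  have hh := hS.mul hw
  have ph : Per (fun x => sqm ε u w x ^ a * w x) := by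
    intro x k; simp only [pu.sqm pw x k, pw x k]
  have key : ∫ x in Tdom, ((∑ m, pd m (fun x => (sqm ε u w x ^ a * w x) * pd m w x) x)
      - pd i (fun x => (sqm ε u w x ^ a * w x) * pd j u x) x) = 0 := by
    rw [integral_sub, int_sum_pd, int_pd, sub_zero]
    · exact Sm.one (hh.mul (hu.pdi j))
    · intro x k; simp only [ph x k, pu.pd j x k]
    · exact fun m => hh.mul (hw.pdi m)
    · intro m x k; simp only [ph x k, pw.pd m x k]
    · exact cont_intT (ContDiff.sum fun m _ => (hh.mul (hw.pdi m)).pdi m : Sm _).continuous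
    · exact cont_intT ((hh.mul (hu.pdi j)).pdi i).continuous
  have c0 : Sm (fun x => (∑ m, pd m (fun x => (sqm ε u w x ^ a * w x) * pd m w x) x)
      - pd i (fun x => (sqm ε u w x ^ a * w x) * pd j u x) x) :=
    (ContDiff.sum fun m _ => (hh.mul (hw.pdi m)).pdi m).sub ((hh.mul (hu.pdi j)).pdi i)
  have c1 : Sm (fun x => sqm ε u w x ^ a * gr w x) := hS.mul hw.gr
  have c2 : Sm (fun x => sqm ε u w x ^ a * gr u x) := hS.mul hu.gr
  have main : δ / 2 * (∫ x in Tdom, sqm ε u w x ^ a * gr w x)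
      - 2 / δ * (∫ x in Tdom, sqm ε u w x ^ a * gr u x) ≤ 0 := by
    have i1 : IntegrableOn (fun x => δ / 2 * (sqm ε u w x ^ a * gr w x)) Tdom :=
      cont_intT (continuous_const.mul c1.continuous)
    have i2 : IntegrableOn (fun x => 2 / δ * (sqm ε u w x ^ a * gr u x)) Tdom :=
      cont_intT (continuous_const.mul c2.continuous)
    rw [← key, ← integral_const_mul, ← integral_const_mul, ← integral_sub i1 i2]
    apply integral_mono (i1.sub i2) (cont_intT c0.continuous)
    intro x
    have hs := sqm_pos (u := u) (w := w) hε x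
    have h1 : 0 ≤ sqm ε u w x ^ a := Real.rpow_nonneg hs.le _
    have ph' : ∀ m, pd m (fun x => sqm ε u w x ^ a * w x) x = sqm ε u w x ^ a *
        (2 * a * ((u x * pd m u x + w x * pd m w x) / sqm ε u w x) * w x + pd m w x) := by
      intro m
      rw [pd_mul (hS.diff x) (hw.diff x), pd_sqpow hu hw hε]; ring
    have e1 : ∀ m, pd m (fun x => (sqm ε u w x ^ a * w x) * pd m w x) x
        = pd m (fun x => sqm ε u w x ^ a * w x) x * pd m w x
          + sqm ε u w x ^ a * w x * pd m (pd m w) x := by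
      intro m
      rw [pd_mul (Sm.diff hh x) (Sm.diff (hw.pdi m) x)]
    have e2 : pd i (fun x => (sqm ε u w x ^ a * w x) * pd j u x) x
        = pd i (fun x => sqm ε u w x ^ a * w x) x * pd j u x
          + sqm ε u w x ^ a * w x * pd i (pd j u) x := by
      rw [pd_mul (Sm.diff hh x) (Sm.diff (hu.pdi j) x)]
    have e3 : (∑ m, pd m (fun x => (sqm ε u w x ^ a * w x) * pd m w x) x)
      - pd i (fun x => (sqm ε u w x ^ a * w x) * pd j u x) x
      = sqm ε u w x ^ a * (gr w x - (1 - δ) * (w x ^ 2 / sqm ε u w x * gr w x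
          + u x * w x / sqm ε u w x * ∑ m, pd m u x * pd m w x) - pd i w x * pd j u x
          + (1 - δ) * (u x * w x / sqm ε u w x * (pd i u x * pd j u x)
            + w x ^ 2 / sqm ε u w x * (pd i w x * pd j u x))) := by
      simp only [e1, e2, ph', ← heq x, Finset.sum_add_distrib, ← Finset.mul_sum]
      have : 1 - δ = - (2 * a) := by linarith
      rw [this]
      simp only [gr, lap, Fin.sum_univ_three]
      ring
    show δ / 2 * (sqm ε u w x ^ a * gr w x) - 2 / δ * (sqm ε u w x ^ a * gr u x) ≤
      (∑ m, pd m (fun x => (sqm ε u w x ^ a * w x) * pd m w x) x)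
      - pd i (fun x => (sqm ε u w x ^ a * w x) * pd j u x) x
    rw [e3]
    have hsing : ∀ (v : Spc → ℝ) (m : Fin 3), (pd m v x) ^ 2 ≤ gr v x := fun v m =>
      Finset.single_le_sum (f := fun m => (pd m v x) ^ 2) (fun _ _ => sq_nonneg _)
        (Finset.mem_univ m)
    have cs : ∀ y z : ℝ, |y * z| ≤ δ / 4 * y ^ 2 + z ^ 2 / δ := by
      intro y z
      rw [abs_mul, ← sq_abs y, ← sq_abs z]
      have : δ / 4 * |y| ^ 2 + |z| ^ 2 / δ - |y| * |z| = (δ / 2 * |y| - |z|) ^ 2 / δ := by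
        field_simp; ring
      have h' : 0 ≤ (δ / 2 * |y| - |z|) ^ 2 / δ := by positivity
      linarith
    have alg := ell_alg (κ := 1 - δ) (δ := δ) (θ := w x ^ 2 / sqm ε u w x)
      (η := u x * w x / sqm ε u w x) (G := gr w x) (U := gr u x)
      (P := ∑ m, pd m u x * pd m w x) (A := pd i w x * pd j u x) (B := pd i u x * pd j u x)
      hδ rfl (by linarith) (by positivity)
      (by rw [div_le_one hs]; unfold sqm; nlinarith [sq_nonneg (u x)])
      (by
        rw [abs_div, abs_of_pos hs, div_le_iff₀ hs, abs_mul]; unfold sqm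
        rw [← sq_abs (u x), ← sq_abs (w x)]
        nlinarith [sq_nonneg (|u x| - |w x|)])
      (gr_nonneg _ _) (gr_nonneg _ _)
      (by
        have : |∑ m, pd m u x * pd m w x| ≤ ∑ m, (δ / 4 * (pd m w x) ^ 2 + (pd m u x) ^ 2 / δ) := by
          refine (Finset.abs_sum_le_sum_abs _ _).trans (Finset.sum_le_sum fun m _ => ?_)
          rw [mul_comm]; exact cs _ _
        refine this.trans (le_of_eq ?_)
        rw [Finset.sum_add_distrib, ← Finset.mul_sum, ← Finset.sum_div]; rfl)
      (by
        refine (cs _ _).trans ?_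
        have := hsing w i
        have := hsing u j
        gcongr)
      (by
        rw [abs_mul]
        have h1 := hsing u i
        have h2 := hsing u j
        rw [← sq_abs] at h1 h2
        nlinarith [sq_nonneg (|pd i u x| - |pd j u x|)])
    have := mul_le_mul_of_nonneg_left alg h1
    refine le_trans (le_of_eq ?_) this
    ring
  have hd2 : 0 < δ ^ 2 := by positivity
  set I1 := ∫ x in Tdom, sqm ε u w x ^ a * gr w x
  set I2 := ∫ x in Tdom, sqm ε u w x ^ a * gr u x
  have : I1 ≤ (2 / δ) * (2 / δ * I2) := by
    have h := mul_le_mul_of_nonneg_left (sub_nonpos.1 main) (by positivity : 0 ≤ 2 / δ)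
    refine le_trans (le_of_eq ?_) h
    field_simp
  refine this.trans (le_of_eq ?_)
  field_simp; ring

end Energy


section FourierPart
open Complex

/-- Frequencies. -/
abbrev Frq : Type := Fin 3 → ℤ

/-- The linear phase. -/
def phs (k : Frq) : Spc →L[ℝ] ℂ :=
  ∑ j, (2 * Real.pi * I * (k j : ℂ)) • (Complex.ofRealCLM ∘L ContinuousLinearMap.proj j)

/-- Exponentials. -/
def ef (k : Frq) (x : Spc) : ℂ := Complex.exp (phs k x)

lemma phs_apply (k : Frq) (x : Spc) : phs k x = ∑ j, 2 * Real.pi * I * (k j : ℂ) * (x j : ℂ) := by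
  simp [phs]

lemma phs_apply' (k : Frq) (x : Spc) :
    phs k x = ((∑ j, 2 * Real.pi * (k j : ℝ) * x j : ℝ) : ℂ) * I := by
  rw [phs_apply]; push_cast; rw [Finset.sum_mul]
  exact Finset.sum_congr rfl fun j _ => by ring

lemma ef_norm (k : Frq) (x : Spc) : ‖ef k x‖ = 1 := by
  rw [ef, phs_apply', Complex.norm_exp_ofReal_mul_I]

lemma ef_per (k : Frq) : Per (ef k) := by
  intro x n
  unfold ef
  rw [Complex.exp_eq_exp_iff_exists_int]
  refine ⟨∑ j, k j * n j, ?_⟩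
  simp only [phs_apply]
  push_cast
  rw [Finset.sum_mul, ← Finset.sum_add_distrib]
  exact Finset.sum_congr rfl fun j _ => by ring

lemma ef_hasFDerivAt (k : Frq) (x : Spc) : HasFDerivAt (ef k) (ef k x • phs k) x :=
  (phs k).hasFDerivAt.cexp

lemma ef_contDiff (k : Frq) : ContDiff ℝ (⊤ : ℕ∞) (ef k) :=
  (phs k).contDiff.cexp

lemma norm_le_frq (k : Frq) (j : Fin 3) : |(k j : ℝ)| ≤ ‖k‖ := by
  have := norm_le_pi_norm k j
  rwa [Int.norm_eq_abs] at this

lemma phs_norm (k : Frq) : ‖phs k‖ ≤ 6 * Real.pi * ‖k‖ := by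
  refine ContinuousLinearMap.opNorm_le_bound _ (by positivity) fun x => ?_
  rw [phs_apply]
  refine (norm_sum_le _ _).trans ?_
  have : ∀ j ∈ Finset.univ, ‖2 * Real.pi * I * (k j : ℂ) * (x j : ℂ)‖ ≤ 2 * Real.pi * ‖k‖ * ‖x‖ := by
    intro j _
    have h1 := norm_le_frq k j
    have h2 := norm_le_pi_norm x j
    have h3 : ‖2 * Real.pi * I * (k j : ℂ) * (x j : ℂ)‖ = 2 * Real.pi * |(k j : ℝ)| * ‖x j‖ := by
      simp [abs_of_pos Real.pi_pos]
    rw [h3]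
    gcongr
  refine (Finset.sum_le_sum this).trans ?_
  simp only [Finset.sum_const, Finset.card_univ, Fintype.card_fin]
  apply le_of_eq; simp; ring

/-- Rapid decay. -/
def RD (c : Frq → ℂ) : Prop := ∀ N : ℕ, Summable fun k => (1 + ‖k‖) ^ N * ‖c k‖

/-- Fourier series. -/
def FS (c : Frq → ℂ) (x : Spc) : ℂ := ∑' k, c k * ef k x

/-- Real part of Fourier series. -/
def RS (c : Frq → ℂ) (x : Spc) : ℝ := (FS c x).re

/-- Derivative on the Fourier side. -/
def Dc (j : Fin 3) (c : Frq → ℂ) (k : Frq) : ℂ := 2 * Real.pi * I * (k j : ℂ) * c k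

variable {c : Frq → ℂ}

lemma RD.of_le (hc : RD c) {d : Frq → ℂ} (A : ℝ) (M : ℕ)
    (h : ∀ k, ‖d k‖ ≤ A * (1 + ‖k‖) ^ M * ‖c k‖) : RD d := by
  intro N
  refine Summable.of_nonneg_of_le (fun k => by positivity) (fun k => ?_) ((hc (N + M)).mul_left A)
  calc (1 + ‖k‖) ^ N * ‖d k‖ ≤ (1 + ‖k‖) ^ N * (A * (1 + ‖k‖) ^ M * ‖c k‖) := by
        gcongr; exact h k
    _ = _ := by rw [pow_add]; ring

lemma RD.summable (hc : RD c) : Summable fun k => ‖c k‖ := by simpa using hc 0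

lemma Dc_norm (j : Fin 3) (k : Frq) : ‖Dc j c k‖ ≤ 2 * Real.pi * (1 + ‖k‖) ^ 1 * ‖c k‖ := by
  have h1 := norm_le_frq k j
  have h3 : ‖Dc j c k‖ = 2 * Real.pi * |(k j : ℝ)| * ‖c k‖ := by
    simp [Dc, abs_of_pos Real.pi_pos]
  rw [h3]
  have : |(k j : ℝ)| ≤ (1 + ‖k‖) ^ 1 := by rw [pow_one]; linarith
  gcongr

lemma RD.D (hc : RD c) (j : Fin 3) : RD (Dc j c) := hc.of_le _ 1 (Dc_norm j)

lemma RD.sum_ef (hc : RD c) (x : Spc) : Summable fun k => c k * ef k x :=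
  Summable.of_norm (by simpa [ef_norm] using hc.summable)

lemma FS_hasFDerivAt (hc : RD c) (x : Spc) :
    HasFDerivAt (FS c)
      (∑ j, FS (Dc j c) x • (Complex.ofRealCLM ∘L ContinuousLinearMap.proj (R := ℝ) (φ := fun _ : Fin 3 => ℝ) j)) x := by
  have h := hasFDerivAt_tsum (𝕜 := ℝ) (u := fun k => 6 * Real.pi * ((1 + ‖k‖) ^ 1 * ‖c k‖))
    (f := fun k x => c k * ef k x) (f' := fun k x => c k • (ef k x • phs k)) (x₀ := x)
    ((hc 1).mul_left _) (fun k x => (ef_hasFDerivAt k x).const_mul (c k))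
    (fun k x => by
      rw [norm_smul, norm_smul, ef_norm, one_mul]
      have := phs_norm k
      have hp := Real.pi_pos
      have h0 := norm_nonneg k
      have h1 : ‖phs k‖ ≤ 6 * Real.pi * (1 + ‖k‖) := by nlinarith
      calc ‖c k‖ * ‖phs k‖ ≤ ‖c k‖ * (6 * Real.pi * (1 + ‖k‖)) := by gcongr
        _ = _ := by ring) (hc.sum_ef x) x
  have h2 : HasFDerivAt (FS c) (∑' k, c k • (ef k x • phs k)) x := h
  suffices e : HasSum (fun k => c k • (ef k x • phs k)) (∑ j, FS (Dc j c) x • (Complex.ofRealCLM ∘L ContinuousLinearMap.proj (R := ℝ) (φ := fun _ : Fin 3 => ℝ) j)) by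
    rw [← e.tsum_eq]; exact h2
  have : ∀ k, c k • (ef k x • phs k) = ∑ j, (Dc j c k * ef k x) •
      (Complex.ofRealCLM ∘L ContinuousLinearMap.proj (R := ℝ) (φ := fun _ : Fin 3 => ℝ) j) := by
    intro k
    rw [phs, Finset.smul_sum, Finset.smul_sum]
    refine Finset.sum_congr rfl fun j _ => ?_
    rw [smul_smul, smul_smul]
    congr 1
    simp only [Dc]; ring
  simp only [this]
  exact hasSum_sum fun j _ => ((hc.D j).sum_ef x).hasSum.smul_const _

lemma FS_contDiff (hc : RD c) : ContDiff ℝ (⊤ : ℕ∞) (FS c) := by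
  rw [contDiff_infty]
  intro n
  induction n generalizing c with
  | zero => exact contDiff_zero.2 (continuous_iff_continuousAt.2 fun x => (FS_hasFDerivAt hc x).continuousAt)
  | succ n ih =>
    have : ((n + 1 : ℕ) : WithTop ℕ∞) = (n : WithTop ℕ∞) + 1 := by push_cast; rfl
    rw [this, contDiff_succ_iff_fderiv]
    refine ⟨fun x => (FS_hasFDerivAt hc x).differentiableAt, by simp, ?_⟩
    have : fderiv ℝ (FS c) = fun x => ∑ j, FS (Dc j c) x • (Complex.ofRealCLM ∘L ContinuousLinearMap.proj (R := ℝ) (φ := fun _ : Fin 3 => ℝ) j) :=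
      funext fun x => (FS_hasFDerivAt hc x).fderiv
    rw [this]
    exact ContDiff.sum fun j _ => (ih (hc.D j)).smul contDiff_const

lemma FS_per : Per (FS c) := by
  intro x n
  unfold FS
  congr 1; funext k
  rw [ef_per k x n]

lemma RS_sm (hc : RD c) : Sm (RS c) := Complex.reCLM.contDiff.comp (FS_contDiff hc)

lemma RS_per : Per (RS c) := by
  intro x n
  unfold RS
  rw [FS_per x n]

lemma pd_RS (hc : RD c) (j : Fin 3) : pd j (RS c) = RS (Dc j c) := by
  funext x
  unfold pd
  have h := (Complex.reCLM.hasFDerivAt (x := FS c x)).comp x (FS_hasFDerivAt hc x)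
  have h' : HasFDerivAt (RS c) _ x := h
  rw [h'.fderiv]
  simp [RS, Pi.single_apply, Fin.sum_univ_three]
  fin_cases j <;> simp

lemma RS_bound (hc : RD c) (x : Spc) : |RS c x| ≤ ∑' k, ‖c k‖ := by
  refine (Complex.abs_re_le_norm _).trans ?_
  refine (norm_tsum_le_tsum_norm ?_).trans ?_
  · simpa [ef_norm] using hc.summable
  · simp [ef_norm]

lemma RS_sum {ι : Type*} (s : Finset ι) {d : ι → Frq → ℂ} (hd : ∀ i, RD (d i)) (x : Spc) :
    RS (fun k => ∑ i ∈ s, d i k) x = ∑ i ∈ s, RS (d i) x := by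
  unfold RS FS
  rw [← Complex.re_sum]
  congr 1
  rw [← Summable.tsum_finsetSum fun i _ => (hd i).sum_ef x]
  congr 1; funext k
  rw [Finset.sum_mul]

lemma RS_add {d e : Frq → ℂ} (hd : RD d) (he : RD e) (x : Spc) :
    RS (fun k => d k + e k) x = RS d x + RS e x := by
  unfold RS FS
  rw [← Complex.add_re, ← (hd.sum_ef x).tsum_add (he.sum_ef x)]
  congr 2; funext k; ring

lemma lap_RS (hc : RD c) (x : Spc) : lap (RS c) x = RS (fun k => ∑ m, Dc m (Dc m c) k) x := by
  rw [RS_sum _ fun m => (hc.D m).D m]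
  unfold lap
  simp only [pd_RS hc, pd_RS (hc.D _)]

/-- Fourier coefficients. -/
def fc (f : Spc → ℝ) (k : Frq) : ℂ := ∫ x in Tdom, (f x : ℂ) * ef (-k) x

lemma ef_neg_pd (k : Frq) (j : Fin 3) (x : Spc) :
    fderiv ℝ (ef (-k)) x (Pi.single j 1) = - (2 * Real.pi * I * (k j : ℂ)) * ef (-k) x := by
  rw [(ef_hasFDerivAt (-k) x).fderiv]
  simp [phs_apply, Pi.single_apply, Fin.sum_univ_three]
  fin_cases j <;> simp <;> ring

lemma fc_pd {f : Spc → ℝ} (hf : Sm f) (pf : Per f) (j : Fin 3) (k : Frq) :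
    fc (pd j f) k = 2 * Real.pi * I * (k j : ℂ) * fc f k := by
  have hF : ContDiff ℝ (⊤ : ℕ∞) (fun x => (f x : ℂ)) := Complex.ofRealCLM.contDiff.comp hf
  have h0 := int_pd (g := fun x => (f x : ℂ) * ef (-k) x) (Sm.one (hF.mul (ef_contDiff (-k))))
    (by intro x n; simp only [pf x n, ef_per (-k) x n]) j
  have h1 : ∀ x, pd j (fun x => (f x : ℂ) * ef (-k) x) x
      = ((pd j f x : ℝ) : ℂ) * ef (-k) x - 2 * Real.pi * I * (k j : ℂ) * ((f x : ℂ) * ef (-k) x) := by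
    intro x
    have hd : HasFDerivAt (fun x => (f x : ℂ)) (Complex.ofRealCLM ∘L fderiv ℝ f x) x :=
      Complex.ofRealCLM.hasFDerivAt.comp x (hf.diff x).hasFDerivAt
    have : HasFDerivAt (fun x => (f x : ℂ) * ef (-k) x) _ x := hd.mul (ef_hasFDerivAt (-k) x)
    unfold pd
    have hn := ef_neg_pd k j x
    rw [(ef_hasFDerivAt (-k) x).fderiv] at hn
    rw [HasFDerivAt.fderiv this]
    simp only [add_apply, smul_apply, smul_eq_mul, ContinuousLinearMap.comp_apply, Complex.ofRealCLM_apply] at hn ⊢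
    rw [hn]
    ring
  simp only [h1] at h0
  have c1 : Continuous (fun x => ((pd j f x : ℝ) : ℂ) * ef (-k) x) :=
    (Complex.continuous_ofReal.comp (hf.pdi j).continuous).mul (ef_contDiff _).continuous
  have c2 : Continuous (fun x => 2 * Real.pi * I * (k j : ℂ) * ((f x : ℂ) * ef (-k) x)) :=
    continuous_const.mul (hF.continuous.mul (ef_contDiff _).continuous)
  rw [integral_sub (cont_intT c1) (cont_intT c2), integral_const_mul, sub_eq_zero] at h0
  exact h0

lemma fc_norm (f : Spc → ℝ) (k : Frq) : ‖fc f k‖ ≤ ∫ x in Tdom, |f x| := by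
  refine (norm_integral_le_integral_norm _).trans (le_of_eq ?_)
  simp [ef_norm]

lemma fc_bound {f : Spc → ℝ} (hf : Sm f) (pf : Per f) (j : Fin 3) (N : ℕ) :
    ∃ B, ∀ k : Frq, |(k j : ℝ)| ^ N * ‖fc f k‖ ≤ B := by
  induction N generalizing f with
  | zero => exact ⟨_, fun k => by simpa using fc_norm f k⟩
  | succ n ih =>
    obtain ⟨B, hB⟩ := ih (hf.pdi j) (pf.pd j)
    refine ⟨B, fun k => le_trans ?_ (hB k)⟩
    rw [fc_pd hf pf]
    have : ‖2 * Real.pi * I * (k j : ℂ) * fc f k‖ = 2 * Real.pi * |(k j : ℝ)| * ‖fc f k‖ := by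
      simp [abs_of_pos Real.pi_pos]
    rw [this, pow_succ]
    have hpi : 1 ≤ 2 * Real.pi := by linarith [Real.pi_gt_three]
    calc |(k j : ℝ)| ^ n * |(k j : ℝ)| * ‖fc f k‖ = 1 * (|(k j : ℝ)| ^ n * |(k j : ℝ)| * ‖fc f k‖) := by ring
      _ ≤ 2 * Real.pi * (|(k j : ℝ)| ^ n * |(k j : ℝ)| * ‖fc f k‖) := by gcongr
      _ = _ := by ring

lemma fc_bound' {f : Spc → ℝ} (hf : Sm f) (pf : Per f) (N : ℕ) :
    ∃ B, ∀ k : Frq, (1 + ‖k‖) ^ N * ‖fc f k‖ ≤ B := by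
  choose B hB using fun j => fc_bound hf pf j N
  obtain ⟨B0, hB0⟩ := fc_bound hf pf 0 0
  refine ⟨2 ^ N * (B0 + ∑ j, |B j|), fun k => ?_⟩
  have h0 : ‖fc f k‖ ≤ B0 := by simpa using hB0 k
  have h1 : ‖k‖ ^ N * ‖fc f k‖ ≤ ∑ j, |B j| := by
    obtain ⟨j, hj⟩ : ∃ j, ‖k‖ ≤ |(k j : ℝ)| := by
      by_contra! hcon
      have hpos : 0 < ‖k‖ := (abs_nonneg _).trans_lt (hcon 0)
      have := (pi_norm_lt_iff hpos).2 (fun j => by rw [Int.norm_eq_abs]; exact hcon j)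
      exact lt_irrefl _ this
    calc ‖k‖ ^ N * ‖fc f k‖ ≤ |(k j : ℝ)| ^ N * ‖fc f k‖ := by gcongr
      _ ≤ B j := hB j k
      _ ≤ |B j| := le_abs_self _
      _ ≤ _ := Finset.single_le_sum (f := fun j => |B j|) (fun _ _ => abs_nonneg _) (Finset.mem_univ j)
  have h2 : (1 + ‖k‖) ^ N ≤ 2 ^ N * (1 + ‖k‖ ^ N) := by
    have := add_pow_le (zero_le_one (α := ℝ)) (norm_nonneg k) N
    rw [one_pow] at this
    refine this.trans ?_
    have : (2:ℝ) ^ (N - 1) ≤ 2 ^ N := pow_le_pow_right₀ (by norm_num) (by omega)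
    gcongr
  calc (1 + ‖k‖) ^ N * ‖fc f k‖ ≤ 2 ^ N * (1 + ‖k‖ ^ N) * ‖fc f k‖ := by gcongr
    _ = 2 ^ N * (‖fc f k‖ + ‖k‖ ^ N * ‖fc f k‖) := by ring
    _ ≤ _ := by gcongr

lemma summable_frq : Summable fun k : Frq => ((1 + ‖k‖) ^ 6)⁻¹ := by
  have h1 : Summable fun n : ℤ => ((1 + |(n : ℝ)|) ^ 2)⁻¹ := by
    have hn : Summable fun n : ℕ => ((1 + (n : ℝ)) ^ 2)⁻¹ := by
      have := (summable_nat_add_iff 1).2 (Real.summable_nat_pow_inv (p := 2).2 (by norm_num))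
      refine this.congr fun n => ?_
      push_cast; rw [add_comm]
    refine Summable.of_nat_of_neg ?_ ?_
    · simpa using hn
    · simpa using hn
  have hnn : ∀ n : ℤ, 0 ≤ ((1 + |(n : ℝ)|) ^ 2)⁻¹ := fun n => by positivity
  have h2 := h1.mul_of_nonneg (h1.mul_of_nonneg h1 hnn hnn) hnn
    (fun x => mul_nonneg (hnn _) (hnn _))
  have hinj : Function.Injective fun k : Frq => (k 0, (k 1, k 2)) := by
    intro k l h
    simp only [Prod.mk.injEq] at h
    funext i; fin_cases i
    exacts [h.1, h.2.1, h.2.2]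
  refine Summable.of_nonneg_of_le (fun k => by positivity) (fun k => ?_) (h2.comp_injective hinj)
  simp only [Function.comp]
  rw [← mul_inv, ← mul_inv]
  apply inv_anti₀ (by positivity)
  have e := norm_le_frq k
  calc (1 + |(k 0 : ℝ)|) ^ 2 * ((1 + |(k 1 : ℝ)|) ^ 2 * (1 + |(k 2 : ℝ)|) ^ 2)
      ≤ (1 + ‖k‖) ^ 2 * ((1 + ‖k‖) ^ 2 * (1 + ‖k‖) ^ 2) := by
        gcongr <;> exact e _
    _ = _ := by ring

lemma fc_RD {f : Spc → ℝ} (hf : Sm f) (pf : Per f) : RD (fc f) := by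
  intro N
  obtain ⟨B, hB⟩ := fc_bound' hf pf (N + 6)
  refine Summable.of_nonneg_of_le (fun k => by positivity) (fun k => ?_) (summable_frq.mul_left B)
  have hp : 0 < (1 + ‖k‖) ^ 6 := by positivity
  rw [← div_eq_mul_inv, le_div_iff₀ hp]
  refine le_trans (le_of_eq ?_) (hB k)
  rw [pow_add]; ring

lemma tor_quot : Topology.IsQuotientMap tor := by
  have h : IsOpenQuotientMap (Pi.map (fun (_ : Fin 3) (x : ℝ) => (x : UnitAddCircle))) :=
    IsOpenQuotientMap.piMap fun _ => QuotientAddGroup.isOpenQuotientMap_mk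
  exact h.isQuotientMap

lemma mFourier_tor (k : Frq) (x : Spc) : UnitAddTorus.mFourier k (fun i => (x i : UnitAddCircle)) = ef k x := by
  simp only [UnitAddTorus.mFourier, ContinuousMap.coe_mk, fourier_coe_apply]
  rw [← Complex.exp_sum, ef, phs_apply]
  simp

lemma FS_fc {f : Spc → ℝ} (hf : Sm f) (pf : Per f) (x : Spc) : FS (fc f) x = f x := by
  have pF : Per (fun x => (f x : ℂ)) := fun x n => by simp only [pf x n]
  have hcont : Continuous (tlift fun x => (f x : ℂ)) := by
    rw [tor_quot.continuous_iff]
    have : (tlift fun x => (f x : ℂ)) ∘ tor = fun x => (f x : ℂ) := funext fun x => tlift_tor pF x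
    rw [this]
    exact Complex.continuous_ofReal.comp hf.continuous
  let F : C(UnitAddTorus (Fin 3), ℂ) := ⟨_, hcont⟩
  have hco : ∀ k, UnitAddTorus.mFourierCoeff F k = fc f k := by
    intro k
    rw [UnitAddTorus.mFourierCoeff_eq_integral F k 0, fc, setIntegral_congr_set Tdom_ae_Ioc]
    congr 1
    funext y
    rw [mFourier_tor, smul_eq_mul, mul_comm]
    congr 1
    exact tlift_tor pF y
  have hs : Summable (UnitAddTorus.mFourierCoeff F) := by
    refine Summable.of_norm ?_
    simp only [hco]
    exact (fc_RD hf pf).summable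
  have := (UnitAddTorus.hasSum_mFourier_series_apply_of_summable hs (tor x)).tsum_eq
  simp only [hco] at this
  have e : F (tor x) = f x := tlift_tor pF x
  rw [← e, ← this, FS]
  congr 1; funext k
  rw [smul_eq_mul, ← mFourier_tor]; rfl

lemma RS_fc {f : Spc → ℝ} (hf : Sm f) (pf : Per f) : RS (fc f) = f := by
  funext x
  rw [RS, FS_fc hf pf, Complex.ofReal_re]

end FourierPart


section FlowPart
open Complex Filter Topology

/-- Symbol of minus the Laplacian. -/
def nsq (k : Frq) : ℝ := 4 * Real.pi ^ 2 * ∑ j, (k j : ℝ) ^ 2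

lemma nsq_nonneg (k : Frq) : 0 ≤ nsq k := by unfold nsq; positivity

lemma nsq_pos {k : Frq} (hk : k ≠ 0) : 0 < nsq k := by
  obtain ⟨j, hj⟩ : ∃ j, k j ≠ 0 := by
    by_contra! h; exact hk (funext h)
  unfold nsq
  have h1 : (0:ℝ) < (k j : ℝ) ^ 2 := by positivity
  have h2 : (k j : ℝ) ^ 2 ≤ ∑ j, (k j : ℝ) ^ 2 :=
    Finset.single_le_sum (f := fun j => (k j : ℝ) ^ 2) (fun _ _ => sq_nonneg _) (Finset.mem_univ j)
  have : 0 < ∑ j, (k j : ℝ) ^ 2 := h1.trans_le h2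
  positivity

lemma nsq_zero : nsq 0 = 0 := by simp [nsq]

lemma Dc_lap (c : Frq → ℂ) (k : Frq) : ∑ m, Dc m (Dc m c) k = -(nsq k : ℂ) * c k := by
  simp only [Dc, nsq]
  push_cast
  have h : ∀ m : Fin 3, 2 * (Real.pi : ℂ) * I * (k m : ℂ) * (2 * Real.pi * I * (k m : ℂ) * c k)
      = -4 * Real.pi ^ 2 * c k * (k m : ℂ) ^ 2 := by
    intro m
    have := Complex.I_sq
    linear_combination (4 * Real.pi ^ 2 * (k m : ℂ) ^ 2 * c k) * this
  simp only [h]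
  rw [← Finset.mul_sum]; ring

/-- Heat flow on the Fourier side. -/
def Ht (t : ℝ) (c : Frq → ℂ) (k : Frq) : ℂ := (Real.exp (-(nsq k) * t) : ℂ) * c k

/-- Laplacian on the Fourier side. -/
def Lc (c : Frq → ℂ) (k : Frq) : ℂ := -(nsq k : ℂ) * c k

variable {c : Frq → ℂ}

lemma Ht_norm {t : ℝ} (ht : 0 ≤ t) (k : Frq) : ‖Ht t c k‖ ≤ ‖c k‖ := by
  rw [Ht, norm_mul, Complex.norm_real, Real.norm_eq_abs, Real.abs_exp]
  have : Real.exp (-(nsq k) * t) ≤ 1 := by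
    rw [Real.exp_le_one_iff]
    have := mul_nonneg (nsq_nonneg k) ht
    linarith
  exact mul_le_of_le_one_left (norm_nonneg _) this

lemma RD.H (hc : RD c) {t : ℝ} (ht : 0 ≤ t) : RD (Ht t c) :=
  hc.of_le 1 0 fun k => by simpa using Ht_norm ht k

lemma RD.L (hc : RD c) : RD (Lc c) := by
  have : Lc c = fun k => ∑ m, Dc m (Dc m c) k := funext fun k => (Dc_lap c k).symm
  rw [this]
  intro N
  refine Summable.of_nonneg_of_le (fun k => by positivity) (fun k => ?_)
    (summable_sum (s := Finset.univ) fun m _ => ((hc.D m).D m) N)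
  rw [← Finset.mul_sum]
  gcongr
  exact norm_sum_le _ _

lemma lap_RS' (hc : RD c) (x : Spc) : lap (RS c) x = RS (Lc c) x := by
  rw [lap_RS hc]
  congr 1
  funext k; exact Dc_lap c k

lemma Lc_Ht (t : ℝ) : Lc (Ht t c) = Ht t (Lc c) := by
  funext k; simp only [Lc, Ht]; ring

lemma Ht_zero : Ht 0 c = c := by
  funext k; simp [Ht]

lemma Ht_hasDerivAt (hc : RD c) {t : ℝ} (ht : 0 < t) (x : Spc) :
    HasDerivAt (fun t => RS (Ht t c) x) (lap (RS (Ht t c)) x) t := by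
  rw [lap_RS' (hc.H ht.le), Lc_Ht]
  have h : HasDerivAt (fun t => FS (Ht t c) x) (FS (Ht t (Lc c)) x) t := by
    unfold FS
    refine hasDerivAt_tsum_of_isPreconnected (u := fun k => ‖Lc c k‖) (t := Set.Ioi (0:ℝ)) (y₀ := t)
      (g := fun k t => Ht t c k * ef k x) (g' := fun k t => Ht t (Lc c) k * ef k x)
      hc.L.summable isOpen_Ioi (convex_Ioi 0).isPreconnected ?_ ?_ ht ((hc.H ht.le).sum_ef x) ht
    · intro k s _
      have h1 : HasDerivAt (fun s : ℝ => Real.exp (-(nsq k) * s)) (Real.exp (-(nsq k) * s) * (-(nsq k))) s := by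
        have := ((hasDerivAt_id s).const_mul (-(nsq k))).exp
        simpa using this
      have h2 := ((h1.ofReal_comp).mul_const (c k)).mul_const (ef k x)
      refine HasDerivAt.congr_deriv h2 ?_
      simp only [Ht, Lc]; push_cast; ring
    · intro k s hs
      rw [norm_mul, ef_norm, mul_one]
      exact Ht_norm (le_of_lt hs) k
  exact (Complex.reCLM.hasFDerivAt (x := FS (Ht t c) x)).comp_hasDerivAt t h

lemma Ht_tendsto (hc : RD c) {l : Filter ℝ} (hl : ∀ᶠ t in l, 0 ≤ t) {d : Frq → ℂ}
    (hd : ∀ k, Tendsto (fun t => Ht t c k) l (𝓝 (d k))) (x : Spc) :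
    Tendsto (fun t => RS (Ht t c) x) l (𝓝 (RS d x)) := by
  refine (Complex.continuous_re.tendsto _).comp ?_
  unfold FS
  refine tendsto_tsum_of_dominated_convergence (bound := fun k => ‖c k‖) hc.summable ?_ ?_
  · intro k; exact (hd k).mul_const _
  · filter_upwards [hl] with t ht k
    rw [norm_mul, ef_norm, mul_one]
    exact Ht_norm ht k

lemma Ht_cont (k : Frq) : Continuous fun t => Ht t c k := by
  unfold Ht; fun_prop

lemma Ht_tendsto_top (k : Frq) :
    Tendsto (fun t => Ht t c k) atTop (𝓝 (if k = 0 then c 0 else 0)) := by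
  by_cases hk : k = 0
  · subst hk; simp [Ht, nsq_zero]
  · simp only [hk, if_false]
    unfold Ht
    have h1 : Tendsto (fun t => Real.exp (-(nsq k) * t)) atTop (𝓝 0) :=
      Real.tendsto_exp_atBot.comp (tendsto_id.const_mul_atTop_of_neg (by linarith [nsq_pos hk]))
    have h2 := ((Complex.continuous_ofReal.tendsto 0).comp h1).mul_const (c k)
    simpa using h2

lemma RS_const (z : ℂ) (x : Spc) : RS (fun k => if k = 0 then z else 0) x = z.re := by
  unfold RS FS
  rw [tsum_eq_single 0]
  · simp [ef, phs_apply]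
  · intro k hk; simp [hk]

/-- The energy functional. -/
def En (ε q : ℝ) (a b : Frq → ℂ) (t : ℝ) : ℝ :=
  ∫ x in Tdom, sqm ε (RS (Ht t a)) (RS (Ht t b)) x ^ q

variable {a b : Frq → ℂ} {ε : ℝ}

lemma sqm_bound (ha : RD a) (hb : RD b) (x : Spc) :
    sqm ε (RS a) (RS b) x ≤ (∑' k, ‖a k‖) ^ 2 + (∑' k, ‖b k‖) ^ 2 + ε := by
  unfold sqm
  have h1 := RS_bound ha x
  have h2 := RS_bound hb x
  have h3 := sq_le_sq' (abs_le.1 h1).1 (abs_le.1 h1).2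
  have h4 := sq_le_sq' (abs_le.1 h2).1 (abs_le.1 h2).2
  linarith

lemma Ht_tsum (ha : RD a) {t : ℝ} (ht : 0 ≤ t) : ∑' k, ‖Ht t a k‖ ≤ ∑' k, ‖a k‖ :=
  (ha.H ht).summable.tsum_le_tsum (Ht_norm ht) ha.summable

lemma RSHt_bound (ha : RD a) {t : ℝ} (ht : 0 ≤ t) (x : Spc) : |RS (Ht t a) x| ≤ ∑' k, ‖a k‖ :=
  (RS_bound (ha.H ht) x).trans (Ht_tsum ha ht)

lemma sqmHt_bound (ha : RD a) (hb : RD b) {t : ℝ} (ht : 0 ≤ t) (x : Spc) :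
    sqm ε (RS (Ht t a)) (RS (Ht t b)) x ≤ (∑' k, ‖a k‖) ^ 2 + (∑' k, ‖b k‖) ^ 2 + ε := by
  unfold sqm
  have h1 := RSHt_bound ha ht x
  have h2 := RSHt_bound hb ht x
  have h3 := sq_le_sq' (abs_le.1 h1).1 (abs_le.1 h1).2
  have h4 := sq_le_sq' (abs_le.1 h2).1 (abs_le.1 h2).2
  linarith

lemma En_tendsto (ha : RD a) (hb : RD b) (hε : 0 < ε) {q : ℝ} (hq : 0 < q) {l : Filter ℝ}
    [l.IsCountablyGenerated] (hl : ∀ᶠ t in l, 0 ≤ t) {a' b' : Frq → ℂ}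
    (hd : ∀ k, Tendsto (fun t => Ht t a k) l (𝓝 (a' k)))
    (he : ∀ k, Tendsto (fun t => Ht t b k) l (𝓝 (b' k))) :
    Tendsto (En ε q a b) l (𝓝 (∫ x in Tdom, sqm ε (RS a') (RS b') x ^ q)) := by
  unfold En
  refine tendsto_integral_filter_of_dominated_convergence
    (fun _ => ((∑' k, ‖a k‖) ^ 2 + (∑' k, ‖b k‖) ^ 2 + ε) ^ q) ?_ ?_ (integrable_const _) ?_
  · filter_upwards [hl] with t ht
    exact (Sm.sqpow (RS_sm (ha.H ht)) (RS_sm (hb.H ht)) hε q).continuous.aestronglyMeasurable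
  · filter_upwards [hl] with t ht
    refine ae_of_all _ fun x => ?_
    have hp := sqm_pos (u := RS (Ht t a)) (w := RS (Ht t b)) hε x
    rw [Real.norm_eq_abs, abs_of_nonneg (Real.rpow_nonneg hp.le _)]
    exact Real.rpow_le_rpow hp.le (sqmHt_bound ha hb ht x) hq.le
  · refine ae_of_all _ fun x => ?_
    have h : Tendsto (fun t => sqm ε (RS (Ht t a)) (RS (Ht t b)) x) l (𝓝 (sqm ε (RS a') (RS b') x)) :=
      (((Ht_tendsto ha hl hd x).pow 2).add ((Ht_tendsto hb hl he x).pow 2)).add_const ε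
    exact h.rpow_const (Or.inr hq.le)

lemma En_hasDerivAt (ha : RD a) (hb : RD b) (hε : 0 < ε) {p α : ℝ} (hp : 0 < p) (hα : α ≤ 0)
    (hpα : p / 2 - 1 = α) {t : ℝ} (ht : 0 < t) :
    HasDerivAt (En ε (p / 2) a b) (p * ∫ x in Tdom, sqm ε (RS (Ht t a)) (RS (Ht t b)) x ^ α *
      (RS (Ht t a) x * lap (RS (Ht t a)) x + RS (Ht t b) x * lap (RS (Ht t b)) x)) t := by
  rw [← integral_const_mul]
  have hnn : ∀ d : Frq → ℂ, 0 ≤ ∑' k, ‖d k‖ := fun d => tsum_nonneg fun _ => norm_nonneg _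
  refine (hasDerivAt_integral_of_dominated_loc_of_deriv_le (μ := volume.restrict Tdom)
    (F := fun t x => sqm ε (RS (Ht t a)) (RS (Ht t b)) x ^ (p / 2))
    (F' := fun t x => p * (sqm ε (RS (Ht t a)) (RS (Ht t b)) x ^ α *
      (RS (Ht t a) x * lap (RS (Ht t a)) x + RS (Ht t b) x * lap (RS (Ht t b)) x)))
    (x₀ := t) (s := Set.Ioi 0)
    (bound := fun _ => p * (ε ^ α * ((∑' k, ‖a k‖) * (∑' k, ‖Lc a k‖) + (∑' k, ‖b k‖) * (∑' k, ‖Lc b k‖))))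
    (Ioi_mem_nhds ht) ?_ ?_ ?_ ?_ (integrable_const _) ?_).2
  · filter_upwards [Ioi_mem_nhds ht] with s hs
    have hs' : (0:ℝ) ≤ s := le_of_lt hs
    exact (Sm.sqpow (RS_sm (ha.H hs')) (RS_sm (hb.H hs')) hε _).continuous.aestronglyMeasurable
  · exact cont_intT (Sm.sqpow (RS_sm (ha.H ht.le)) (RS_sm (hb.H ht.le)) hε _).continuous
  · have h1 := RS_sm (ha.H ht.le)
    have h2 := RS_sm (hb.H ht.le)
    have h3 := Sm.lap h1
    have h4 := Sm.lap h2
    exact (continuous_const.mul ((Sm.sqpow h1 h2 hε α).continuous.mul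
      ((h1.continuous.mul h3.continuous).add (h2.continuous.mul h4.continuous)))).aestronglyMeasurable
  · refine ae_of_all _ fun x s hs => ?_
    have hs' : (0:ℝ) ≤ s := le_of_lt hs
    have hpos := sqm_pos (u := RS (Ht s a)) (w := RS (Ht s b)) hε x
    have e1 := RSHt_bound ha hs' x
    have e2 := RSHt_bound hb hs' x
    have e3 := RSHt_bound ha.L hs' x
    have e4 := RSHt_bound hb.L hs' x
    rw [lap_RS' (ha.H hs'), lap_RS' (hb.H hs'), Lc_Ht, Lc_Ht, Real.norm_eq_abs, abs_mul, abs_mul,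
      abs_of_pos hp, abs_of_nonneg (Real.rpow_nonneg hpos.le _)]
    have e5 : sqm ε (RS (Ht s a)) (RS (Ht s b)) x ^ α ≤ ε ^ α := by
      refine Real.rpow_le_rpow_of_nonpos hε ?_ hα
      unfold sqm; nlinarith [sq_nonneg (RS (Ht s a) x), sq_nonneg (RS (Ht s b) x)]
    gcongr
    refine (abs_add_le _ _).trans ?_
    rw [abs_mul, abs_mul]
    gcongr
  · refine ae_of_all _ fun x s hs => ?_
    have hpos := sqm_pos (u := RS (Ht s a)) (w := RS (Ht s b)) hε x
    have d1 := Ht_hasDerivAt ha hs x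
    have d2 := Ht_hasDerivAt hb hs x
    have d3 : HasDerivAt (fun t => sqm ε (RS (Ht t a)) (RS (Ht t b)) x) _ s :=
      ((d1.pow 2).add (d2.pow 2)).add_const ε
    have d4 := d3.rpow_const (p := p / 2) (Or.inl hpos.ne')
    refine HasDerivAt.congr_deriv d4 ?_
    rw [hpα]
    simp only [Nat.cast_ofNat, Nat.add_one_sub_one, pow_one]
    ring

end FlowPart


section FlowMain
open Complex Filter Topology

variable {a b : Frq → ℂ} {ε : ℝ}

lemma Ht_Dc (t : ℝ) (i : Fin 3) (c : Frq → ℂ) : Dc i (Ht t c) = Ht t (Dc i c) := by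
  funext k; simp only [Dc, Ht]; ring

lemma RD_zero : RD (0 : Frq → ℂ) := fun N => by simp

lemma RS_Ht_zero (t : ℝ) : RS (Ht t (0 : Frq → ℂ)) = 0 := by
  funext x; simp [RS, FS, Ht]

lemma En_cont (ha : RD a) (hb : RD b) (hε : 0 < ε) {q : ℝ} (hq : 0 < q) :
    ContinuousOn (En ε q a b) (Set.Ici 0) := by
  intro t ht
  have h := En_tendsto ha hb hε hq (l := 𝓝[Set.Ici 0] t) (self_mem_nhdsWithin)
    (fun k => (Ht_cont (c := a) k).continuousWithinAt) (fun k => (Ht_cont (c := b) k).continuousWithinAt)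
  exact h

lemma flow_eps (ha : RD a) (hb : RD b) (hb0 : b 0 = 0) (i j : Fin 3)
    (heq : Lc b = Dc i (Dc j a)) {p : ℝ} (hp1 : 1 < p) (hp2 : p ≤ 2) (hε : 0 < ε) :
    ∫ x in Tdom, sqm ε (RS a) (RS b) x ^ (p / 2)
      ≤ ((1 + 4 / (p - 1) ^ 2) / (p - 1)) * ∫ x in Tdom, sqm ε (RS a) 0 x ^ (p / 2) := by
  set δ := p - 1 with hδ
  have hδ0 : 0 < δ := by linarith
  set α := p / 2 - 1 with hα
  have hα0 : α ≤ 0 := by linarith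
  have had : 1 + 2 * α = δ := by rw [hα, hδ]; ring
  set A := (1 + 4 / δ ^ 2) / δ with hA
  have hA1 : 1 ≤ A := by
    rw [hA, le_div_iff₀ hδ0]
    have : 0 ≤ 4 / δ ^ 2 := by positivity
    linarith
  have hp0 : 0 < p / 2 := by linarith
  have hpp : 0 < p := by linarith
  let Ξ : ℝ → ℝ := fun t => En ε (p / 2) a b t - A * En ε (p / 2) a 0 t
  have hcont : ContinuousOn Ξ (Set.Ici 0) :=
    (En_cont ha hb hε hp0).sub (continuousOn_const.mul (En_cont ha RD_zero hε hp0))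
  have hder : ∀ t, 0 < t → ∃ d, 0 ≤ d ∧ HasDerivAt Ξ d t := by
    intro t ht
    have d1 := En_hasDerivAt ha hb hε hpp hα0 hα.symm ht
    have d2 := En_hasDerivAt ha RD_zero hε hpp hα0 hα.symm ht
    refine ⟨_, ?_, d1.sub (d2.const_mul A)⟩
    have hu := RS_sm (ha.H ht.le)
    have hw := RS_sm (hb.H ht.le)
    have hz : Sm (0 : Spc → ℝ) := contDiff_const
    have pu : Per (RS (Ht t a)) := RS_per
    have pw : Per (RS (Ht t b)) := RS_per
    have hel : ∀ x, lap (RS (Ht t b)) x = pd i (pd j (RS (Ht t a))) x := by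
      intro x
      rw [lap_RS' (hb.H ht.le), pd_RS (ha.H ht.le), pd_RS ((ha.H ht.le).D j), Lc_Ht, heq, Ht_Dc, Ht_Dc]
    have e1 := energyA hu hw pu pw hε hα0
    have e2 := energyB hu pu hε hα0
    have e3 := elliptic hu hw pu pw hε hα0 hδ0 had i j hel
    rw [had] at e2
    have hgu := (Sm.gr hu).continuous
    have hgw := (Sm.gr hw).continuous
    have hS := (Sm.sqpow (ε := ε) hu hw hε α).continuous
    have hS0 := (Sm.sqpow (ε := ε) hu hz hε α).continuous
    have e4 : ∫ x in Tdom, sqm ε (RS (Ht t a)) (RS (Ht t b)) x ^ α * gr (RS (Ht t a)) x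
        ≤ ∫ x in Tdom, sqm ε (RS (Ht t a)) 0 x ^ α * gr (RS (Ht t a)) x := by
      refine integral_mono (cont_intT (hS.mul hgu)) (cont_intT (hS0.mul hgu)) fun x => ?_
      refine mul_le_mul_of_nonneg_right ?_ (gr_nonneg _ _)
      refine Real.rpow_le_rpow_of_nonpos (sqm_pos hε x) ?_ hα0
      unfold sqm
      have := sq_nonneg (RS (Ht t b) x)
      simp only [Pi.zero_apply]; linarith
    have e5 : ∫ x in Tdom, sqm ε (RS (Ht t a)) (RS (Ht t b)) x ^ α * (gr (RS (Ht t a)) x + gr (RS (Ht t b)) x)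
        = (∫ x in Tdom, sqm ε (RS (Ht t a)) (RS (Ht t b)) x ^ α * gr (RS (Ht t a)) x)
          + ∫ x in Tdom, sqm ε (RS (Ht t a)) (RS (Ht t b)) x ^ α * gr (RS (Ht t b)) x := by
      simp only [mul_add]
      exact integral_add (cont_intT (hS.mul hgu)) (cont_intT (hS.mul hgw))
    simp only [RS_Ht_zero, Pi.zero_apply, zero_mul, add_zero]
    rw [e5] at e1
    have hAδ : A * δ = 1 + 4 / δ ^ 2 := by rw [hA]; field_simp
    generalize (∫ x in Tdom, sqm ε (RS (Ht t a)) (RS (Ht t b)) x ^ α * gr (RS (Ht t a)) x) = X at *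
    generalize (∫ x in Tdom, sqm ε (RS (Ht t a)) (RS (Ht t b)) x ^ α * gr (RS (Ht t b)) x) = Y at *
    generalize (∫ x in Tdom, sqm ε (RS (Ht t a)) 0 x ^ α * gr (RS (Ht t a)) x) = Z at *
    generalize (∫ x in Tdom, sqm ε (RS (Ht t a)) (RS (Ht t b)) x ^ α *
      (RS (Ht t a) x * lap (RS (Ht t a)) x + RS (Ht t b) x * lap (RS (Ht t b)) x)) = U at *
    generalize (∫ x in Tdom, sqm ε (RS (Ht t a)) 0 x ^ α * (RS (Ht t a) x * lap (RS (Ht t a)) x)) = V at *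
    have f1 : A * V ≤ A * (-(δ * Z)) := mul_le_mul_of_nonneg_left e2 (by linarith)
    have f2 : A * (-(δ * Z)) = -((1 + 4 / δ ^ 2) * Z) := by rw [← hAδ]; ring
    have f3 : (1 + 4 / δ ^ 2) * X ≤ (1 + 4 / δ ^ 2) * Z := mul_le_mul_of_nonneg_left e4 (by positivity)
    have f4 : 0 ≤ U - A * V := by
      have : (1 + 4 / δ ^ 2) * X = X + 4 / δ ^ 2 * X := by ring
      linarith
    have : p * U - A * (p * V) = p * (U - A * V) := by ring
    rw [this]; positivity
  have hmono : MonotoneOn Ξ (Set.Ici 0) := by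
    refine monotoneOn_of_deriv_nonneg (convex_Ici 0) hcont ?_ ?_
    · intro t ht
      rw [interior_Ici] at ht
      obtain ⟨d, _, hd⟩ := hder t ht
      exact hd.differentiableAt.differentiableWithinAt
    · intro t ht
      rw [interior_Ici] at ht
      obtain ⟨d, h0, hd⟩ := hder t ht
      rw [hd.deriv]; exact h0
  have hlim : Tendsto Ξ atTop (𝓝 ((1 - A) * ((a 0).re ^ 2 + ε) ^ (p / 2))) := by
    have h1 := En_tendsto ha hb hε hp0 (eventually_ge_atTop 0) Ht_tendsto_top Ht_tendsto_top
    have h2 := En_tendsto ha RD_zero hε hp0 (eventually_ge_atTop 0) Ht_tendsto_top Ht_tendsto_top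
    have h3 := h1.sub (h2.const_mul A)
    refine h3.congr' (Eventually.of_forall fun t => rfl) |>.trans (le_of_eq ?_)
    congr 1
    simp only [sqm, RS_const, hb0, Pi.zero_apply, Complex.zero_re, integral_const, smul_eq_mul]
    simp
    ring
  have hfin : Ξ 0 ≤ (1 - A) * ((a 0).re ^ 2 + ε) ^ (p / 2) := by
    refine ge_of_tendsto hlim ?_
    filter_upwards [eventually_ge_atTop 0] with t ht
    exact hmono (Set.mem_Ici.2 le_rfl) ht ht
  have hneg : (1 - A) * ((a 0).re ^ 2 + ε) ^ (p / 2) ≤ 0 :=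
    mul_nonpos_of_nonpos_of_nonneg (by linarith) (by positivity)
  have : Ξ 0 = (∫ x in Tdom, sqm ε (RS a) (RS b) x ^ (p / 2)) - A * ∫ x in Tdom, sqm ε (RS a) 0 x ^ (p / 2) := by
    simp only [Ξ, En, RS_Ht_zero, Ht_zero]
  linarith

lemma cont_abs_rpow {f : Spc → ℝ} (hf : Continuous f) {p : ℝ} (hp : 0 < p) :
    Continuous fun x => |f x| ^ p :=
  hf.abs.rpow_const fun _ => Or.inr hp.le

lemma abs_rpow_eq (y p : ℝ) : |y| ^ p = (y ^ 2) ^ (p / 2) := by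
  rw [← sq_abs, ← Real.rpow_natCast, ← Real.rpow_mul (abs_nonneg _)]
  congr 1; push_cast; ring

lemma flow_main (ha : RD a) (hb : RD b) (hb0 : b 0 = 0) (i j : Fin 3)
    (heq : Lc b = Dc i (Dc j a)) {p : ℝ} (hp1 : 1 < p) (hp2 : p ≤ 2) :
    ∫ x in Tdom, |RS b x| ^ p ≤ ((1 + 4 / (p - 1) ^ 2) / (p - 1)) * ∫ x in Tdom, |RS a x| ^ p := by
  set A := (1 + 4 / (p - 1) ^ 2) / (p - 1) with hA
  have hA0 : 0 ≤ A := by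
    have : 0 < p - 1 := by linarith
    positivity
  have hp0 : 0 < p := by linarith
  have hu := RS_sm ha
  have hw := RS_sm hb
  have hz : Sm (0 : Spc → ℝ) := contDiff_const
  have cu := cont_abs_rpow hu.continuous hp0
  have cw := cont_abs_rpow hw.continuous hp0
  have key : ∀ η : ℝ, 0 < η → ∫ x in Tdom, |RS b x| ^ p ≤ A * ((∫ x in Tdom, |RS a x| ^ p) + η) := by
    intro η hη
    set ε := η ^ (2 / p) with hε
    have hε0 : 0 < ε := by positivity
    have hεp : ε ^ (p / 2) = η := by
      rw [hε, ← Real.rpow_mul hη.le]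
      have : 2 / p * (p / 2) = 1 := by field_simp
      rw [this, Real.rpow_one]
    have h := flow_eps ha hb hb0 i j heq hp1 hp2 hε0
    have h1 : ∫ x in Tdom, |RS b x| ^ p ≤ ∫ x in Tdom, sqm ε (RS a) (RS b) x ^ (p / 2) := by
      refine integral_mono (cont_intT cw) (cont_intT (Sm.sqpow hu hw hε0 _).continuous) fun x => ?_
      show |RS b x| ^ p ≤ _
      rw [abs_rpow_eq]
      refine Real.rpow_le_rpow (sq_nonneg _) ?_ (by linarith)
      unfold sqm; nlinarith [sq_nonneg (RS a x)]
    have h2 : ∫ x in Tdom, sqm ε (RS a) 0 x ^ (p / 2) ≤ (∫ x in Tdom, |RS a x| ^ p) + η := by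
      have : (∫ x in Tdom, |RS a x| ^ p) + η = ∫ x in Tdom, (|RS a x| ^ p + η) := by
        rw [integral_add (cont_intT cu) (integrable_const _)]; simp
      rw [this]
      refine integral_mono (cont_intT (Sm.sqpow hu hz hε0 _).continuous) (cont_intT (cu.add continuous_const)) fun x => ?_
      show sqm ε (RS a) 0 x ^ (p / 2) ≤ |RS a x| ^ p + η
      rw [abs_rpow_eq, ← hεp]
      have : sqm ε (RS a) 0 x = RS a x ^ 2 + ε := by simp [sqm]
      rw [this]
      exact Real.rpow_add_le_add_rpow (sq_nonneg _) hε0.le (by linarith) (by linarith)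
    exact h1.trans (h.trans (by gcongr))
  have hl : Tendsto (fun η => A * ((∫ x in Tdom, |RS a x| ^ p) + η)) (𝓝[>] 0)
      (𝓝 (A * ((∫ x in Tdom, |RS a x| ^ p) + 0))) := by
    refine tendsto_nhdsWithin_of_tendsto_nhds ?_
    exact (tendsto_const_nhds.add tendsto_id).const_mul A
  rw [add_zero] at hl
  refine ge_of_tendsto hl ?_
  filter_upwards [self_mem_nhdsWithin] with η hη
  exact key η hη

end FlowMain


section CZPart
open Complex Filter Topology

/-- Inverse Laplacian on the Fourier side. -/
def Nc (c : Frq → ℂ) (k : Frq) : ℂ := -((nsq k)⁻¹ : ℝ) * c k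

variable {c : Frq → ℂ}

lemma nsq_ge_one {k : Frq} (hk : k ≠ 0) : 1 ≤ nsq k := by
  obtain ⟨j, hj⟩ : ∃ j, k j ≠ 0 := by
    by_contra! h; exact hk (funext h)
  unfold nsq
  have h1 : (1:ℝ) ≤ (k j : ℝ) ^ 2 := by
    have h0 : 0 < (k j) ^ 2 := lt_of_le_of_ne (sq_nonneg _) (pow_ne_zero 2 hj).symm
    have : 1 ≤ (k j) ^ 2 := h0
    exact_mod_cast this
  have h2 : (k j : ℝ) ^ 2 ≤ ∑ j, (k j : ℝ) ^ 2 :=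
    Finset.single_le_sum (f := fun j => (k j : ℝ) ^ 2) (fun _ _ => sq_nonneg _) (Finset.mem_univ j)
  have h3 : 1 ≤ 4 * Real.pi ^ 2 := by nlinarith [Real.pi_gt_three]
  exact one_le_mul_of_one_le_of_one_le h3 (h1.trans h2)

lemma RD.N (hc : RD c) : RD (Nc c) := by
  refine hc.of_le 1 0 fun k => ?_
  simp only [Nc, norm_mul, norm_neg, Complex.norm_real, pow_zero, mul_one]
  gcongr
  by_cases hk : k = 0
  · subst hk; simp [nsq_zero]
  · rw [Real.norm_eq_abs, abs_of_nonneg (inv_nonneg.2 (nsq_nonneg k))]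
    exact inv_le_one_of_one_le₀ (nsq_ge_one hk)

lemma Lc_Nc (k : Frq) : Lc (Nc c) k = if k = 0 then 0 else c k := by
  by_cases hk : k = 0
  · subst hk; simp [Lc, nsq_zero]
  · have : (nsq k : ℂ) ≠ 0 := by exact_mod_cast (nsq_pos hk).ne'
    simp only [Lc, Nc, hk, if_false]
    push_cast
    field_simp

/-- The solution of the Poisson equation. -/
def phi (f : Spc → ℝ) : Spc → ℝ := RS (Nc (fc f))

variable {f : Spc → ℝ}

lemma phi_sm (hf : Sm f) (pf : Per f) : Sm (phi f) := RS_sm (fc_RD hf pf).N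

lemma phi_per : Per (phi f) := RS_per

lemma fc_zero (f : Spc → ℝ) : fc f 0 = ((∫ x in Tdom, f x : ℝ) : ℂ) := by
  have h : ∀ x, (f x : ℂ) * ef (-0) x = ((f x : ℝ) : ℂ) := fun x => by simp [ef, phs_apply]
  unfold fc
  simp only [h]
  exact integral_ofReal

lemma RD_single (z : ℂ) : RD fun k => if k = 0 then z else 0 := by
  intro N
  refine summable_of_ne_finset_zero (s := {0}) fun k hk => ?_
  have : k ≠ 0 := by simpa using hk
  simp [this]

lemma lap_phi (hf : Sm f) (pf : Per f) (x : Spc) : lap (phi f) x = f x - ∫ y in Tdom, f y := by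
  have hc := fc_RD hf pf
  unfold phi
  rw [lap_RS' hc.N]
  have h := RS_add hc.N.L (RD_single (fc f 0)) x
  have e : (fun k => Lc (Nc (fc f)) k + if k = 0 then fc f 0 else 0) = fc f := by
    funext k
    rw [Lc_Nc]
    by_cases hk : k = 0
    · simp [hk]
    · simp [hk]
  rw [e, RS_const, RS_fc hf pf, fc_zero, Complex.ofReal_re] at h
  linarith

lemma pd_pd_phi (hf : Sm f) (pf : Per f) (i j : Fin 3) :
    pd i (pd j (phi f)) = RS (Dc i (Dc j (Nc (fc f)))) := by
  unfold phi
  rw [pd_RS (fc_RD hf pf).N, pd_RS ((fc_RD hf pf).N.D j)]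

lemma cz_low (hf : Sm f) (pf : Per f) (i j : Fin 3) {p : ℝ} (hp1 : 1 < p) (hp2 : p ≤ 2) :
    ∫ x in Tdom, |pd i (pd j (phi f)) x| ^ p
      ≤ ((1 + 4 / (p - 1) ^ 2) / (p - 1)) * ∫ x in Tdom, |f x| ^ p := by
  have hc := fc_RD hf pf
  rw [pd_pd_phi hf pf]
  have h := flow_main hc ((hc.N.D j).D i) (by simp [Dc]) i j ?_ hp1 hp2
  · rw [RS_fc hf pf] at h; exact h
  · funext k
    have : Lc (Dc i (Dc j (Nc (fc f)))) k
        = 2 * Real.pi * I * (k i : ℂ) * (2 * Real.pi * I * (k j : ℂ) * Lc (Nc (fc f)) k) := by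
      simp only [Lc, Dc]; ring
    rw [this, Lc_Nc]
    by_cases hk : k = 0
    · subst hk; simp [Dc]
    · simp only [hk, if_false, Dc]

lemma ibp {u v : Spc → ℝ} (hu : Sm u) (hv : Sm v) (pu : Per u) (pv : Per v) (j : Fin 3) :
    ∫ x in Tdom, pd j u x * v x = -∫ x in Tdom, u x * pd j v x := by
  have h := int_pd (g := fun x => u x * v x) (Sm.one (hu.mul hv)) (fun x k => by simp only [pu x k, pv x k]) j
  have e : ∀ x, pd j (fun x => u x * v x) x = pd j u x * v x + u x * pd j v x := by
    intro x
    have := pd_mul (j := j) (Sm.diff hu x) (Sm.diff hv x)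
    exact this.trans (by ring)
  simp only [e] at h
  have c1 : Continuous (fun x => pd j u x * v x) := (hu.pdi j).continuous.mul hv.continuous
  have c2 : Continuous (fun x => u x * pd j v x) := hu.continuous.mul (hv.pdi j).continuous
  rw [integral_add (cont_intT c1) (cont_intT c2)] at h
  linarith

lemma Dc_comm (i j : Fin 3) (c : Frq → ℂ) : Dc i (Dc j c) = Dc j (Dc i c) := by
  funext k; simp only [Dc]; ring

lemma pd_comm_RS (hc : RD c) (i j : Fin 3) : pd i (pd j (RS c)) = pd j (pd i (RS c)) := by
  rw [pd_RS hc, pd_RS hc, pd_RS (hc.D _), pd_RS (hc.D _), Dc_comm]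

lemma ibp4 {a b : Frq → ℂ} (ha : RD a) (hb : RD b) (i j m : Fin 3) :
    ∫ x in Tdom, pd i (pd j (RS a)) x * pd m (pd m (RS b)) x
      = ∫ x in Tdom, pd m (pd m (RS a)) x * pd i (pd j (RS b)) x := by
  have hu := RS_sm ha
  have hv := RS_sm hb
  have pu : Per (RS a) := RS_per
  have pv : Per (RS b) := RS_per
  rw [ibp (hu.pdi j) ((hv.pdi m).pdi m) (pu.pd j) ((pv.pd m).pd m) i]
  have e1 : pd i (pd m (pd m (RS b))) = pd m (pd i (pd m (RS b))) := by
    rw [pd_RS hb, pd_comm_RS (hb.D m)]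
  have h2 := ibp (hu.pdi j) ((hv.pdi m).pdi i) (pu.pd j) ((pv.pd m).pd i) m
  rw [e1, ← h2, pd_comm_RS ha m j, ibp (hu.pdi m) ((hv.pdi m).pdi i) (pu.pd m) ((pv.pd m).pd i) j]
  have e2 : pd j (pd i (pd m (RS b))) = pd m (pd i (pd j (RS b))) := by
    rw [pd_comm_RS hb i m, pd_RS hb, pd_comm_RS (hb.D i) j m, ← pd_RS hb, pd_comm_RS hb j i]
  rw [e2, ← ibp (hu.pdi m) ((hv.pdi j).pdi i) (pu.pd m) ((pv.pd j).pd i) m]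

lemma dual_id {g : Spc → ℝ} (hf : Sm f) (pf : Per f) (hg : Sm g) (pg : Per g)
    (f0 : ∫ x in Tdom, f x = 0) (i j : Fin 3) :
    ∫ x in Tdom, pd i (pd j (phi f)) x * g x = ∫ x in Tdom, f x * pd i (pd j (phi g)) x := by
  have hF := phi_sm hf pf
  have hG := phi_sm hg pg
  have cF : ∀ i j, Continuous (pd i (pd j (phi f))) := fun i j => ((hF.pdi j).pdi i).continuous
  have cG : ∀ i j, Continuous (pd i (pd j (phi g))) := fun i j => ((hG.pdi j).pdi i).continuous
  set m := ∫ y in Tdom, g y with hm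
  have e1 : ∀ x, g x = lap (phi g) x + m := fun x => by rw [lap_phi hg pg]; ring
  have e2 : ∀ x, f x = lap (phi f) x := fun x => by rw [lap_phi hf pf, f0]; ring
  have h0 : ∫ x in Tdom, pd i (pd j (phi f)) x = 0 :=
    int_pd (Sm.one (hF.pdi j)) (phi_per.pd j) i
  have l1 : ∫ x in Tdom, pd i (pd j (phi f)) x * g x
      = ∫ x in Tdom, pd i (pd j (phi f)) x * lap (phi g) x := by
    have c1 : Continuous (fun x => pd i (pd j (phi f)) x * lap (phi g) x) := (cF i j).mul hG.lap.continuous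
    have c2 : Continuous (fun x => pd i (pd j (phi f)) x * m) := (cF i j).mul continuous_const
    calc _ = ∫ x in Tdom, (pd i (pd j (phi f)) x * lap (phi g) x + pd i (pd j (phi f)) x * m) := by
          congr 1; funext x; rw [e1 x]; ring
      _ = _ := by
          rw [integral_add (cont_intT c1) (cont_intT c2), integral_mul_const, h0]; ring
  rw [l1]
  simp only [e2]
  unfold lap
  simp only [Finset.mul_sum, Finset.sum_mul]
  have c1 : ∀ m, Continuous (fun x => pd i (pd j (phi f)) x * pd m (pd m (phi g)) x) :=
    fun m => (cF i j).mul (cG m m)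
  have c2 : ∀ m, Continuous (fun x => pd m (pd m (phi f)) x * pd i (pd j (phi g)) x) :=
    fun m => (cF m m).mul (cG i j)
  rw [integral_finsetSum _ fun m _ => cont_intT (c1 m), integral_finsetSum _ fun m _ => cont_intT (c2 m)]
  exact Finset.sum_congr rfl fun m _ => ibp4 (fc_RD hf pf).N (fc_RD hg pg).N i j m

lemma radd_pow {a b r : ℝ} (ha : 0 ≤ a) (hb : 0 ≤ b) (hr : 1 ≤ r) :
    (a + b) ^ r ≤ 2 ^ (r - 1) * (a ^ r + b ^ r) := by
  lift a to NNReal using ha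
  lift b to NNReal using hb
  exact_mod_cast NNReal.rpow_add_le_mul_rpow_add_rpow a b hr

lemma cz_high {p : ℝ} (hp : 2 ≤ p) : ∃ C : ℝ, 0 ≤ C ∧ ∀ f : Spc → ℝ, Sm f → Per f →
    ∫ x in Tdom, f x = 0 → ∀ i j, ∫ x in Tdom, |pd i (pd j (phi f)) x| ^ p ≤ C * ∫ x in Tdom, |f x| ^ p := by
  set q := p / (p - 1) with hq
  have hp1 : 0 < p - 1 := by linarith
  have hp0 : 0 < p := by linarith
  have hq1 : 1 < q := by rw [hq, lt_div_iff₀ hp1]; linarith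
  have hq2 : q ≤ 2 := by rw [hq, div_le_iff₀ hp1]; linarith
  have hq0 : 0 < q := by linarith
  have hpq : p.HolderConjugate q := by
    rw [Real.holderConjugate_iff]
    refine ⟨by linarith, ?_⟩
    rw [hq]; field_simp; ring
  have hpq' : (p - 1) * q = p := by rw [hq]; field_simp
  set A := (1 + 4 / (q - 1) ^ 2) / (q - 1) with hA
  have hA0 : 0 < A := by
    have : 0 < q - 1 := by linarith
    positivity
  set B : ℝ := 2 ^ (p / 2 - 1) with hB
  have hB0 : 0 < B := by positivity
  set L : ℝ := (2 * A * B) ^ q⁻¹ with hL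
  have hL0 : 0 < L := by positivity
  have hLq : L ^ q = 2 * A * B := by
    rw [hL, ← Real.rpow_mul (by positivity), inv_mul_cancel₀ hq0.ne', Real.rpow_one]
  refine ⟨2 * L ^ p, by positivity, ?_⟩
  intro f hf pf f0 i j
  have hF := phi_sm hf pf
  have hw : Sm (pd i (pd j (phi f))) := (hF.pdi j).pdi i
  have pw : Per (pd i (pd j (phi f))) := (phi_per.pd j).pd i
  set w := pd i (pd j (phi f)) with hwdef
  have hz : Sm (0 : Spc → ℝ) := contDiff_const
  have pz : Per (0 : Spc → ℝ) := fun _ _ => rfl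
  have cw := cont_abs_rpow hw.continuous hp0
  have cf := cont_abs_rpow hf.continuous hp0
  refine le_of_forall_pos_le_add fun η hη => ?_
  set ε := η ^ (2 / p) with hε
  have hε0 : 0 < ε := by positivity
  have hεp : ε ^ (p / 2) = η := by
    rw [hε, ← Real.rpow_mul hη.le]
    have : 2 / p * (p / 2) = 1 := by field_simp
    rw [this, Real.rpow_one]
  have hS := fun e => Sm.sqpow (ε := ε) hw hz hε0 e
  have es : ∀ x, sqm ε w 0 x = w x ^ 2 + ε := fun x => by simp [sqm]
  have hg : Sm (fun x => sqm ε w 0 x ^ (p / 2 - 1) * w x) := (hS _).mul hw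
  have pg : Per (fun x => sqm ε w 0 x ^ (p / 2 - 1) * w x) := by
    intro x k
    simp only [Per.sqm pw pz x k, pw x k]
  set g := fun x => sqm ε w 0 x ^ (p / 2 - 1) * w x with hgdef
  have hG := phi_sm hg pg
  have hv : Sm (pd i (pd j (phi g))) := (hG.pdi j).pdi i
  have cv := cont_abs_rpow hv.continuous hq0
  have cg := cont_abs_rpow hg.continuous hq0
  have s1 : ∫ x in Tdom, |w x| ^ p ≤ ∫ x in Tdom, w x * g x := by
    refine integral_mono (cont_intT cw) (cont_intT (hw.continuous.mul hg.continuous)) fun x => ?_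
    show |w x| ^ p ≤ w x * g x
    have e : |w x| ^ p = (w x ^ 2) ^ (p / 2 - 1) * w x ^ 2 := by
      rw [abs_rpow_eq]
      conv_lhs => rw [show p / 2 = (p / 2 - 1) + 1 by ring]
      rw [Real.rpow_add_of_nonneg (sq_nonneg _) (by linarith) (by norm_num), Real.rpow_one]
    rw [e, hgdef]
    simp only [es]
    have : (w x ^ 2) ^ (p / 2 - 1) ≤ (w x ^ 2 + ε) ^ (p / 2 - 1) :=
      Real.rpow_le_rpow (sq_nonneg _) (by linarith) (by linarith)
    nlinarith [sq_nonneg (w x)]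
  have s2 : ∫ x in Tdom, w x * g x = ∫ x in Tdom, f x * pd i (pd j (phi g)) x :=
    dual_id hf pf hg pg f0 i j
  have s3 : ∫ x in Tdom, f x * pd i (pd j (phi g)) x
      ≤ L ^ p * (∫ x in Tdom, |f x| ^ p) + (L ^ q)⁻¹ * ∫ x in Tdom, |pd i (pd j (phi g)) x| ^ q := by
    have c1 : Continuous fun x => L ^ p * |f x| ^ p := continuous_const.mul cf
    have c2 : Continuous fun x => (L ^ q)⁻¹ * |pd i (pd j (phi g)) x| ^ q := continuous_const.mul cv
    rw [← integral_const_mul, ← integral_const_mul, ← integral_add (cont_intT c1) (cont_intT c2)]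
    refine integral_mono (cont_intT (hf.continuous.mul hv.continuous)) (cont_intT (c1.add c2)) fun x => ?_
    show f x * pd i (pd j (phi g)) x ≤ L ^ p * |f x| ^ p + (L ^ q)⁻¹ * |pd i (pd j (phi g)) x| ^ q
    have y := Real.young_inequality (L * f x) (L⁻¹ * pd i (pd j (phi g)) x) hpq
    have y1 : L * f x * (L⁻¹ * pd i (pd j (phi g)) x) = f x * pd i (pd j (phi g)) x := by
      field_simp
    rw [y1, abs_mul, abs_mul, abs_of_pos hL0, abs_of_pos (inv_pos.2 hL0),
      Real.mul_rpow hL0.le (abs_nonneg _), Real.mul_rpow (inv_pos.2 hL0).le (abs_nonneg _),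
      Real.inv_rpow hL0.le] at y
    refine y.trans (add_le_add ?_ ?_)
    · exact div_le_self (by positivity) (by linarith)
    · exact div_le_self (by positivity) (by linarith)
  have s4 := cz_low hg pg i j hq1 hq2
  have s5 : ∫ x in Tdom, |g x| ^ q ≤ ∫ x in Tdom, (B * |w x| ^ p + B * η) := by
    refine integral_mono (cont_intT cg) (cont_intT ((continuous_const.mul cw).add continuous_const)) fun x => ?_
    show |g x| ^ q ≤ B * |w x| ^ p + B * η
    have hpos : 0 < w x ^ 2 + ε := by positivity
    have g1 : |g x| ≤ (w x ^ 2 + ε) ^ ((p - 1) / 2) := by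
      rw [hgdef]
      simp only [es]
      rw [abs_mul, abs_of_pos (Real.rpow_pos_of_pos hpos _)]
      have : (p - 1) / 2 = (p / 2 - 1) + 1 / 2 := by ring
      rw [this, Real.rpow_add hpos, ← Real.sqrt_eq_rpow]
      gcongr
      apply Real.abs_le_sqrt
      linarith
    have g2 : |g x| ^ q ≤ (w x ^ 2 + ε) ^ (p / 2) := by
      refine (Real.rpow_le_rpow (abs_nonneg _) g1 hq0.le).trans (le_of_eq ?_)
      rw [← Real.rpow_mul hpos.le]
      congr 1
      linear_combination hpq' / 2
    refine g2.trans ?_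
    rw [← mul_add, abs_rpow_eq, ← hεp]
    exact radd_pow (sq_nonneg _) hε0.le (by linarith)
  have s6 : ∫ x in Tdom, (B * |w x| ^ p + B * η) = B * (∫ x in Tdom, |w x| ^ p) + B * η := by
    have c1 : Continuous fun x => B * |w x| ^ p := continuous_const.mul cw
    rw [integral_add (cont_intT c1) (integrable_const _), integral_const_mul]
    simp
  rw [s6] at s5
  rw [s2] at s1
  rw [← hA] at s4
  generalize (∫ x in Tdom, |w x| ^ p) = N at *
  generalize (∫ x in Tdom, |f x| ^ p) = F at *
  generalize (∫ x in Tdom, |g x| ^ q) = G at *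
  generalize (∫ x in Tdom, |pd i (pd j (phi g)) x| ^ q) = V at *
  have t1 : V ≤ A * (B * N + B * η) := s4.trans (by gcongr)
  have t2 : (L ^ q)⁻¹ * V ≤ (L ^ q)⁻¹ * (A * (B * N + B * η)) := by gcongr
  have t3 : (L ^ q)⁻¹ * (A * (B * N + B * η)) = (N + η) / 2 := by
    rw [hLq]; field_simp
  linarith

lemma cz {p : ℝ} (hp : 1 < p) : ∃ C : ℝ, 0 ≤ C ∧ ∀ f : Spc → ℝ, Sm f → Per f →
    ∫ x in Tdom, f x = 0 → ∀ i j, ∫ x in Tdom, |pd i (pd j (phi f)) x| ^ p ≤ C * ∫ x in Tdom, |f x| ^ p := by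
  rcases le_total p 2 with h | h
  · refine ⟨(1 + 4 / (p - 1) ^ 2) / (p - 1), ?_, fun f hf pf _ i j => cz_low hf pf i j hp h⟩
    have : 0 < p - 1 := by linarith
    positivity
  · exact cz_high h

end CZPart


section Morrey
open Set

variable {E : Type*} [NormedAddCommGroup E] [NormedSpace ℝ E] [CompleteSpace E]

instance probI : IsProbabilityMeasure ((volume : Measure ℝ).restrict (Ioc 0 1)) := by
  constructor; simp

lemma cont_int2 {h : Spc × ℝ → ℝ} (hh : Continuous h) :
    Integrable h (((volume : Measure Spc).restrict Tdom).prod ((volume : Measure ℝ).restrict (Ioc 0 1))) := by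
  rw [Measure.prod_restrict]
  exact (hh.continuousOn.integrableOn_compact (isCompact_Icc.prod isCompact_Icc)).mono_set
    (prod_mono Tdom_subset_Icc Ioc_subset_Icc_self)

lemma cont_int3 {h : Spc × (Spc × ℝ) → ℝ} (hh : Continuous h) :
    Integrable h (((volume : Measure Spc).restrict Tdom).prod
      (((volume : Measure Spc).restrict Tdom).prod ((volume : Measure ℝ).restrict (Ioc 0 1)))) := by
  rw [Measure.prod_restrict, Measure.prod_restrict]
  exact (hh.continuousOn.integrableOn_compact (isCompact_Icc.prod (isCompact_Icc.prod isCompact_Icc))).mono_set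
    (prod_mono Tdom_subset_Icc (prod_mono Tdom_subset_Icc Ioc_subset_Icc_self))

lemma jensen {Ω : Type*} [MeasurableSpace Ω] {μ : Measure Ω} [IsProbabilityMeasure μ] {h : Ω → ℝ} {p : ℝ}
    (hp : 1 ≤ p) (h0 : ∀ x, 0 ≤ h x) (hi : Integrable h μ) (hip : Integrable (fun x => h x ^ p) μ) :
    (∫ x, h x ∂μ) ^ p ≤ ∫ x, h x ^ p ∂μ := by
  have := (convexOn_rpow hp).map_integral_le (μ := μ) (f := h)
    (Real.continuous_rpow_const (by linarith)).continuousOn isClosed_Ici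
    (Filter.Eventually.of_forall h0) hi hip
  exact this

lemma mean_bound {g : Spc → E} (hg : ContDiff ℝ 1 g) (pg : Per g) (g0 : ∫ x in Tdom, g x = 0) (x : Spc) :
    ‖g x‖ ≤ ∫ z : Spc × ℝ, ‖fderiv ℝ g (x + z.2 • z.1)‖
      ∂(((volume : Measure Spc).restrict Tdom).prod ((volume : Measure ℝ).restrict (Ioc 0 1))) := by
  have cD : Continuous fun x => ‖fderiv ℝ g x‖ := (hg.continuous_fderiv (by simp)).norm
  have c2 : Continuous fun z : Spc × ℝ => ‖fderiv ℝ g (x + z.2 • z.1)‖ := cD.comp (by fun_prop)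
  have cg := hg.continuous
  have cg1 : Continuous fun y => g (x + y) := cg.comp (by fun_prop)
  have hi := cont_int2 c2
  rw [integral_prod _ hi]
  have e1 : ∫ y in Tdom, g (x + y) = 0 := by
    rw [← g0, ← int_translate pg x]
    congr 1; funext y; rw [add_comm]
  have e2 : ∫ y in Tdom, (g (x + y) - g x) = - g x := by
    rw [integral_sub (cont_intT cg1) (integrable_const _), e1]; simp
  rw [← norm_neg, ← e2]
  refine (norm_integral_le_integral_norm _).trans ?_
  have c3 : Continuous fun y => ‖g (x + y) - g x‖ := (cg1.sub continuous_const).norm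
  refine setIntegral_mono_on (cont_intT c3) hi.integral_prod_left Tdom_meas fun y hy => ?_
  have hy1 : ‖y‖ ≤ 1 := by
    rw [pi_norm_le_iff_of_nonneg zero_le_one]
    intro i
    have := hy i trivial
    rw [Real.norm_eq_abs, abs_of_nonneg this.1]; exact this.2.le
  have hd : ∀ τ : ℝ, HasDerivAt (fun τ : ℝ => g (x + τ • y)) (fderiv ℝ g (x + τ • y) y) τ := by
    intro τ
    have h1 : HasDerivAt (fun τ : ℝ => x + τ • y) y τ := by
      have := ((hasDerivAt_id τ).smul_const y).const_add x
      simpa using this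
    exact ((hg.differentiable (by simp) (x + τ • y)).hasFDerivAt).comp_hasDerivAt τ h1
  have cl : Continuous fun τ : ℝ => fderiv ℝ g (x + τ • y) y :=
    ((hg.continuous_fderiv (by simp)).comp (by fun_prop : Continuous fun τ : ℝ => x + τ • y)).clm_apply continuous_const
  have hft := intervalIntegral.integral_eq_sub_of_hasDerivAt (a := 0) (b := 1) (fun τ _ => hd τ)
    (cl.intervalIntegrable 0 1)
  simp only [one_smul, zero_smul, add_zero] at hft
  rw [← hft, intervalIntegral.integral_of_le zero_le_one]
  refine (norm_integral_le_integral_norm _).trans ?_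
  have cr : Continuous fun τ : ℝ => ‖fderiv ℝ g (x + τ • y)‖ := cD.comp (by fun_prop)
  refine integral_mono (cl.norm.integrableOn_Ioc) cr.integrableOn_Ioc fun τ => ?_
  exact (ContinuousLinearMap.le_opNorm _ _).trans (mul_le_of_le_one_right (norm_nonneg _) hy1)

lemma poincare {g : Spc → E} (hg : ContDiff ℝ 1 g) (pg : Per g) (g0 : ∫ x in Tdom, g x = 0) {p : ℝ} (hp : 1 ≤ p) :
    ∫ x in Tdom, ‖g x‖ ^ p ≤ ∫ x in Tdom, ‖fderiv ℝ g x‖ ^ p := by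
  have hp0 : 0 ≤ p := by linarith
  have cD : Continuous fun x => ‖fderiv ℝ g x‖ := (hg.continuous_fderiv (by simp)).norm
  have cDp : Continuous fun x => ‖fderiv ℝ g x‖ ^ p := cD.rpow_const fun _ => Or.inr hp0
  have c3 : Continuous fun z : Spc × (Spc × ℝ) => ‖fderiv ℝ g (z.1 + z.2.2 • z.2.1)‖ ^ p :=
    cDp.comp (by fun_prop)
  have hi := cont_int3 c3
  have pD : Per fun x => ‖fderiv ℝ g x‖ ^ p := fun x k => by simp only [pg.fderiv x k]
  have s1 : ∀ x, ‖g x‖ ^ p ≤ ∫ z : Spc × ℝ, ‖fderiv ℝ g (x + z.2 • z.1)‖ ^ p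
      ∂(((volume : Measure Spc).restrict Tdom).prod ((volume : Measure ℝ).restrict (Ioc 0 1))) := by
    intro x
    refine (Real.rpow_le_rpow (norm_nonneg _) (mean_bound hg pg g0 x) hp0).trans ?_
    refine jensen hp (fun _ => norm_nonneg _) (cont_int2 (cD.comp (by fun_prop))) (cont_int2 ?_)
    exact cDp.comp (by fun_prop : Continuous fun z : Spc × ℝ => x + z.2 • z.1)
  refine (integral_mono (cont_intT (hg.continuous.norm.rpow_const fun _ => Or.inr hp0)) hi.integral_prod_left s1).trans ?_
  rw [integral_integral_swap hi]
  have : ∀ z : Spc × ℝ, ∫ x in Tdom, ‖fderiv ℝ g (x + z.2 • z.1)‖ ^ p = ∫ x in Tdom, ‖fderiv ℝ g x‖ ^ p :=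
    fun z => int_translate pD _
  simp only [this]
  simp

lemma dilate {h : Spc → ℝ} (hc : Continuous h) (ph : Per h) (h0 : ∀ x, 0 ≤ h x) {τ : ℝ} (hτ : 0 < τ) (hτ1 : τ ≤ 1)
    (x : Spc) : ∫ y in Tdom, h (x + τ • y) ≤ (τ ^ 3)⁻¹ * ∫ y in Tdom, h y := by
  have e := Measure.setIntegral_comp_smul_of_pos (volume : Measure Spc) (fun y => h (x + y)) Tdom hτ
  rw [e]
  simp only [Module.finrank_fintype_fun_eq_card, Fintype.card_fin, smul_eq_mul]
  have ht : ∫ y in Tdom, h y = ∫ y in Tdom, h (x + y) := by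
    rw [← int_translate ph x]; congr 1; funext y; rw [add_comm]
  rw [ht]
  refine mul_le_mul_of_nonneg_left ?_ (by positivity)
  refine setIntegral_mono_set (cont_intT (hc.comp (by fun_prop))) (ae_of_all _ fun y => h0 _) ?_
  refine LE.le.eventuallyLE ?_
  rintro _ ⟨y, hy, rfl⟩
  intro i _
  have := hy i trivial
  simp only [Pi.smul_apply, smul_eq_mul]
  exact ⟨mul_nonneg hτ.le this.1, by nlinarith [this.1, this.2]⟩

lemma morrey {g : Spc → E} (hg : ContDiff ℝ 1 g) (pg : Per g) (g0 : ∫ x in Tdom, g x = 0) {p : ℝ} (hp : 3 < p) (x : Spc) :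
    ‖g x‖ ≤ (1 - 3 / p)⁻¹ * (∫ x in Tdom, ‖fderiv ℝ g x‖ ^ p) ^ p⁻¹ := by
  have hp0 : 0 < p := by linarith
  have cD : Continuous fun x => ‖fderiv ℝ g x‖ := (hg.continuous_fderiv (by simp)).norm
  have cDp : Continuous fun x => ‖fderiv ℝ g x‖ ^ p := cD.rpow_const fun _ => Or.inr hp0.le
  have pD : Per fun x => ‖fderiv ℝ g x‖ ^ p := fun x k => by simp only [pg.fderiv x k]
  have hi := cont_int2 (h := fun z : Spc × ℝ => ‖fderiv ℝ g (x + z.2 • z.1)‖) (cD.comp (by fun_prop))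
  set M := ∫ x in Tdom, ‖fderiv ℝ g x‖ ^ p with hM
  have hM0 : 0 ≤ M := integral_nonneg fun _ => by positivity
  have h3p : 3 / p < 1 := by rw [div_lt_one hp0]; exact hp
  refine (mean_bound hg pg g0 x).trans ?_
  rw [integral_prod_symm _ hi]
  have hr : IntervalIntegrable (fun τ : ℝ => τ ^ (-(3 / p))) volume 0 1 :=
    intervalIntegral.intervalIntegrable_rpow' (by linarith)
  have hr' : IntegrableOn (fun τ : ℝ => τ ^ (-(3 / p))) (Ioc 0 1) :=
    (intervalIntegrable_iff_integrableOn_Ioc_of_le zero_le_one).1 hr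
  have key : ∀ τ ∈ Ioc (0:ℝ) 1, ∫ y in Tdom, ‖fderiv ℝ g (x + τ • y)‖ ≤ τ ^ (-(3 / p)) * M ^ p⁻¹ := by
    intro τ hτ
    have cτ : Continuous fun y : Spc => x + τ • y := by fun_prop
    have j := jensen (μ := volume.restrict Tdom) (p := p) (by linarith) (fun y => norm_nonneg (fderiv ℝ g (x + τ • y)))
      (cont_intT (cD.comp cτ)) (cont_intT (cDp.comp cτ))
    have d := dilate cDp pD (fun _ => by positivity) hτ.1 hτ.2 x
    have n0 : 0 ≤ ∫ y in Tdom, ‖fderiv ℝ g (x + τ • y)‖ := integral_nonneg fun _ => norm_nonneg _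
    have := Real.rpow_le_rpow (Real.rpow_nonneg n0 _) (j.trans d) (inv_nonneg.2 hp0.le)
    rw [Real.rpow_rpow_inv n0 hp0.ne', Real.mul_rpow (by have := hτ.1; positivity) hM0] at this
    refine this.trans (le_of_eq ?_)
    congr 1
    rw [← Real.rpow_natCast, ← Real.rpow_neg hτ.1.le, ← Real.rpow_mul hτ.1.le]
    congr 1
    push_cast; ring
  refine (setIntegral_mono_on hi.integral_prod_right (hr'.mul_const _) measurableSet_Ioc key).trans (le_of_eq ?_)
  rw [integral_mul_const, ← intervalIntegral.integral_of_le zero_le_one, integral_rpow (Or.inl (by linarith))]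
  rw [Real.one_rpow, Real.zero_rpow (by linarith)]
  congr 1
  rw [sub_zero, one_div]; congr 1; ring

end Morrey


section Assembly

/-- Components of the tensor field. -/
def Qt (f : Spc → Spc) (x : Spc) (j l : Fin 3) : ℝ :=
  pd j (phi fun y => f y l) x + pd l (phi fun y => f y j) x
    - if j = l then ∑ m, pd m (phi fun y => f y m) x else 0

lemma fc_add' {f g : Spc → ℝ} (hf : Continuous f) (hg : Continuous g) :
    fc (fun x => f x + g x) = fun k => fc f k + fc g k := by
  funext k
  unfold fc
  have c1 : Continuous fun x => (f x : ℂ) * ef (-k) x :=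
    (Complex.continuous_ofReal.comp hf).mul (ef_contDiff _).continuous
  have c2 : Continuous fun x => (g x : ℂ) * ef (-k) x :=
    (Complex.continuous_ofReal.comp hg).mul (ef_contDiff _).continuous
  rw [← integral_add (cont_intT c1) (cont_intT c2)]
  congr 1; funext x; push_cast; ring

lemma fc_smul' (r : ℝ) (f : Spc → ℝ) : fc (fun x => r * f x) = fun k => (r : ℂ) * fc f k := by
  funext k
  unfold fc
  rw [← integral_const_mul]
  congr 1; funext x; push_cast; ring

lemma RS_smul' (r : ℝ) (c : Frq → ℂ) (x : Spc) : RS (fun k => (r : ℂ) * c k) x = r * RS c x := by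
  unfold RS FS
  simp only [mul_assoc]
  rw [tsum_mul_left, Complex.re_ofReal_mul]

lemma phi_add {f g : Spc → ℝ} (hf : Sm f) (pf : Per f) (hg : Sm g) (pg : Per g) (j : Fin 3) (x : Spc) :
    pd j (phi fun y => f y + g y) x = pd j (phi f) x + pd j (phi g) x := by
  have hF := phi_sm hf pf
  have hG := phi_sm hg pg
  rw [← pd_add (Sm.diff hF x) (Sm.diff hG x)]
  congr 1
  funext y
  unfold phi
  rw [fc_add' hf.continuous hg.continuous, ← RS_add (fc_RD hf pf).N (fc_RD hg pg).N]
  congr 1; funext k; simp only [Nc]; ring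

lemma phi_smul (r : ℝ) {f : Spc → ℝ} (hf : Sm f) (pf : Per f) (j : Fin 3) (x : Spc) :
    pd j (phi fun y => r * f y) x = r * pd j (phi f) x := by
  have e : (phi fun y => r * f y) = fun y => r * phi f y := by
    funext y
    unfold phi
    rw [fc_smul', ← RS_smul']
    congr 1; funext k; simp only [Nc]; ring
  rw [e]
  unfold pd
  rw [fderiv_const_mul (Sm.diff (phi_sm hf pf) x)]
  rfl

/-- Smooth periodic fields. -/
def VV : Submodule ℝ (Spc → Spc) where
  carrier := {f | ContDiff ℝ (⊤ : ℕ∞) f ∧ Per f}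
  zero_mem' := ⟨contDiff_const, fun _ _ => rfl⟩
  add_mem' := fun {a b} ha hb => ⟨ha.1.add hb.1, fun x k => by
    simp only [Pi.add_apply, ha.2 x k, hb.2 x k]⟩
  smul_mem' := fun c a ha => ⟨contDiff_const.smul ha.1, fun x k => by
    simp only [Pi.smul_apply, ha.2 x k]⟩

lemma comp_sm {f : Spc → Spc} (hf : ContDiff ℝ (⊤ : ℕ∞) f) (l : Fin 3) : Sm fun x => f x l :=
  contDiff_pi.1 hf l

lemma comp_per {f : Spc → Spc} (hf : Per f) (l : Fin 3) : Per fun x => f x l :=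
  fun x k => by simp only [hf x k]

/-- The linear solution operator on smooth fields. -/
def T0 : VV →ₗ[ℝ] (Spc → Fin 3 → Fin 3 → ℝ) where
  toFun f := Qt f.1
  map_add' f g := by
    funext x j l
    have h : ∀ m n, pd m (phi fun y => f.1 y n + g.1 y n) x
        = pd m (phi fun y => f.1 y n) x + pd m (phi fun y => g.1 y n) x := fun m n =>
      phi_add (comp_sm f.2.1 n) (comp_per f.2.2 n) (comp_sm g.2.1 n) (comp_per g.2.2 n) m x
    simp only [Qt, Submodule.coe_add, Pi.add_apply, h, Finset.sum_add_distrib]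
    split_ifs <;> ring
  map_smul' r f := by
    funext x j l
    have h : ∀ m n, pd m (phi fun y => r * f.1 y n) x = r * pd m (phi fun y => f.1 y n) x := fun m n =>
      phi_smul r (comp_sm f.2.1 n) (comp_per f.2.2 n) m x
    simp only [Qt, Submodule.coe_smul, Pi.smul_apply, smul_eq_mul, h, ← Finset.mul_sum, RingHom.id_apply]
    split_ifs <;> ring

variable {f : Spc → Spc}

lemma Qt_sm_comp (hf : ContDiff ℝ (⊤ : ℕ∞) f) (pf : Per f) (j l : Fin 3) : Sm fun x => Qt f x j l := by
  have h : ∀ m n, Sm (pd m (phi fun y => f y n)) := fun m n =>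
    (phi_sm (comp_sm hf n) (comp_per pf n)).pdi m
  unfold Qt
  refine ((h j l).add (h l j)).sub ?_
  split_ifs
  · exact ContDiff.sum fun m _ => h m m
  · exact contDiff_const

lemma Qt_sm (hf : ContDiff ℝ (⊤ : ℕ∞) f) (pf : Per f) : ContDiff ℝ (⊤ : ℕ∞) (Qt f) :=
  contDiff_pi.2 fun j => contDiff_pi.2 fun l => Qt_sm_comp hf pf j l

lemma Qt_per : Per (Qt f) := by
  intro x k
  funext j l
  have h : ∀ m n, pd m (phi fun y => f y n) (fun i => x i + (k i : ℝ)) = pd m (phi fun y => f y n) x :=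
    fun m n => phi_per.pd m x k
  simp only [Qt, h]

lemma Qt_symm (x : Spc) (j l : Fin 3) : Qt f x j l = Qt f x l j := by
  simp only [Qt, eq_comm (a := j) (b := l)]
  ring

lemma pd_Qt (hf : ContDiff ℝ (⊤ : ℕ∞) f) (pf : Per f) (i j l : Fin 3) (x : Spc) :
    pd i (fun y => Qt f y j l) x = pd i (pd j (phi fun y => f y l)) x + pd i (pd l (phi fun y => f y j)) x
      - if j = l then ∑ m, pd i (pd m (phi fun y => f y m)) x else 0 := by
  have h : ∀ m n, Sm (pd m (phi fun y => f y n)) := fun m n =>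
    (phi_sm (comp_sm hf n) (comp_per pf n)).pdi m
  unfold Qt
  have hs : Sm (fun x => if j = l then ∑ m, pd m (phi fun y => f y m) x else 0) := by
    split_ifs
    · exact ContDiff.sum fun m _ => h m m
    · exact contDiff_const
  rw [pd_sub (Sm.diff ((h j l).add (h l j)) x) (Sm.diff hs x), pd_add (Sm.diff (h j l) x) (Sm.diff (h l j) x)]
  congr 1
  split_ifs
  · show fderiv ℝ (fun x => ∑ m, pd m (phi fun y => f y m) x) x (Pi.single i 1) = _
    rw [fderiv_fun_sum fun m _ => Sm.diff (h m m) x]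
    rw [sum_apply]
    rfl
  · simp [pd]

lemma Qt_div (hf : ContDiff ℝ (⊤ : ℕ∞) f) (pf : Per f) (f0 : ∀ l, ∫ x in Tdom, f x l = 0) (x : Spc) (l : Fin 3) :
    ∑ j, pd j (fun y => Qt f y j l) x = f x l := by
  simp only [pd_Qt hf pf]
  have hl := lap_phi (comp_sm hf l) (comp_per pf l) x
  rw [f0 l, sub_zero] at hl
  rw [← hl]
  have hc : ∀ j, pd j (pd l (phi fun y => f y j)) x = pd l (pd j (phi fun y => f y j)) x := fun j => by
    unfold phi
    rw [pd_comm_RS (fc_RD (comp_sm hf j) (comp_per pf j)).N]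
  simp only [hc, Finset.sum_sub_distrib, Finset.sum_add_distrib, Finset.sum_ite_eq', Finset.mem_univ, if_true, lap]
  ring

lemma pd_clm {E F : Type*} [NormedAddCommGroup E] [NormedSpace ℝ E] [NormedAddCommGroup F] [NormedSpace ℝ F]
    (L : E →L[ℝ] F) {g : Spc → E} {x : Spc} (hg : DifferentiableAt ℝ g x) (i : Fin 3) :
    pd i (fun y => L (g y)) x = L (pd i g x) := by
  unfold pd
  have : HasFDerivAt (fun y => L (g y)) (L ∘L fderiv ℝ g x) x := L.hasFDerivAt.comp x hg.hasFDerivAt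
  rw [this.fderiv]; rfl

/-- Entry evaluation. -/
def entry (j l : Fin 3) : (Fin 3 → Fin 3 → ℝ) →L[ℝ] ℝ :=
  (ContinuousLinearMap.proj (R := ℝ) (φ := fun _ : Fin 3 => ℝ) l) ∘L
    (ContinuousLinearMap.proj (R := ℝ) (φ := fun _ : Fin 3 => Fin 3 → ℝ) j)

lemma entry_apply (j l : Fin 3) (v : Fin 3 → Fin 3 → ℝ) : entry j l v = v j l := rfl

lemma Qt_mean (hf : ContDiff ℝ (⊤ : ℕ∞) f) (pf : Per f) : ∫ x in Tdom, Qt f x = 0 := by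
  have hi : IntegrableOn (Qt f) Tdom := cont_intT (Qt_sm hf pf).continuous
  funext j l
  have e := (entry j l).integral_comp_comm hi
  simp only [entry_apply] at e
  rw [← e]
  have hs : ∀ n, Sm (phi fun y => f y n) := fun n => phi_sm (comp_sm hf n) (comp_per pf n)
  have h : ∀ m n, Continuous (pd m (phi fun y => f y n)) := fun m n => ((hs n).pdi m).continuous
  have h0 : ∀ m n, ∫ x in Tdom, pd m (phi fun y => f y n) x = 0 := fun m n =>
    int_pd (Sm.one (hs n)) phi_per m
  have h1 : ∀ m n, IntegrableOn (fun x => pd m (phi fun y => f y n) x) Tdom := fun m n => cont_intT (h m n)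
  simp only [Qt, Pi.zero_apply]
  have h2 : IntegrableOn (fun x => pd j (phi fun y => f y l) x + pd l (phi fun y => f y j) x) Tdom :=
    (h1 j l).add (h1 l j)
  split_ifs
  · have h3 : IntegrableOn (fun x => ∑ m, pd m (phi fun y => f y m) x) Tdom :=
      integrable_finsetSum _ fun m _ => h1 m m
    rw [integral_sub h2 h3, integral_add (h1 j l) (h1 l j), integral_finsetSum _ fun m _ => h1 m m]
    simp [h0]
  · simp only [sub_zero]
    rw [integral_add (h1 j l) (h1 l j)]
    simp [h0]

/-- Sum of absolute values of second derivatives. -/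
def S2 (f : Spc → Spc) (x : Spc) : ℝ :=
  ∑ t : Fin 3 × Fin 3 × Fin 3, |pd t.1 (pd t.2.1 (phi fun y => f y t.2.2)) x|

lemma le_sum3 (F : Fin 3 → Fin 3 → Fin 3 → ℝ) (hF : ∀ a b c, 0 ≤ F a b c) (i j l : Fin 3) :
    F i j l ≤ ∑ t : Fin 3 × Fin 3 × Fin 3, F t.1 t.2.1 t.2.2 := by
  have := Finset.single_le_sum (s := Finset.univ) (f := fun t : Fin 3 × Fin 3 × Fin 3 => F t.1 t.2.1 t.2.2)
    (fun t _ => hF _ _ _) (Finset.mem_univ (i, j, l))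
  exact this

lemma S2_ge (i j l : Fin 3) (x : Spc) : |pd i (pd j (phi fun y => f y l)) x| ≤ S2 f x := by
  have := le_sum3 (fun a b c => |pd a (pd b (phi fun y => f y c)) x|) (fun _ _ _ => abs_nonneg _) i j l
  unfold S2
  exact this

lemma S2_nonneg (x : Spc) : 0 ≤ S2 f x := Finset.sum_nonneg fun _ _ => abs_nonneg _

lemma Qt_fderiv (hf : ContDiff ℝ (⊤ : ℕ∞) f) (pf : Per f) (x : Spc) : ‖fderiv ℝ (Qt f) x‖ ≤ 15 * S2 f x := by
  have hd : DifferentiableAt ℝ (Qt f) x := (Qt_sm hf pf).differentiable (by simp) x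
  have h0 := S2_nonneg (f := f) x
  have h1 : ∀ i, ‖pd i (Qt f) x‖ ≤ 5 * S2 f x := by
    intro i
    rw [pi_norm_le_iff_of_nonneg (by positivity)]
    intro j
    rw [pi_norm_le_iff_of_nonneg (by positivity)]
    intro l
    have e : pd i (Qt f) x j l = pd i (fun y => Qt f y j l) x := (pd_clm (entry j l) hd i).symm
    rw [e, pd_Qt hf pf, Real.norm_eq_abs]
    have a1 := S2_ge (f := f) i j l x
    have a2 := S2_ge (f := f) i l j x
    have a3 : |if j = l then ∑ m, pd i (pd m (phi fun y => f y m)) x else 0| ≤ 3 * S2 f x := by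
      split_ifs
      · refine (Finset.abs_sum_le_sum_abs _ _).trans ?_
        refine (Finset.sum_le_sum fun m _ => S2_ge (f := f) i m m x).trans ?_
        simp
      · simpa using h0
    refine (abs_sub _ _).trans ?_
    have := abs_add_le (pd i (pd j (phi fun y => f y l)) x) (pd i (pd l (phi fun y => f y j)) x)
    linarith
  refine ContinuousLinearMap.opNorm_le_bound _ (by positivity) fun v => ?_
  have hv : v = ∑ i, v i • (Pi.single i (1:ℝ) : Spc) := by
    funext m; simp [Finset.sum_apply, Pi.single_apply]
  conv_lhs => rw [hv]
  rw [map_sum]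
  refine (norm_sum_le _ _).trans ?_
  have : ∀ i ∈ Finset.univ, ‖fderiv ℝ (Qt f) x (v i • (Pi.single i (1:ℝ) : Spc))‖ ≤ 5 * S2 f x * ‖v‖ := by
    intro i _
    rw [map_smul, norm_smul, mul_comm]
    gcongr
    · exact h1 i
    · exact norm_le_pi_norm v i
  refine (Finset.sum_le_sum this).trans (le_of_eq ?_)
  simp; ring

lemma Qt_Lp {p : ℝ} (hp : 1 < p) : ∃ K : ℝ, 0 ≤ K ∧ ∀ f : Spc → Spc, ContDiff ℝ (⊤ : ℕ∞) f → Per f →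
    (∀ l, ∫ x in Tdom, f x l = 0) →
    ∫ x in Tdom, ‖fderiv ℝ (Qt f) x‖ ^ p ≤ K * ∫ x in Tdom, ‖f x‖ ^ p := by
  obtain ⟨C, hC, hcz⟩ := cz hp
  have hp0 : 0 < p := by linarith
  refine ⟨15 ^ p * 27 ^ (p - 1) * (27 * C), by positivity, fun f hf pf f0 => ?_⟩
  have cD : Continuous fun x => ‖fderiv ℝ (Qt f) x‖ ^ p :=
    (((Qt_sm hf pf).continuous_fderiv (by simp)).norm).rpow_const fun _ => Or.inr hp0.le
  have cs : ∀ t : Fin 3 × Fin 3 × Fin 3, Continuous fun x => |pd t.1 (pd t.2.1 (phi fun y => f y t.2.2)) x| ^ p :=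
    fun t => cont_abs_rpow (((phi_sm (comp_sm hf _) (comp_per pf _)).pdi _).pdi _).continuous hp0
  have cS : Continuous fun x => 15 ^ p * 27 ^ (p - 1) * ∑ t : Fin 3 × Fin 3 × Fin 3, |pd t.1 (pd t.2.1 (phi fun y => f y t.2.2)) x| ^ p :=
    continuous_const.mul (continuous_finsetSum _ fun t _ => cs t)
  have cf : Continuous fun x => ‖f x‖ ^ p := hf.continuous.norm.rpow_const fun _ => Or.inr hp0.le
  have s1 : ∀ x, ‖fderiv ℝ (Qt f) x‖ ^ p ≤
      15 ^ p * 27 ^ (p - 1) * ∑ t : Fin 3 × Fin 3 × Fin 3, |pd t.1 (pd t.2.1 (phi fun y => f y t.2.2)) x| ^ p := by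
    intro x
    refine (Real.rpow_le_rpow (norm_nonneg _) (Qt_fderiv hf pf x) hp0.le).trans ?_
    rw [Real.mul_rpow (by norm_num) (S2_nonneg x), mul_assoc]
    gcongr
    have := Real.rpow_sum_le_const_mul_sum_rpow (Finset.univ : Finset (Fin 3 × Fin 3 × Fin 3))
      (fun t => pd t.1 (pd t.2.1 (phi fun y => f y t.2.2)) x) hp.le
    have hcard : ((Finset.univ : Finset (Fin 3 × Fin 3 × Fin 3)).card : ℝ) = 27 := by
      simp
    rw [hcard] at this
    exact this
  refine (integral_mono (cont_intT cD) (cont_intT cS) s1).trans ?_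
  rw [integral_const_mul, mul_assoc (15 ^ p * 27 ^ (p - 1) : ℝ) (27 * C)]
  gcongr
  rw [integral_finsetSum _ fun t _ => cont_intT (cs t)]
  have s2 : ∀ t ∈ (Finset.univ : Finset (Fin 3 × Fin 3 × Fin 3)),
      ∫ x in Tdom, |pd t.1 (pd t.2.1 (phi fun y => f y t.2.2)) x| ^ p ≤ C * ∫ x in Tdom, ‖f x‖ ^ p := by
    intro t _
    refine (hcz _ (comp_sm hf _) (comp_per pf _) (f0 _) _ _).trans ?_
    gcongr ?_ * ?_
    refine integral_mono (cont_intT (cont_abs_rpow (comp_sm hf _).continuous hp0)) (cont_intT cf) fun x => ?_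
    exact Real.rpow_le_rpow (abs_nonneg _) (norm_le_pi_norm (f x) t.2.2) hp0.le
  refine (Finset.sum_le_sum s2).trans (le_of_eq ?_)
  simp; ring

end Assembly



theorem divergence_equation_Lp (p : ℝ) (hp : 1 < p) :
    ∃ (C : ℝ) (T : (Spc → Spc) →ₗ[ℝ] (Spc → Fin 3 → Fin 3 → ℝ)), 0 < C ∧
      ∀ f : Spc → Spc, ContDiff ℝ (⊤ : ℕ∞) f → Per f →
        (∫ x in Tdom, f x) = 0 →
        (ContDiff ℝ (⊤ : ℕ∞) (T f) ∧ Per (T f) ∧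
         (∀ x j l, T f x j l = T f x l j) ∧
         (∀ x l, (∑ j, pd j (fun y => T f y j l) x) = f x l) ∧
         ((∫ x in Tdom, ‖T f x‖ ^ p) ^ p⁻¹ +
            (∫ x in Tdom, ‖fderiv ℝ (T f) x‖ ^ p) ^ p⁻¹
              ≤ C * (∫ x in Tdom, ‖f x‖ ^ p) ^ p⁻¹) ∧
         (3 < p → ∀ x, ‖T f x‖ ≤ C * (∫ y in Tdom, ‖f y‖ ^ p) ^ p⁻¹)) := by
  obtain ⟨K, hK, hLp⟩ := Qt_Lp hp
  obtain ⟨T, hT⟩ := LinearMap.exists_extend T0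
  have hp0 : 0 < p := by linarith
  refine ⟨2 * K ^ p⁻¹ + |(1 - 3 / p)⁻¹| * K ^ p⁻¹ + 1, T, by positivity, ?_⟩
  intro f hf pf hm
  have e : T f = Qt f := by
    have := LinearMap.congr_fun hT ⟨f, hf, pf⟩
    exact this
  rw [e]
  have f0 : ∀ l, ∫ x in Tdom, f x l = 0 := by
    intro l
    have h := (ContinuousLinearMap.proj (R := ℝ) (φ := fun _ : Fin 3 => ℝ) l).integral_comp_comm
      (cont_intT hf.continuous)
    rw [hm] at h
    simpa using h
  have h1 := hLp f hf pf f0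
  have hQ := Qt_sm hf pf
  have hQ1 := Sm.one hQ
  have h2 := poincare hQ1 Qt_per (Qt_mean hf pf) hp.le
  have nF : 0 ≤ ∫ x in Tdom, ‖f x‖ ^ p := integral_nonneg fun _ => by positivity
  have nD : 0 ≤ ∫ x in Tdom, ‖fderiv ℝ (Qt f) x‖ ^ p := integral_nonneg fun _ => by positivity
  have nQ : 0 ≤ ∫ x in Tdom, ‖Qt f x‖ ^ p := integral_nonneg fun _ => by positivity
  have k1 : (∫ x in Tdom, ‖fderiv ℝ (Qt f) x‖ ^ p) ^ p⁻¹ ≤ K ^ p⁻¹ * (∫ x in Tdom, ‖f x‖ ^ p) ^ p⁻¹ := by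
    rw [← Real.mul_rpow hK nF]
    exact Real.rpow_le_rpow nD h1 (by positivity)
  have k2 : (∫ x in Tdom, ‖Qt f x‖ ^ p) ^ p⁻¹ ≤ (∫ x in Tdom, ‖fderiv ℝ (Qt f) x‖ ^ p) ^ p⁻¹ :=
    Real.rpow_le_rpow nQ h2 (by positivity)
  have nFp : 0 ≤ (∫ x in Tdom, ‖f x‖ ^ p) ^ p⁻¹ := by positivity
  have nK : 0 ≤ K ^ p⁻¹ := by positivity
  refine ⟨hQ, Qt_per, Qt_symm, Qt_div hf pf f0, ?_, ?_⟩
  · have : 0 ≤ |(1 - 3 / p)⁻¹| * K ^ p⁻¹ * (∫ x in Tdom, ‖f x‖ ^ p) ^ p⁻¹ := by positivity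
    linarith
  · intro hp3 x
    have h3 := morrey hQ1 Qt_per (Qt_mean hf pf) hp3 x
    have k3 : (1 - 3 / p)⁻¹ * (∫ x in Tdom, ‖fderiv ℝ (Qt f) x‖ ^ p) ^ p⁻¹
        ≤ |(1 - 3 / p)⁻¹| * (K ^ p⁻¹ * (∫ x in Tdom, ‖f x‖ ^ p) ^ p⁻¹) :=
      mul_le_mul (le_abs_self _) k1 (by positivity) (abs_nonneg _)
    have : 0 ≤ K ^ p⁻¹ * (∫ x in Tdom, ‖f x‖ ^ p) ^ p⁻¹ := by positivity
    linarith
end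
end

section
/- There exists a linear operator R taking smooth vector fields U : 𝕋³ → ℝ³ to smooth symmetric tensor fields R[U]^{jl} = R[U]^{lj} on 𝕋³ such that: (i) ∂_j R[U]^{jl} = U^l − ∫_{𝕋³} U^l dx for every smooth U (i.e., the divergence of R[U] equals the projection of U onto vector fields of integral zero); (ii) ∫_{𝕋³} R[U]^{jl} dx = 0; and (iii) for every integer k ≥ 0 there is a constant C_k with ‖∇^{k+1} R[U]‖_{L⁴(𝕋³)} ≤ C_k ‖∇^k U‖_{L⁴(𝕋³)} for all smooth U. -/
noncomputable section

open MeasureTheory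

namespace InvDiv

section


open Complex (I exp)
open scoped BigOperators

abbrev Lam : Type := Fin 3 → ℤ

/-- Characters. -/
def ee (ξ : Lam) (x : Spc) : ℂ :=
  Complex.exp (((2 * Real.pi * ∑ j, (ξ j : ℝ) * x j : ℝ) : ℂ) * Complex.I)

lemma ee_norm (ξ : Lam) (x : Spc) : ‖ee ξ x‖ = 1 := Complex.norm_exp_ofReal_mul_I _

lemma ee_add (ξ η : Lam) (x : Spc) : ee (ξ + η) x = ee ξ x * ee η x := by
  unfold ee
  rw [← Complex.exp_add]
  congr 1
  simp only [Pi.add_apply, Int.cast_add, add_mul, Finset.sum_add_distrib]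
  push_cast
  ring

lemma ee_zero (x : Spc) : ee 0 x = 1 := by simp [ee]

lemma ee_neg (ξ : Lam) (x : Spc) : ee (-ξ) x = (starRingEnd ℂ) (ee ξ x) := by
  unfold ee
  rw [← Complex.exp_conj, map_mul, Complex.conj_ofReal, Complex.conj_I]
  congr 1
  simp

lemma ee_per (ξ : Lam) : Per (ee ξ) := by
  intro x k
  unfold ee
  have : (∑ j, (ξ j : ℝ) * (x j + (k j : ℝ))) = (∑ j, (ξ j : ℝ) * x j) + ((∑ j, ξ j * k j : ℤ) : ℝ) := by
    push_cast
    rw [← Finset.sum_add_distrib]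
    exact Finset.sum_congr rfl fun _ _ => by ring
  rw [this, Complex.exp_eq_exp_iff_exists_int]
  refine ⟨∑ j, ξ j * k j, ?_⟩
  push_cast
  ring

/-- The linear form of a frequency. -/
def lf (ξ : Lam) : Spc →L[ℝ] ℂ :=
  ∑ j, ((ContinuousLinearMap.proj j : Spc →L[ℝ] ℝ).smulRight (2 * Real.pi * Complex.I * (ξ j : ℂ)))

lemma lf_apply (ξ : Lam) (v : Spc) : lf ξ v = ∑ j, (v j : ℂ) * (2 * Real.pi * Complex.I * (ξ j : ℂ)) := by
  simp [lf]

lemma lf_single (ξ : Lam) (j : Fin 3) : lf ξ (Pi.single j 1) = 2 * Real.pi * Complex.I * (ξ j : ℂ) := by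
  rw [lf_apply, Finset.sum_eq_single j]
  · simp
  · intro b _ hb
    simp [Pi.single_eq_of_ne hb]
  · simp

lemma ee_eq (ξ : Lam) (x : Spc) : ee ξ x = Complex.exp (lf ξ x) := by
  unfold ee
  rw [lf_apply]
  congr 1
  push_cast
  rw [Finset.mul_sum, Finset.sum_mul]
  exact Finset.sum_congr rfl fun _ _ => by ring

lemma ee_hasFDerivAt (ξ : Lam) (x : Spc) : HasFDerivAt (ee ξ) (ee ξ x • lf ξ) x := by
  have h : ee ξ = fun x => Complex.exp (lf ξ x) := funext (ee_eq ξ)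
  rw [h]
  exact ((lf ξ).hasFDerivAt (x := x)).cexp

lemma ee_contDiff (ξ : Lam) {n : WithTop ℕ∞} : ContDiff ℝ n (ee ξ) := by
  have h : ee ξ = fun x => Complex.exp (lf ξ x) := funext (ee_eq ξ)
  rw [h]
  exact (lf ξ).contDiff.cexp

lemma ee_continuous (ξ : Lam) : Continuous (ee ξ) := (ee_contDiff ξ (n := 0)).continuous

lemma abs_le_norm (ξ : Lam) (j : Fin 3) : |(ξ j : ℝ)| ≤ ‖ξ‖ := by
  have := norm_le_pi_norm ξ j
  rwa [Int.norm_eq_abs] at this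

/-- Rapidly decaying sequences. -/
def Rapid (a : Lam → ℂ) : Prop := ∀ N : ℕ, ∃ C : ℝ, ∀ ξ, ‖a ξ‖ * (1 + ‖ξ‖) ^ N ≤ C

lemma Rapid.of_le {a b : Lam → ℂ} (ha : Rapid a) (K : ℝ) (m : ℕ)
    (h : ∀ ξ, ‖b ξ‖ ≤ K * (1 + ‖ξ‖) ^ m * ‖a ξ‖) : Rapid b := by
  intro N
  obtain ⟨C, hC⟩ := ha (N + m)
  refine ⟨|K| * C, fun ξ => ?_⟩
  have h1 : (0:ℝ) ≤ 1 + ‖ξ‖ := by positivity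
  calc ‖b ξ‖ * (1 + ‖ξ‖) ^ N ≤ (K * (1 + ‖ξ‖) ^ m * ‖a ξ‖) * (1 + ‖ξ‖) ^ N := by
        gcongr; exact h ξ
    _ ≤ (|K| * (1 + ‖ξ‖) ^ m * ‖a ξ‖) * (1 + ‖ξ‖) ^ N := by
        gcongr; exact le_abs_self K
    _ = |K| * (‖a ξ‖ * (1 + ‖ξ‖) ^ (N + m)) := by ring
    _ ≤ |K| * C := by gcongr; exact hC ξ

lemma Rapid.add {a b : Lam → ℂ} (ha : Rapid a) (hb : Rapid b) : Rapid (fun ξ => a ξ + b ξ) := by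
  intro N
  obtain ⟨C, hC⟩ := ha N
  obtain ⟨D, hD⟩ := hb N
  refine ⟨C + D, fun ξ => ?_⟩
  calc ‖a ξ + b ξ‖ * (1 + ‖ξ‖) ^ N ≤ (‖a ξ‖ + ‖b ξ‖) * (1 + ‖ξ‖) ^ N := by
        gcongr; exact norm_add_le _ _
    _ ≤ _ := by rw [add_mul]; exact add_le_add (hC ξ) (hD ξ)

lemma summable_int_sq : Summable fun n : ℤ => (1 / (1 + |(n : ℝ)|) ^ 2 : ℝ) := by
  have h : Summable fun n : ℕ => (1 / (1 + |(n : ℝ)|) ^ 2 : ℝ) := by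
    have := (summable_nat_add_iff 1).2 (Real.summable_one_div_nat_pow.2 (one_lt_two))
    refine this.congr fun n => ?_
    rw [abs_of_nonneg (by positivity)]
    push_cast
    ring
  refine Summable.of_nat_of_neg ?_ ?_
  · simpa using h
  · simpa using h

lemma summable_weight : Summable fun ξ : Lam => (1 / (1 + ‖ξ‖) ^ 6 : ℝ) := by
  have h2 := summable_int_sq
  have hn : ∀ n : ℤ, 0 ≤ (1 / (1 + |(n : ℝ)|) ^ 2 : ℝ) := fun n => by positivity
  have h3 := h2.mul_of_nonneg (h2.mul_of_nonneg h2 hn hn) hn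
    (fun p => mul_nonneg (hn _) (hn _))
  have hinj : Function.Injective (fun ξ : Lam => (ξ 0, ξ 1, ξ 2)) := by
    intro a b hab
    simp only [Prod.mk.injEq] at hab
    ext j
    fin_cases j
    · exact hab.1
    · exact hab.2.1
    · exact hab.2.2
  have h4 := h3.comp_injective hinj
  refine Summable.of_nonneg_of_le (fun ξ => by positivity) (fun ξ => ?_) h4
  simp only [Function.comp]
  have hb := abs_le_norm ξ
  rw [one_div_mul_one_div, one_div_mul_one_div]
  have h0 := hb 0
  have h1 := hb 1
  have h2 := hb 2
  apply one_div_le_one_div_of_le (by positivity)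
  calc _ ≤ (1 + ‖ξ‖) ^ 2 * ((1 + ‖ξ‖) ^ 2 * (1 + ‖ξ‖) ^ 2) := by gcongr
    _ = _ := by ring

lemma Rapid.summable {a : Lam → ℂ} (ha : Rapid a) : Summable fun ξ => ‖a ξ‖ := by
  obtain ⟨C, hC⟩ := ha 6
  refine Summable.of_nonneg_of_le (fun ξ => norm_nonneg _) (fun ξ => ?_) (summable_weight.mul_left C)
  rw [mul_one_div, le_div_iff₀ (by positivity)]
  exact hC ξ

/-- Synthesis. -/
def FF (a : Lam → ℂ) (x : Spc) : ℂ := ∑' ξ, a ξ * ee ξ x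

lemma norm_term (a : Lam → ℂ) (ξ : Lam) (x : Spc) : ‖a ξ * ee ξ x‖ = ‖a ξ‖ := by
  rw [norm_mul, ee_norm, mul_one]

lemma Rapid.summable_term {a : Lam → ℂ} (ha : Rapid a) (x : Spc) :
    Summable fun ξ => a ξ * ee ξ x :=
  Summable.of_norm (by simpa only [norm_term] using ha.summable)

lemma FF_per (a : Lam → ℂ) : Per (FF a) := by
  intro x k
  unfold FF
  exact tsum_congr fun ξ => by rw [ee_per ξ x k]

lemma FF_add {a b : Lam → ℂ} (ha : Rapid a) (hb : Rapid b) (x : Spc) :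
    FF (fun ξ => a ξ + b ξ) x = FF a x + FF b x := by
  unfold FF
  rw [← (ha.summable_term x).tsum_add (hb.summable_term x)]
  exact tsum_congr fun ξ => by ring

lemma FF_smul (c : ℂ) (a : Lam → ℂ) (x : Spc) : FF (fun ξ => c * a ξ) x = c * FF a x := by
  unfold FF
  rw [← tsum_mul_left]
  exact tsum_congr fun ξ => by ring

/-- Multiplication by the symbol of `∂_j`. -/
def dm (j : Fin 3) (a : Lam → ℂ) (ξ : Lam) : ℂ := 2 * Real.pi * Complex.I * (ξ j : ℂ) * a ξ

lemma Rapid.dm {a : Lam → ℂ} (ha : Rapid a) (j : Fin 3) : Rapid (dm j a) := by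
  refine ha.of_le (2 * Real.pi) 1 fun ξ => ?_
  unfold InvDiv.dm
  have h1 := abs_le_norm ξ j
  have h : ‖(2 * Real.pi * Complex.I * (ξ j : ℂ) * a ξ : ℂ)‖ = 2 * Real.pi * |(ξ j : ℝ)| * ‖a ξ‖ := by
    simp [abs_of_pos Real.pi_pos]
  rw [h]
  gcongr
  linarith

lemma FF_hasFDerivAt {a : Lam → ℂ} (ha : Rapid a) (x : Spc) :
    HasFDerivAt (FF a) (∑ j, (ContinuousLinearMap.proj j : Spc →L[ℝ] ℝ).smulRight (FF (dm j a) x)) x := by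
  have hb : Summable fun ξ => 3 * (2 * Real.pi * ‖ξ‖) * ‖a ξ‖ := by
    have : Rapid (fun ξ => ((3 * (2 * Real.pi * ‖ξ‖) : ℝ) : ℂ) * a ξ) := by
      refine ha.of_le (6 * Real.pi) 1 fun ξ => ?_
      rw [norm_mul, Complex.norm_of_nonneg (by positivity)]
      refine mul_le_mul_of_nonneg_right ?_ (norm_nonneg _)
      nlinarith [Real.pi_pos, norm_nonneg ξ]
    refine this.summable.congr fun ξ => ?_
    rw [norm_mul, Complex.norm_of_nonneg (by positivity)]
  have key := hasFDerivAt_tsum (f := fun ξ x => a ξ * ee ξ x)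
    (f' := fun ξ x => a ξ • (ee ξ x • lf ξ)) hb
    (fun ξ x => (ee_hasFDerivAt ξ x).const_mul (a ξ)) (fun ξ y => ?_) (ha.summable_term x) x
  · refine key.congr_fderiv ?_
    have hlf : ∀ ξ, a ξ • (ee ξ x • lf ξ) =
        ∑ j, (ContinuousLinearMap.proj j : Spc →L[ℝ] ℝ).smulRight (dm j a ξ * ee ξ x) := by
      intro ξ
      ext v
      simp only [_root_.smul_apply, lf_apply, _root_.sum_apply,
        ContinuousLinearMap.smulRight_apply, ContinuousLinearMap.proj_apply, smul_eq_mul,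
        Complex.real_smul, dm, Finset.mul_sum]
      exact Finset.sum_congr rfl fun _ _ => by ring
    simp_rw [hlf]
    have hs : ∀ j, HasSum (fun ξ => (ContinuousLinearMap.proj j : Spc →L[ℝ] ℝ).smulRight (dm j a ξ * ee ξ x))
        ((ContinuousLinearMap.proj j : Spc →L[ℝ] ℝ).smulRight (FF (dm j a) x)) := by
      intro j
      have := ((ha.dm j).summable_term x).hasSum
      exact this.mapL (ContinuousLinearMap.smulRightL ℝ Spc ℂ (ContinuousLinearMap.proj j))
    exact (hasSum_sum fun j _ => hs j).tsum_eq
  · rw [norm_smul, norm_smul, ee_norm, one_mul, mul_comm]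
    gcongr
    refine ContinuousLinearMap.opNorm_le_bound _ (by positivity) fun v => ?_
    rw [lf_apply]
    refine (norm_sum_le _ _).trans ?_
    have : ∀ j ∈ Finset.univ, ‖(v j : ℂ) * (2 * Real.pi * Complex.I * (ξ j : ℂ))‖ ≤ 2 * Real.pi * ‖ξ‖ * ‖v‖ := by
      intro j _
      have h : ‖(v j : ℂ) * (2 * Real.pi * Complex.I * (ξ j : ℂ))‖ = 2 * Real.pi * |(ξ j : ℝ)| * ‖v j‖ := by
        simp [abs_of_pos Real.pi_pos]
        ring
      rw [h]
      gcongr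
      · exact abs_le_norm ξ j
      · exact norm_le_pi_norm v j
    refine (Finset.sum_le_sum this).trans (le_of_eq ?_)
    simp
    ring

lemma FF_continuous {a : Lam → ℂ} (ha : Rapid a) : Continuous (FF a) :=
  continuous_iff_continuousAt.2 fun x => (FF_hasFDerivAt ha x).continuousAt

lemma FF_contDiff_nat (n : ℕ) : ∀ {a : Lam → ℂ}, Rapid a → ContDiff ℝ n (FF a) := by
  induction n with
  | zero => intro a ha; exact contDiff_zero.2 (FF_continuous ha)
  | succ n ih =>
    intro a ha
    refine (contDiff_succ_iff_hasFDerivAt (n := n)).2 ⟨_, ?_, fun x => FF_hasFDerivAt ha x⟩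
    refine ContDiff.sum fun j _ => ?_
    exact contDiff_const.smulRight (ih (ha.dm j))

lemma FF_contDiff {a : Lam → ℂ} (ha : Rapid a) : ContDiff ℝ (⊤ : ℕ∞) (FF a) :=
  contDiff_infty.2 fun n => FF_contDiff_nat n ha

lemma FF_pd {a : Lam → ℂ} (ha : Rapid a) (j : Fin 3) (x : Spc) : pd j (FF a) x = FF (dm j a) x := by
  unfold pd
  rw [(FF_hasFDerivAt ha x).fderiv, _root_.sum_apply, Finset.sum_eq_single j]
  · simp
  · intro b _ hb
    simp [Pi.single_eq_of_ne hb]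
  · simp


end

section

lemma Tdom_ae_Icc : Tdom =ᵐ[volume] Set.Icc (0 : Spc) 1 := by
  unfold Tdom
  rw [volume_pi]
  exact Measure.univ_pi_Ico_ae_eq_Icc (f := (0 : Spc)) (g := 1)

lemma Tdom_ae_Ioc : Tdom =ᵐ[volume] {x : Spc | ∀ i, x i ∈ Set.Ioc ((0 : Spc) i) ((0 : Spc) i + 1)} := by
  refine Tdom_ae_Icc.trans ?_
  have := Measure.univ_pi_Ioc_ae_eq_Icc (μ := fun _ : Fin 3 => (volume : Measure ℝ)) (f := (0 : Spc)) (g := 1)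
  rw [volume_pi]
  have he : (Set.univ.pi fun i => Set.Ioc ((0 : Spc) i) ((1 : Spc) i)) =
      {x : Spc | ∀ i, x i ∈ Set.Ioc ((0 : Spc) i) ((0 : Spc) i + 1)} := by
    ext x
    simp only [Set.mem_pi, Set.mem_univ, true_imp_iff, Set.mem_ofPred_eq, Pi.zero_apply, Pi.one_apply, zero_add]
  rw [← he]
  exact this.symm

lemma Tdom_meas : MeasurableSet Tdom := MeasurableSet.univ_pi fun _ => measurableSet_Ico

lemma Tdom_vol : volume Tdom = 1 := by
  rw [measure_congr Tdom_ae_Icc, Real.volume_Icc_pi]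
  simp

instance : IsProbabilityMeasure (volume.restrict Tdom) := ⟨by simp [Tdom_vol]⟩

variable {E : Type*} [NormedAddCommGroup E] [NormedSpace ℝ E]

lemma integrable_of_cont {E : Type*} [NormedAddCommGroup E] {f : Spc → E} (hf : Continuous f) : Integrable f (volume.restrict Tdom) := by
  have : IntegrableOn f (Set.Icc (0 : Spc) 1) := hf.continuousOn.integrableOn_compact isCompact_Icc
  exact this.congr_set_ae Tdom_ae_Icc

lemma pd_continuous {g : Spc → E} (hg : ContDiff ℝ 1 g) (j : Fin 3) : Continuous (pd j g) :=
  (hg.continuous_fderiv one_ne_zero).clm_apply continuous_const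

lemma integral_pd {g : Spc → E} (hg : ContDiff ℝ 1 g) (hp : Per g) (j : Fin 3) :
    ∫ x in Tdom, pd j g x = 0 := by
  rw [setIntegral_congr_set Tdom_ae_Icc]
  have key := integral_divergence_of_hasFDerivAt_off_countable' (n := 2) (E := E) (0 : Spc) 1
    (by intro i; simp)
    (fun i x => if i = j then g x else 0)
    (fun i x => if i = j then fderiv ℝ g x else 0) ∅ Set.countable_empty
    (fun i => by
      by_cases h : i = j
      · simp only [h, if_true]; exact hg.continuous.continuousOn
      · simp only [h, if_false]; exact continuousOn_const)
    (fun x _ i => by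
      by_cases h : i = j
      · simp only [h, if_true]; exact (hg.differentiable one_ne_zero x).hasFDerivAt
      · simp only [h, if_false]; exact hasFDerivAt_const _ _)
    (by
      refine Continuous.integrableOn_Icc ?_
      refine continuous_finsetSum _ fun i _ => ?_
      by_cases h : i = j
      · simp only [h, if_true]; exact pd_continuous hg j
      · simp only [h, if_false]; exact continuous_const)
  have h1 : ∀ x : Spc, (∑ i : Fin 3, (if i = j then fderiv ℝ g x else 0) (Pi.single i 1)) = pd j g x := by
    intro x
    rw [Finset.sum_eq_single j]
    · simp [pd]
    · intro b _ hb; simp [hb]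
    · simp
  simp only [Nat.reduceAdd] at key
  simp_rw [h1] at key
  rw [key]
  refine Finset.sum_eq_zero fun i _ => ?_
  by_cases h : i = j
  · subst h
    simp only [if_true]
    rw [sub_eq_zero]
    congr 1
    ext y
    rw [← hp (i.insertNth ((0 : Spc) i) y) (Pi.single i 1)]
    congr 1
    ext k
    refine Fin.succAboveCases i ?_ (fun m => ?_) k
    · simp
    · simp
  · simp [h]

lemma pd_per {g : Spc → E} (hp : Per g) (j : Fin 3) : Per (pd j g) := by
  intro x k
  unfold pd
  have h : g = fun y => g (y + fun i => (k i : ℝ)) := by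
    funext y; exact (hp y k).symm
  have h2 := fderiv_comp_add_right (𝕜 := ℝ) (f := g) (x := x) (fun i => (k i : ℝ))
  rw [← h] at h2
  rw [h2]
  rfl

lemma ee_pd (ξ : Lam) (j : Fin 3) (x : Spc) : pd j (ee ξ) x = 2 * Real.pi * Complex.I * (ξ j : ℂ) * ee ξ x := by
  unfold pd
  rw [(ee_hasFDerivAt ξ x).fderiv, _root_.smul_apply, lf_single, smul_eq_mul, mul_comm]

lemma two_pi_I_ne {n : ℤ} (hn : n ≠ 0) : (2 * Real.pi * Complex.I * (n : ℂ) : ℂ) ≠ 0 := by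
  simp [hn, Real.pi_ne_zero]

lemma ee_integral (ξ : Lam) : ∫ x in Tdom, ee ξ x = if ξ = 0 then 1 else 0 := by
  split_ifs with h
  · subst h
    simp [ee_zero, Measure.real]
  · obtain ⟨j, hj⟩ : ∃ j, ξ j ≠ 0 := by
      by_contra hh
      push Not at hh
      exact h (funext hh)
    have := integral_pd (ee_contDiff ξ) (ee_per ξ) j
    simp_rw [ee_pd] at this
    rw [integral_const_mul] at this
    exact (mul_eq_zero.1 this).resolve_left (two_pi_I_ne hj)

/-- Another name for `pd`. -/
abbrev pdf (j : Fin 3) (f : Spc → E) : Spc → E := pd j f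

/-- Fourier coefficients. -/
def coef (u : Spc → ℂ) (ξ : Lam) : ℂ := ∫ y in Tdom, ee (-ξ) y * u y

/-- smooth and periodic -/
def SP (u : Spc → E) : Prop := ContDiff ℝ (⊤ : ℕ∞) u ∧ Per u

lemma SP.cd {u : Spc → E} (h : SP u) (n : ℕ) : ContDiff ℝ n u := contDiff_infty.1 h.1 n

lemma SP.pd {u : Spc → E} (h : SP u) (j : Fin 3) : SP (pd j u) := by
  refine ⟨?_, pd_per h.2 j⟩
  have : ContDiff ℝ (⊤ : ℕ∞) (fderiv ℝ u) := h.1.fderiv_right (by simp)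
  exact this.clm_apply contDiff_const

lemma coef_pd {u : Spc → ℂ} (hu : SP u) (j : Fin 3) (ξ : Lam) :
    coef (pd j u) ξ = dm j (coef u) ξ := by
  have h1 : ContDiff ℝ 1 u := hu.cd 1
  have hg : ContDiff ℝ 1 (fun y => ee (-ξ) y * u y) := (ee_contDiff (-ξ)).mul h1
  have hp : Per (fun y => ee (-ξ) y * u y) := by
    intro x k
    simp only
    rw [ee_per (-ξ) x k, hu.2 x k]
  have h0 := integral_pd hg hp j
  have h2 : ∀ y, InvDiv.pdf j (fun y => ee (-ξ) y * u y) y =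
      2 * Real.pi * Complex.I * ((-ξ) j : ℂ) * (ee (-ξ) y * u y) + ee (-ξ) y * InvDiv.pdf j u y := by
    intro y
    have hd := (ee_hasFDerivAt (-ξ) y).mul (h1.differentiable one_ne_zero y).hasFDerivAt
    have e1 := ee_pd (-ξ) j y
    unfold pdf pd at *
    rw [show (fun y => ee (-ξ) y * u y) = ee (-ξ) * u from rfl, hd.fderiv]
    rw [(ee_hasFDerivAt (-ξ) y).fderiv] at e1
    simp only [_root_.add_apply, _root_.smul_apply, smul_eq_mul] at e1 ⊢
    linear_combination u y * e1
  have h3 : Continuous (fun y => ee (-ξ) y * u y) := hg.continuous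
  have h4 : Continuous (fun y => ee (-ξ) y * InvDiv.pdf j u y) :=
    (ee_continuous _).mul (pd_continuous h1 j)
  unfold pdf at h2 h4
  simp_rw [h2] at h0
  rw [integral_add ((integrable_of_cont h3).const_mul _) (integrable_of_cont h4),
    integral_const_mul] at h0
  unfold coef dm
  simp only [Pi.neg_apply, Int.cast_neg] at h0
  linear_combination h0

lemma coef_bound (u : Spc → ℂ) (ξ : Lam) : ‖coef u ξ‖ ≤ ∫ y in Tdom, ‖u y‖ := by
  unfold coef
  refine (norm_integral_le_integral_norm _).trans (le_of_eq ?_)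
  simp_rw [norm_mul, ee_norm, one_mul]

lemma norm_le_sum (ξ : Lam) : ‖ξ‖ ≤ ∑ j, |(ξ j : ℝ)| := by
  refine (pi_norm_le_iff_of_nonneg (Finset.sum_nonneg fun _ _ => abs_nonneg _)).2 fun j => ?_
  rw [Int.norm_eq_abs]
  exact Finset.single_le_sum (f := fun j => |(ξ j : ℝ)|) (fun _ _ => abs_nonneg _) (Finset.mem_univ j)

lemma coef_rapid_aux (N : ℕ) : ∀ {u : Spc → ℂ}, SP u → ∃ C : ℝ, ∀ ξ, ‖coef u ξ‖ * (1 + ‖ξ‖) ^ N ≤ C := by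
  induction N with
  | zero =>
    intro u hu
    exact ⟨_, fun ξ => by simpa using coef_bound u ξ⟩
  | succ N ih =>
    intro u hu
    obtain ⟨C, hC⟩ := ih hu
    choose D hD using fun j => ih (hu.pd j)
    refine ⟨C + ∑ j, D j, fun ξ => ?_⟩
    have h1 : ∀ j, |(ξ j : ℝ)| * ‖coef u ξ‖ ≤ ‖coef (InvDiv.pdf j u) ξ‖ := by
      intro j
      unfold pdf
      rw [coef_pd hu]
      unfold dm
      have h : ‖(2 * Real.pi * Complex.I * (ξ j : ℂ) * coef u ξ : ℂ)‖ =
          2 * Real.pi * (|(ξ j : ℝ)| * ‖coef u ξ‖) := by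
        simp [abs_of_pos Real.pi_pos]
        ring
      rw [h]
      have : 0 ≤ |(ξ j : ℝ)| * ‖coef u ξ‖ := by positivity
      nlinarith [Real.pi_gt_three]
    have h2 := norm_le_sum ξ
    have h3 : (0:ℝ) ≤ (1 + ‖ξ‖) ^ N := by positivity
    calc ‖coef u ξ‖ * (1 + ‖ξ‖) ^ (N + 1) = ‖coef u ξ‖ * (1 + ‖ξ‖) ^ N + (‖ξ‖ * ‖coef u ξ‖) * (1 + ‖ξ‖) ^ N := by ring
      _ ≤ C + ((∑ j, |(ξ j : ℝ)|) * ‖coef u ξ‖) * (1 + ‖ξ‖) ^ N := by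
          gcongr
          exact hC ξ
      _ ≤ C + (∑ j, ‖coef (InvDiv.pdf j u) ξ‖) * (1 + ‖ξ‖) ^ N := by
          rw [Finset.sum_mul]
          gcongr with j _
          exact h1 j
      _ ≤ _ := by
          rw [Finset.sum_mul]
          gcongr with j _
          exact hD j ξ

lemma coef_rapid {u : Spc → ℂ} (hu : SP u) : Rapid (coef u) := fun N => coef_rapid_aux N hu

/-- projection to the torus -/
def qq : C(Spc, UnitAddTorus (Fin 3)) where
  toFun x i := (x i : UnitAddCircle)
  continuous_toFun := by fun_prop

lemma qq_quot : Topology.IsQuotientMap qq := by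
  have h : IsOpenQuotientMap (Pi.map fun (_ : Fin 3) (x : ℝ) => (x : UnitAddCircle)) :=
    IsOpenQuotientMap.piMap fun _ => QuotientAddGroup.isOpenQuotientMap_mk
  exact h.isQuotientMap

lemma mFourier_qq (ξ : Lam) (x : Spc) : UnitAddTorus.mFourier ξ (qq x) = ee ξ x := by
  unfold UnitAddTorus.mFourier qq ee
  simp only [ContinuousMap.coe_mk, fourier_coe_apply]
  rw [← Complex.exp_sum]
  congr 1
  push_cast
  rw [Finset.mul_sum, Finset.sum_mul]
  exact Finset.sum_congr rfl fun _ _ => by ring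

lemma FF_coef {u : Spc → ℂ} (hu : SP u) (x : Spc) : FF (coef u) x = u x := by
  let uc : C(Spc, ℂ) := ⟨u, hu.1.continuous⟩
  have hfac : Function.FactorsThrough uc qq := by
    intro x y hxy
    have h1 : ∀ i, ∃ n : ℤ, x i + n = y i := by
      intro i
      have h2 : ((x i : ℝ) : UnitAddCircle) = (y i : ℝ) := congrFun hxy i
      have h3 : ((y i - x i : ℝ) : UnitAddCircle) = 0 := by
        rw [AddCircle.coe_sub, h2, sub_self]
      obtain ⟨n, hn⟩ := AddCircle.coe_eq_zero_iff (p := (1 : ℝ)) |>.1 h3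
      refine ⟨n, ?_⟩
      simp only [zsmul_eq_mul, mul_one] at hn
      linarith
    choose k hk using h1
    have := hu.2 x k
    simp_rw [hk] at this
    exact this.symm
  let f : C(UnitAddTorus (Fin 3), ℂ) := qq_quot.lift uc hfac
  have hf : ∀ y, f (qq y) = u y := fun y => by
    have := qq_quot.lift_comp uc hfac
    exact congrArg (fun g : C(Spc, ℂ) => g y) this
  have hc : ∀ ξ, UnitAddTorus.mFourierCoeff f ξ = coef u ξ := by
    intro ξ
    rw [UnitAddTorus.mFourierCoeff_eq_integral f ξ 0]
    unfold coef
    rw [setIntegral_congr_set Tdom_ae_Ioc]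
    congr 1
    ext y
    rw [← mFourier_qq, ← hf]
    rfl
  have hs : Summable (UnitAddTorus.mFourierCoeff f) := by
    have := (coef_rapid hu).summable.of_norm
    exact this.congr fun ξ => (hc ξ).symm
  have := UnitAddTorus.hasSum_mFourier_series_apply_of_summable hs (qq x)
  rw [hf] at this
  simp_rw [hc, mFourier_qq, smul_eq_mul] at this
  exact this.tsum_eq

end

section

/-- Trigonometric polynomials. -/
def TP (S : Finset Lam) (a : Lam → ℂ) (x : Spc) : ℂ := ∑ ξ ∈ S, a ξ * ee ξ x

lemma l2_expand {ι : Type*} (S : Finset ι) (l : ι → Lam) (c : ι → ℂ) :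
    ((∫ x in Tdom, ‖∑ i ∈ S, c i * ee (l i) x‖ ^ 2 : ℝ) : ℂ) =
      ∑ i ∈ S, ∑ j ∈ S, c i * (starRingEnd ℂ) (c j) * (if l i - l j = 0 then 1 else 0) := by
  rw [← integral_complex_ofReal]
  have h : ∀ x, (((‖∑ i ∈ S, c i * ee (l i) x‖ ^ 2 : ℝ)) : ℂ) =
      ∑ i ∈ S, ∑ j ∈ S, c i * (starRingEnd ℂ) (c j) * ee (l i - l j) x := by
    intro x
    push_cast
    rw [← Complex.mul_conj', map_sum, Finset.sum_mul_sum]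
    refine Finset.sum_congr rfl fun i _ => Finset.sum_congr rfl fun j _ => ?_
    rw [map_mul, ← ee_neg, sub_eq_add_neg, ee_add]
    ring
  simp_rw [h]
  have hi : ∀ i j, Integrable (fun x => c i * (starRingEnd ℂ) (c j) * ee (l i - l j) x)
      (volume.restrict Tdom) := fun i j =>
    integrable_of_cont ((ee_continuous _).const_mul _)
  rw [integral_finsetSum _ fun i _ => integrable_finsetSum _ fun j _ => hi i j]
  refine Finset.sum_congr rfl fun i _ => ?_
  rw [integral_finsetSum _ fun j _ => hi i j]
  refine Finset.sum_congr rfl fun j _ => ?_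
  rw [integral_const_mul, ee_integral]

lemma l2_isom {ι : Type*} (S : Finset ι) (l : ι → Lam) (c : ι → ℂ) (s : Lam → ℝ)
    (hs : ∀ ξ, s ξ * s ξ = 1) :
    ∫ x in Tdom, ‖∑ i ∈ S, (s (l i) * c i) * ee (l i) x‖ ^ 2 =
      ∫ x in Tdom, ‖∑ i ∈ S, c i * ee (l i) x‖ ^ 2 := by
  apply Complex.ofReal_injective
  rw [l2_expand, l2_expand]
  refine Finset.sum_congr rfl fun i _ => Finset.sum_congr rfl fun j _ => ?_
  split_ifs with h
  · rw [sub_eq_zero] at h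
    rw [h, map_mul, Complex.conj_ofReal]
    have : ((s (l j) : ℂ) * s (l j)) = 1 := by exact_mod_cast hs (l j)
    linear_combination (c i * (starRingEnd ℂ) (c j)) * this
  · simp

lemma TP_continuous (S : Finset Lam) (a : Lam → ℂ) : Continuous (TP S a) :=
  continuous_finsetSum _ fun ξ _ => (ee_continuous ξ).const_mul _

lemma cotlar (S : Finset Lam) (a : Lam → ℂ) (s : Lam → ℝ)
    (h2 : ∀ ξ η, s ξ * s η = -1 + s (ξ + η) * (s ξ + s η)) (x : Spc) :
    (TP S (fun ξ => s ξ * a ξ) x) ^ 2 = - (TP S a x) ^ 2 +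
      2 * ∑ p ∈ S ×ˢ S, ((s (p.1 + p.2) : ℂ) * (a p.1 * (s p.2 * a p.2))) * ee (p.1 + p.2) x := by
  have hsym : ∑ p ∈ S ×ˢ S, ((s (p.1 + p.2) : ℂ) * (a p.1 * (s p.2 * a p.2))) * ee (p.1 + p.2) x =
      ∑ p ∈ S ×ˢ S, ((s (p.1 + p.2) : ℂ) * (a p.2 * (s p.1 * a p.1))) * ee (p.1 + p.2) x := by
    rw [Finset.sum_product, Finset.sum_product_right]
    refine Finset.sum_congr rfl fun i _ => Finset.sum_congr rfl fun j _ => ?_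
    simp only
    rw [add_comm i j]
  rw [two_mul]
  nth_rewrite 2 [hsym]
  unfold TP
  rw [pow_two, pow_two, Finset.sum_mul_sum, Finset.sum_mul_sum, ← Finset.sum_product',
    ← Finset.sum_product', ← Finset.sum_add_distrib, ← Finset.sum_neg_distrib, ← Finset.sum_add_distrib]
  refine Finset.sum_congr rfl fun p _ => ?_
  have := h2 p.1 p.2
  have h3 : ((s p.1 : ℂ) * s p.2) = -1 + s (p.1 + p.2) * (s p.1 + s p.2) := by exact_mod_cast this
  rw [ee_add]
  linear_combination (a p.1 * a p.2 * ee p.1 x * ee p.2 x) * h3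

lemma l4_sign (S : Finset Lam) (a : Lam → ℂ) (s : Lam → ℝ) (hs : ∀ ξ, s ξ * s ξ = 1)
    (h2 : ∀ ξ η, s ξ * s η = -1 + s (ξ + η) * (s ξ + s η)) :
    ∫ x in Tdom, ‖TP S (fun ξ => s ξ * a ξ) x‖ ^ 4 ≤ 68 * ∫ x in Tdom, ‖TP S a x‖ ^ 4 := by
  set f := TP S a with hf
  set g := TP S (fun ξ => s ξ * a ξ) with hg
  have cf : Continuous f := TP_continuous _ _
  have cg : Continuous g := TP_continuous _ _
  let h : Spc → ℂ := fun x => ∑ p ∈ S ×ˢ S, ((s (p.1 + p.2) : ℂ) * (a p.1 * (s p.2 * a p.2))) * ee (p.1 + p.2) x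
  have ch : Continuous h := continuous_finsetSum _ fun p _ => (ee_continuous _).const_mul _
  have hh : ∫ x in Tdom, ‖h x‖ ^ 2 = ∫ x in Tdom, ‖f x * g x‖ ^ 2 := by
    have := l2_isom (S ×ˢ S) (fun p : Lam × Lam => p.1 + p.2) (fun p => a p.1 * (s p.2 * a p.2)) s hs
    refine this.trans ?_
    congr 1
    ext x
    congr 2
    rw [hf, hg]
    unfold TP
    rw [Finset.sum_mul_sum, ← Finset.sum_product']
    refine Finset.sum_congr rfl fun p _ => ?_
    rw [ee_add]
    ring
  have hpt : ∀ x, ‖g x‖ ^ 4 ≤ 2 * ‖f x‖ ^ 4 + 8 * ‖h x‖ ^ 2 := by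
    intro x
    have e := cotlar S a s h2 x
    have e2 : ‖g x‖ ^ 2 ≤ ‖f x‖ ^ 2 + 2 * ‖h x‖ := by
      rw [← norm_pow, hg, e]
      refine (norm_add_le _ _).trans (le_of_eq ?_)
      rw [norm_neg, norm_mul, norm_pow]
      simp [h, hf]
    have p1 := norm_nonneg (g x)
    have p2 := norm_nonneg (h x)
    calc ‖g x‖ ^ 4 = (‖g x‖ ^ 2) ^ 2 := by ring
      _ ≤ (‖f x‖ ^ 2 + 2 * ‖h x‖) ^ 2 := by gcongr
      _ ≤ _ := by nlinarith [sq_nonneg (‖f x‖ ^ 2 - 2 * ‖h x‖)]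
  have hpt2 : ∀ x, 8 * ‖f x * g x‖ ^ 2 ≤ 32 * ‖f x‖ ^ 4 + (1 / 2) * ‖g x‖ ^ 4 := by
    intro x
    rw [norm_mul]
    nlinarith [sq_nonneg (8 * ‖f x‖ ^ 2 - ‖g x‖ ^ 2)]
  have if4 : Integrable (fun x => ‖f x‖ ^ 4) (volume.restrict Tdom) := integrable_of_cont (by fun_prop)
  have ig4 : Integrable (fun x => ‖g x‖ ^ 4) (volume.restrict Tdom) := integrable_of_cont (by fun_prop)
  have ih2 : Integrable (fun x => ‖h x‖ ^ 2) (volume.restrict Tdom) := integrable_of_cont (by fun_prop)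
  have ifg : Integrable (fun x => ‖f x * g x‖ ^ 2) (volume.restrict Tdom) := integrable_of_cont (by fun_prop)
  have i1 := integral_mono ig4 ((if4.const_mul 2).add (ih2.const_mul 8)) hpt
  have i2 := integral_mono (ifg.const_mul 8) ((if4.const_mul 32).add (ig4.const_mul (1/2))) hpt2
  rw [integral_add' (if4.const_mul 2) (ih2.const_mul 8), integral_const_mul, integral_const_mul] at i1
  rw [integral_add' (if4.const_mul 32) (ig4.const_mul (1/2)), integral_const_mul, integral_const_mul,
    integral_const_mul] at i2
  rw [hh] at i1
  linarith

abbrev E3 : Type := EuclideanSpace ℝ (Fin 3)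

/-- sign without zero -/
def sg (t : ℝ) : ℝ := if 0 ≤ t then 1 else -1

lemma sg_sq (t : ℝ) : sg t * sg t = 1 := by unfold sg; split_ifs <;> norm_num

lemma sg_add (t u : ℝ) : sg t * sg u = -1 + sg (t + u) * (sg t + sg u) := by
  unfold sg
  split_ifs <;> first | (exfalso; linarith) | norm_num

lemma sg_mul (t : ℝ) : sg t * t = |t| := by
  unfold sg
  split_ifs with h
  · rw [abs_of_nonneg h, one_mul]
  · rw [abs_of_neg (not_le.1 h)]; ring

lemma sg_abs (t : ℝ) : |sg t| = 1 := by unfold sg; split_ifs <;> norm_num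

lemma sg_meas : Measurable sg := by
  unfold sg
  exact Measurable.ite measurableSet_Ici measurable_const measurable_const

abbrev BB : Set E3 := Metric.ball 0 1

instance : IsFiniteMeasure ((volume : Measure E3).restrict BB) :=
  ⟨by rw [Measure.restrict_apply_univ]; exact measure_ball_lt_top⟩

/-- the averaged sign -/
def JJ (ξ v : E3) : ℝ := ∫ θ in BB, sg (inner ℝ ξ θ) * inner ℝ v θ

lemma JJ_integrable (ξ v : E3) :
    Integrable (fun θ : E3 => sg (inner ℝ ξ θ) * inner ℝ v θ) (volume.restrict BB) := by
  refine Integrable.mono' (g := fun _ => ‖v‖) ?_ ?_ ?_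
  · exact integrable_const _
  · exact ((sg_meas.comp (by fun_prop)).mul (by fun_prop)).aestronglyMeasurable
  · refine (ae_restrict_iff' measurableSet_ball).2 (Filter.Eventually.of_forall fun θ hθ => ?_)
    rw [norm_mul, Real.norm_eq_abs, sg_abs, one_mul]
    refine (norm_inner_le_norm v θ).trans ?_
    have : ‖θ‖ ≤ 1 := (mem_ball_zero_iff.1 hθ).le
    nlinarith [norm_nonneg v]

lemma ball_isom (A : E3 ≃ₗᵢ[ℝ] E3) (F : E3 → ℝ) : ∫ θ in BB, F (A θ) = ∫ θ in BB, F θ := by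
  have h := A.measurePreserving
  have := h.setIntegral_preimage_emb A.toHomeomorph.measurableEmbedding F BB
  rw [← this]
  congr 2
  ext θ
  simp

lemma JJ_isom (A : E3 ≃ₗᵢ[ℝ] E3) (ξ v : E3) : JJ (A ξ) (A v) = JJ ξ v := by
  unfold JJ
  rw [← ball_isom A]
  simp

lemma JJ_perp (ξ v : E3) (h : inner ℝ ξ v = 0) : JJ ξ v = 0 := by
  have h1 := JJ_isom (Submodule.reflection (Submodule.span ℝ {v})ᗮ) ξ v
  rw [Submodule.reflection_orthogonalComplement_singleton_eq_neg,
    Submodule.reflection_mem_subspace_eq_self (Submodule.mem_orthogonal_singleton_iff_inner_left.2 h)] at h1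
  have h2 : JJ ξ (-v) = - JJ ξ v := by
    unfold JJ
    rw [← integral_neg]
    simp
  linarith

/-- first basis vector -/
def e0 : E3 := EuclideanSpace.single 0 1

/-- the normalising constant -/
def c0 : ℝ := ∫ θ in BB, |inner ℝ e0 θ|

lemma e0_norm : ‖e0‖ = 1 := by simp [e0]

lemma abs_int (ξ : E3) : ∫ θ in BB, |inner ℝ ξ θ| = ‖ξ‖ * c0 := by
  have h : ‖ξ‖ = ‖(‖ξ‖ • e0 : E3)‖ := by
    rw [norm_smul, e0_norm]; simp
  have h1 := Submodule.reflection_sub h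
  rw [← ball_isom (Submodule.reflection (Submodule.span ℝ {ξ - ‖ξ‖ • e0})ᗮ)]
  have : ∀ θ, inner ℝ ξ (Submodule.reflection (Submodule.span ℝ {ξ - ‖ξ‖ • e0})ᗮ θ) = ‖ξ‖ * inner ℝ e0 θ := by
    intro θ
    have h3 := (Submodule.reflection (Submodule.span ℝ {ξ - ‖ξ‖ • e0})ᗮ).inner_map_map (‖ξ‖ • e0) θ
    have h4 : Submodule.reflection (Submodule.span ℝ {ξ - ‖ξ‖ • e0})ᗮ (‖ξ‖ • e0) = ξ := by
      have := congrArg (Submodule.reflection (Submodule.span ℝ {ξ - ‖ξ‖ • e0})ᗮ) h1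
      rw [Submodule.reflection_reflection] at this
      exact this.symm
    rw [h4] at h3
    rw [h3, real_inner_smul_left]
  simp_rw [this, abs_mul, abs_norm]
  rw [integral_const_mul]
  rfl

lemma c0_pos : 0 < c0 := by
  unfold c0
  have hc : Continuous fun θ : E3 => |inner ℝ e0 θ| := by fun_prop
  have hi : IntegrableOn (fun θ : E3 => |inner ℝ e0 θ|) BB :=
    (hc.continuousOn.integrableOn_compact (isCompact_closedBall (0 : E3) 1)).mono_set
      Metric.ball_subset_closedBall
  rw [setIntegral_pos_iff_support_of_nonneg_ae (Filter.Eventually.of_forall fun θ => abs_nonneg _) hi]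
  refine IsOpen.measure_pos _ ((hc.isOpen_support).inter Metric.isOpen_ball) ?_
  refine ⟨(1 / 2 : ℝ) • e0, ?_, ?_⟩
  · simp [Function.mem_support, real_inner_smul_right, e0_norm]
  · simp [norm_smul, e0_norm]
    norm_num

lemma JJ_eq (ξ : E3) (i : Fin 3) : ∫ θ in BB, sg (inner ℝ ξ θ) * θ i = c0 * (ξ i / ‖ξ‖) := by
  have h0 : ∀ θ : E3, θ i = inner ℝ (EuclideanSpace.single i (1:ℝ)) θ := by intro θ; simp [EuclideanSpace.inner_single_left]
  have h1 : ∫ θ in BB, sg (inner ℝ ξ θ) * θ i = JJ ξ (EuclideanSpace.single i 1) := by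
    unfold JJ; simp_rw [← h0]
  rw [h1]
  by_cases hξ : ξ = 0
  · subst hξ
    rw [JJ_perp _ _ (by simp)]
    simp
  have hn : ‖ξ‖ ≠ 0 := norm_ne_zero_iff.2 hξ
  set t := ξ i / ‖ξ‖ ^ 2 with ht
  have hp := JJ_perp ξ (EuclideanSpace.single i 1 - t • ξ) (by
    rw [inner_sub_right, real_inner_smul_right, real_inner_self_eq_norm_sq, real_inner_comm, ← h0, ht]
    field_simp
    ring)
  have hl : JJ ξ (EuclideanSpace.single i 1 - t • ξ) = JJ ξ (EuclideanSpace.single i 1) - t * JJ ξ ξ := by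
    unfold JJ
    rw [← integral_const_mul, ← integral_sub (JJ_integrable _ _) ((JJ_integrable _ _).const_mul _)]
    congr 1
    ext θ
    rw [inner_sub_left, real_inner_smul_left]
    ring
  have hs : JJ ξ ξ = ‖ξ‖ * c0 := by
    rw [← abs_int]
    unfold JJ
    simp_rw [sg_mul]
  rw [hl, hs, ht] at hp
  rw [sub_eq_zero.1 hp]
  field_simp


/-- embedding of frequencies -/
def emb (ξ : Lam) : E3 := WithLp.toLp 2 fun j => (ξ j : ℝ)

/-- Riesz symbol -/
def rz (i : Fin 3) (ξ : Lam) : ℝ := (ξ i : ℝ) / ‖emb ξ‖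

/-- sign symbol -/
def sgn (θ : E3) (ξ : Lam) : ℝ := sg (inner ℝ (emb ξ) θ)

lemma emb_add (ξ η : Lam) : emb (ξ + η) = emb ξ + emb η := by
  ext j
  simp [emb]

lemma sgn_meas (ξ : Lam) : Measurable fun θ => sgn θ ξ := sg_meas.comp (by fun_prop)

lemma sgn_int (ξ : Lam) (i : Fin 3) : ∫ θ in BB, sgn θ ξ * θ i = c0 * rz i ξ := by
  unfold sgn rz
  rw [JJ_eq]
  rfl

lemma sgn_integrable (ξ : Lam) (i : Fin 3) :
    Integrable (fun θ : E3 => sgn θ ξ * θ i) (volume.restrict BB) := by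
  have := JJ_integrable (emb ξ) (EuclideanSpace.single i 1)
  refine this.congr (Filter.Eventually.of_forall fun θ => ?_)
  simp [EuclideanSpace.inner_single_left, sgn]

lemma TP_bound (S : Finset Lam) (a : Lam → ℂ) (x : Spc) : ‖TP S a x‖ ≤ ∑ ξ ∈ S, ‖a ξ‖ := by
  refine (norm_sum_le _ _).trans (le_of_eq ?_)
  simp_rw [norm_term]

lemma TP_sgn_bound (S : Finset Lam) (a : Lam → ℂ) (θ : E3) (x : Spc) :
    ‖TP S (fun ξ => sgn θ ξ * a ξ) x‖ ≤ ∑ ξ ∈ S, ‖a ξ‖ := by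
  refine (TP_bound _ _ _).trans (le_of_eq ?_)
  refine Finset.sum_congr rfl fun ξ _ => ?_
  rw [norm_mul, Complex.norm_real, Real.norm_eq_abs, sgn, sg_abs, one_mul]

lemma jensen4 {Ω : Type*} [MeasurableSpace Ω] (μ : Measure Ω) [IsFiniteMeasure μ]
    (g : Ω → ℝ) (hg : Integrable g μ) (hg4 : Integrable (fun x => g x ^ 4) μ) (h0 : ∀ x, 0 ≤ g x) :
    (∫ x, g x ∂μ) ^ 4 ≤ (μ.real Set.univ) ^ 3 * ∫ x, g x ^ 4 ∂μ := by
  set V := μ.real Set.univ with hV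
  have hVn : 0 ≤ V := measureReal_nonneg
  rcases hVn.eq_or_lt with hz | hp
  · have : μ = 0 := by
      rw [eq_comm, hV, measureReal_eq_zero_iff] at hz
      exact Measure.measure_univ_eq_zero.1 hz
    simp [this]
  set t := (∫ x, g x ∂μ) / V with ht
  have htn : 0 ≤ t := div_nonneg (integral_nonneg h0) hVn
  have hpt : ∀ x, 4 * t ^ 3 * g x - 3 * t ^ 4 ≤ g x ^ 4 := by
    intro x
    have := h0 x
    nlinarith [sq_nonneg (g x ^ 2 - t ^ 2), sq_nonneg (t * (g x - t)), sq_nonneg (g x * (g x - t)),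
      mul_nonneg (mul_nonneg htn this) (sq_nonneg (g x - t))]
  have := integral_mono ((hg.const_mul (4 * t ^ 3)).sub (integrable_const (3 * t ^ 4))) hg4 hpt
  rw [integral_sub' (hg.const_mul (4 * t ^ 3)) (integrable_const (3 * t ^ 4)), integral_const_mul,
    integral_const, smul_eq_mul, ← hV] at this
  have hi : (∫ x, g x ∂μ) = t * V := by rw [ht]; field_simp
  rw [hi] at this ⊢
  have h3 : 0 ≤ V ^ 3 := by positivity
  nlinarith

lemma riesz_pt (S : Finset Lam) (a : Lam → ℂ) (i : Fin 3) (x : Spc) :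
    (c0 : ℂ) * TP S (fun ξ => rz i ξ * a ξ) x = ∫ θ in BB, (θ i : ℂ) * TP S (fun ξ => sgn θ ξ * a ξ) x := by
  have h : ∀ θ : E3, (θ i : ℂ) * TP S (fun ξ => sgn θ ξ * a ξ) x =
      ∑ ξ ∈ S, ((sgn θ ξ * θ i : ℝ) : ℂ) * (a ξ * ee ξ x) := by
    intro θ
    unfold TP
    rw [Finset.mul_sum]
    refine Finset.sum_congr rfl fun ξ _ => ?_
    push_cast
    ring
  simp_rw [h]
  rw [integral_finsetSum _ fun ξ _ => (sgn_integrable ξ i).ofReal.mul_const _]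
  unfold TP
  rw [Finset.mul_sum]
  refine Finset.sum_congr rfl fun ξ _ => ?_
  rw [integral_mul_const, integral_complex_ofReal, sgn_int]
  push_cast
  ring

lemma sgn_sq (θ : E3) (ξ : Lam) : sgn θ ξ * sgn θ ξ = 1 := sg_sq _

lemma sgn_cot (θ : E3) (ξ η : Lam) : sgn θ ξ * sgn θ η = -1 + sgn θ (ξ + η) * (sgn θ ξ + sgn θ η) := by
  unfold sgn
  rw [emb_add, inner_add_left]
  exact sg_add _ _

/-- the `L⁴` constant for Riesz transforms -/
def KR : ℝ := (c0⁻¹) ^ 4 * ((volume.restrict BB).real Set.univ ^ 3 * ((volume.restrict BB).real Set.univ * 68))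

lemma KR_nonneg : 0 ≤ KR := by unfold KR; have := c0_pos; positivity

lemma riesz_fin (S : Finset Lam) (a : Lam → ℂ) (i : Fin 3) :
    ∫ x in Tdom, ‖TP S (fun ξ => rz i ξ * a ξ) x‖ ^ 4 ≤ KR * ∫ x in Tdom, ‖TP S a x‖ ^ 4 := by
  set V := (volume.restrict BB).real Set.univ with hV
  set M := ∑ ξ ∈ S, ‖a ξ‖ with hM
  have hc := c0_pos
  let G : Spc → E3 → ℝ := fun x θ => ‖TP S (fun ξ => sgn θ ξ * a ξ) x‖
  have hGm : Measurable (Function.uncurry G) := by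
    refine Measurable.norm ?_
    refine Finset.measurable_fun_sum _ fun ξ _ => ?_
    refine Measurable.mul (Measurable.mul_const ?_ _) ((ee_continuous ξ).measurable.comp measurable_fst)
    exact Complex.measurable_ofReal.comp ((sgn_meas ξ).comp measurable_snd)
  have hGb : ∀ x θ, ‖G x θ‖ ≤ M := fun x θ => by
    rw [Real.norm_of_nonneg (norm_nonneg _)]; exact TP_sgn_bound S a θ x
  have hG4b : ∀ x θ, ‖G x θ ^ 4‖ ≤ M ^ 4 := fun x θ => by
    rw [norm_pow]
    exact pow_le_pow_left₀ (norm_nonneg _) (hGb x θ) 4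
  have hGi : ∀ x, Integrable (G x) (volume.restrict BB) := fun x =>
    Integrable.of_bound (hGm.comp measurable_prodMk_left).aestronglyMeasurable M
      (Filter.Eventually.of_forall (hGb x))
  have hG4m : Measurable (Function.uncurry fun x θ => G x θ ^ 4) := hGm.pow_const 4
  have hG4i : ∀ x, Integrable (fun θ => G x θ ^ 4) (volume.restrict BB) := fun x =>
    Integrable.of_bound (hG4m.comp measurable_prodMk_left).aestronglyMeasurable (M ^ 4)
      (Filter.Eventually.of_forall (hG4b x))
  have hprod : Integrable (Function.uncurry fun x θ => G x θ ^ 4)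
      ((volume.restrict Tdom).prod (volume.restrict BB)) :=
    Integrable.of_bound hG4m.aestronglyMeasurable (M ^ 4)
      (Filter.Eventually.of_forall fun p => hG4b p.1 p.2)
  have hpt : ∀ x, ‖TP S (fun ξ => rz i ξ * a ξ) x‖ ^ 4 ≤ (c0⁻¹) ^ 4 * (V ^ 3 * ∫ θ in BB, G x θ ^ 4) := by
    intro x
    have h1 : c0 * ‖TP S (fun ξ => rz i ξ * a ξ) x‖ ≤ ∫ θ in BB, G x θ := by
      have := congrArg norm (riesz_pt S a i x)
      rw [norm_mul, Complex.norm_of_nonneg hc.le] at this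
      rw [this]
      refine norm_integral_le_of_norm_le (hGi x) ?_
      refine (ae_restrict_iff' measurableSet_ball).2 (Filter.Eventually.of_forall fun θ hθ => ?_)
      rw [norm_mul]
      have h2 : ‖(θ i : ℂ)‖ ≤ 1 := by
        rw [Complex.norm_real]
        exact (PiLp.norm_apply_le θ i).trans (mem_ball_zero_iff.1 hθ).le
      exact mul_le_of_le_one_left (norm_nonneg _) h2
    have h2 : ‖TP S (fun ξ => rz i ξ * a ξ) x‖ ≤ c0⁻¹ * ∫ θ in BB, G x θ := by
      rw [← div_eq_inv_mul, le_div_iff₀ hc]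
      linarith
    calc _ ≤ (c0⁻¹ * ∫ θ in BB, G x θ) ^ 4 := pow_le_pow_left₀ (norm_nonneg _) h2 4
      _ = (c0⁻¹) ^ 4 * (∫ θ in BB, G x θ) ^ 4 := mul_pow _ _ _
      _ ≤ _ := by
        gcongr
        exact jensen4 _ _ (hGi x) (hG4i x) fun θ => norm_nonneg _
  have hl : Integrable (fun x => ‖TP S (fun ξ => rz i ξ * a ξ) x‖ ^ 4) (volume.restrict Tdom) :=
    integrable_of_cont ((TP_continuous _ _).norm.pow 4)
  have hr : Integrable (fun x => ∫ θ in BB, G x θ ^ 4) (volume.restrict Tdom) := hprod.integral_prod_left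
  have i1 := integral_mono hl ((hr.const_mul (V ^ 3)).const_mul ((c0⁻¹) ^ 4)) hpt
  rw [integral_const_mul, integral_const_mul, integral_integral_swap hprod] at i1
  have i2 : ∫ θ in BB, ∫ x in Tdom, G x θ ^ 4 ≤ ∫ θ in BB, 68 * ∫ x in Tdom, ‖TP S a x‖ ^ 4 := by
    refine integral_mono hprod.integral_prod_right (integrable_const _) fun θ => ?_
    exact l4_sign S a (sgn θ) (sgn_sq θ) (sgn_cot θ)
  rw [integral_const, smul_eq_mul, ← hV] at i2
  refine i1.trans ?_
  unfold KR
  rw [← hV]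
  have hVn : 0 ≤ V := measureReal_nonneg
  calc _ ≤ c0⁻¹ ^ 4 * (V ^ 3 * (V * (68 * ∫ x in Tdom, ‖TP S a x‖ ^ 4))) := by gcongr
    _ = _ := by ring

lemma rz_abs (i : Fin 3) (ξ : Lam) : |rz i ξ| ≤ 1 := by
  unfold rz
  rw [abs_div, abs_norm]
  exact div_le_one_of_le₀ (PiLp.norm_apply_le (emb ξ) i) (norm_nonneg _)

lemma Rapid.rz {a : Lam → ℂ} (ha : Rapid a) (i : Fin 3) : Rapid (fun ξ => rz i ξ * a ξ) := by
  refine ha.of_le 1 0 fun ξ => ?_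
  rw [norm_mul, Complex.norm_real, pow_zero, mul_one]
  gcongr
  exact rz_abs i ξ

lemma TP_tendsto {a : Lam → ℂ} (ha : Rapid a) :
    Filter.Tendsto (fun S => ∫ x in Tdom, ‖TP S a x‖ ^ 4) Filter.atTop
      (nhds (∫ x in Tdom, ‖FF a x‖ ^ 4)) := by
  refine tendsto_integral_filter_of_dominated_convergence (fun _ => (∑' ξ, ‖a ξ‖) ^ 4) ?_ ?_ ?_ ?_
  · exact Filter.Eventually.of_forall fun S => ((TP_continuous S a).norm.pow 4).aestronglyMeasurable
  · refine Filter.Eventually.of_forall fun S => Filter.Eventually.of_forall fun x => ?_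
    rw [norm_pow, norm_norm]
    refine pow_le_pow_left₀ (norm_nonneg _) ((TP_bound S a x).trans ?_) 4
    exact ha.summable.sum_le_tsum _ fun _ _ => norm_nonneg _
  · exact integrable_const _
  · refine Filter.Eventually.of_forall fun x => ?_
    exact ((ha.summable_term x).hasSum.norm).pow 4

lemma riesz {a : Lam → ℂ} (ha : Rapid a) (i : Fin 3) :
    ∫ x in Tdom, ‖FF (fun ξ => rz i ξ * a ξ) x‖ ^ 4 ≤ KR * ∫ x in Tdom, ‖FF a x‖ ^ 4 :=
  le_of_tendsto_of_tendsto' (TP_tendsto (ha.rz i)) ((TP_tendsto ha).const_mul KR)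
    fun S => riesz_fin S a i

end

section

/-- inverse Laplacian symbol -/
def pa (a : Lam → ℂ) (ξ : Lam) : ℂ := ((-(4 * Real.pi ^ 2 * ‖emb ξ‖ ^ 2)⁻¹ : ℝ) : ℂ) * a ξ

lemma emb_norm_ge {ξ : Lam} (h : ξ ≠ 0) : 1 ≤ ‖emb ξ‖ := by
  obtain ⟨j, hj⟩ : ∃ j, ξ j ≠ 0 := by
    by_contra hh
    push Not at hh
    exact h (funext hh)
  refine le_trans ?_ (PiLp.norm_apply_le (emb ξ) j)
  have h1 : (1 : ℤ) ≤ |ξ j| := Int.one_le_abs hj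
  have : ‖(emb ξ) j‖ = ((|ξ j| : ℤ) : ℝ) := by
    simp [emb]
  rw [this]
  exact_mod_cast h1

lemma emb_zero : emb 0 = 0 := by ext j; simp [emb]

lemma Rapid.pa {a : Lam → ℂ} (ha : Rapid a) : Rapid (pa a) := by
  refine ha.of_le 1 0 fun ξ => ?_
  unfold InvDiv.pa
  rw [norm_mul, Complex.norm_real, pow_zero, mul_one]
  refine mul_le_mul_of_nonneg_right ?_ (norm_nonneg _)
  rw [norm_neg, norm_inv]
  by_cases h : ξ = 0
  · subst h; simp [emb_zero]
  · refine inv_le_one_of_one_le₀ ?_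
    have h1 := emb_norm_ge h
    rw [Real.norm_of_nonneg (by positivity)]
    have h2 : 1 ≤ ‖emb ξ‖ ^ 2 := one_le_pow₀ h1
    have h3 : 1 ≤ 4 * Real.pi ^ 2 := by nlinarith [Real.pi_gt_three]
    nlinarith

lemma dm_dm_pa (i j : Fin 3) (a : Lam → ℂ) :
    dm i (dm j (pa a)) = fun ξ => rz i ξ * (rz j ξ * a ξ) := by
  funext ξ
  unfold dm pa rz
  by_cases h : ξ = 0
  · subst h; simp
  · have h1 : (‖emb ξ‖ : ℂ) ≠ 0 := by
      have := emb_norm_ge h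
      exact_mod_cast (by linarith : ‖emb ξ‖ ≠ 0)
    have hpi : (Real.pi : ℂ) ≠ 0 := by exact_mod_cast Real.pi_ne_zero
    push_cast
    field_simp
    linear_combination (-(ξ i : ℂ) * (ξ j : ℂ) * 4 * a ξ) * Complex.I_sq

lemma dm_comm (i j : Fin 3) (a : Lam → ℂ) : dm i (dm j a) = dm j (dm i a) := by
  funext ξ; unfold dm; ring

lemma dm_pa (i : Fin 3) (a : Lam → ℂ) : pa (dm i a) = dm i (pa a) := by
  funext ξ; unfold dm pa; ring

lemma rz_sq_sum {ξ : Lam} (h : ξ ≠ 0) : ∑ j, rz j ξ * rz j ξ = 1 := by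
  have h1 := emb_norm_ge h
  have h2 : ‖emb ξ‖ ^ 2 = ∑ j, (ξ j : ℝ) ^ 2 := by
    rw [EuclideanSpace.norm_sq_eq]
    simp [emb]
  unfold rz
  have h3 : ∀ j, (ξ j : ℝ) / ‖emb ξ‖ * ((ξ j : ℝ) / ‖emb ξ‖) = (ξ j : ℝ) ^ 2 / ‖emb ξ‖ ^ 2 := by
    intro j; field_simp
  simp_rw [h3]
  rw [← Finset.sum_div, ← h2, div_self (by positivity)]

lemma FF_sum3 {a : Fin 3 → Lam → ℂ} (ha : ∀ j, Rapid (a j)) (x : Spc) :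
    FF (fun ξ => ∑ j, a j ξ) x = ∑ j, FF (a j) x := by
  simp_rw [Fin.sum_univ_three]
  rw [FF_add ((ha 0).add (ha 1)) (ha 2), FF_add (ha 0) (ha 1)]

lemma FF_delta (c : ℂ) (x : Spc) : FF (fun ξ => if ξ = 0 then c else 0) x = c := by
  unfold FF
  rw [tsum_eq_single 0]
  · simp [ee_zero]
  · intro ξ h; simp [h]

lemma Rapid.delta (c : ℂ) : Rapid (fun ξ => if ξ = 0 then c else 0) := by
  intro N
  refine ⟨‖c‖, fun ξ => ?_⟩
  beta_reduce
  split_ifs with h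
  · subst h; simp
  · simp

lemma laplace {a : Lam → ℂ} (ha : Rapid a) (x : Spc) :
    ∑ j, FF (dm j (dm j (pa a))) x = FF a x - a 0 := by
  rw [← FF_sum3 (fun j => (ha.pa.dm j).dm j), eq_sub_iff_add_eq]
  have hs : Rapid (fun ξ => ∑ j, dm j (dm j (pa a)) ξ) := by
    simp_rw [Fin.sum_univ_three]
    exact (((ha.pa.dm 0).dm 0).add ((ha.pa.dm 1).dm 1)).add ((ha.pa.dm 2).dm 2)
  have hd : FF (fun ξ => ∑ j, dm j (dm j (pa a)) ξ) x + a 0 =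
      FF (fun ξ => ∑ j, dm j (dm j (pa a)) ξ) x + FF (fun ξ => if ξ = 0 then a 0 else 0) x := by
    rw [FF_delta]
  rw [hd, ← FF_add hs (Rapid.delta _)]
  congr 1
  funext ξ
  simp_rw [dm_dm_pa]
  split_ifs with h
  · subst h
    simp [rz]
  · have := rz_sq_sum h
    have h2 : (∑ j, (rz j ξ : ℂ) * rz j ξ) = 1 := by exact_mod_cast this
    rw [add_zero]
    simp_rw [← mul_assoc]
    rw [← Finset.sum_mul, h2, one_mul]



variable {E F : Type*} [NormedAddCommGroup E] [NormedSpace ℝ E] [NormedAddCommGroup F] [NormedSpace ℝ F]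

lemma pd_clm (L : E →L[ℝ] F) {f : Spc → E} {x : Spc} (hf : DifferentiableAt ℝ f x) (j : Fin 3) :
    pd j (fun y => L (f y)) x = L (pd j f x) := by
  unfold pd
  have := L.hasFDerivAt.comp x hf.hasFDerivAt
  rw [show (fun y => L (f y)) = L ∘ f from rfl, this.fderiv]
  rfl

/-- complexified component -/
def cU (U : Spc → Spc) (l : Fin 3) (x : Spc) : ℂ := (U x l : ℂ)

lemma SP.diff {f : Spc → E} (hf : SP f) (x : Spc) : DifferentiableAt ℝ f x :=
  (hf.cd 1).differentiable (by norm_num) x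

/-- component as a linear map -/
def cL (l : Fin 3) : Spc →L[ℝ] ℂ := Complex.ofRealCLM.comp (ContinuousLinearMap.proj l)

lemma cU_eq (U : Spc → Spc) (l : Fin 3) : cU U l = fun x => cL l (U x) := rfl

lemma cU_SP {U : Spc → Spc} (hU : SP U) (l : Fin 3) : SP (cU U l) := by
  constructor
  · rw [cU_eq]; exact (cL l).contDiff.comp hU.1
  · intro x k
    unfold cU
    rw [hU.2 x k]

lemma cU_pd {U : Spc → Spc} (hU : SP U) (l i : Fin 3) : cU (pd i U) l = pd i (cU U l) := by
  funext x
  rw [cU_eq, cU_eq]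
  exact (pd_clm (cL l) (hU.diff x) i).symm

/-- Fourier coefficients of a component -/
def cc (U : Spc → Spc) (l : Fin 3) : Lam → ℂ := coef (cU U l)

lemma cc_rapid {U : Spc → Spc} (hU : SP U) (l : Fin 3) : Rapid (cc U l) := coef_rapid (cU_SP hU l)

lemma cc_pd {U : Spc → Spc} (hU : SP U) (l i : Fin 3) : cc (pd i U) l = dm i (cc U l) := by
  unfold cc
  rw [cU_pd hU]
  funext ξ
  exact coef_pd (cU_SP hU l) i ξ

lemma cc_add {U W : Spc → Spc} (hU : SP U) (hW : SP W) (l : Fin 3) :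
    cc (U + W) l = fun ξ => cc U l ξ + cc W l ξ := by
  funext ξ
  unfold cc coef
  have h1 : ∀ V : Spc → Spc, SP V →
      Integrable (fun y => ee (-ξ) y * cU V l y) (volume.restrict Tdom) := fun V hV =>
    integrable_of_cont ((ee_continuous _).mul (cU_SP hV l).1.continuous)
  rw [← integral_add (h1 U hU) (h1 W hW)]
  congr 1
  funext y
  simp only [cU, Pi.add_apply, Complex.ofReal_add]
  ring

lemma cc_smul (c : ℝ) (U : Spc → Spc) (l : Fin 3) :
    cc (c • U) l = fun ξ => (c : ℂ) * cc U l ξ := by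
  funext ξ
  unfold cc coef
  rw [← integral_const_mul]
  congr 1
  funext y
  simp only [cU, Pi.smul_apply, smul_eq_mul, Complex.ofReal_mul]
  ring

/-- `∂_j φ^l` -/
def DD (U : Spc → Spc) (j l : Fin 3) (x : Spc) : ℝ := (FF (dm j (pa (cc U l))) x).re

/-- the operator on smooth periodic fields -/
def T0 (U : Spc → Spc) (x : Spc) (j l : Fin 3) : ℝ :=
  DD U j l x + DD U l j x - if j = l then ∑ p, DD U p p x else 0

lemma DD_add {U W : Spc → Spc} (hU : SP U) (hW : SP W) (j l : Fin 3) (x : Spc) :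
    DD (U + W) j l x = DD U j l x + DD W j l x := by
  unfold DD
  rw [← Complex.add_re, ← FF_add ((cc_rapid hU l).pa.dm j) ((cc_rapid hW l).pa.dm j), cc_add hU hW]
  congr 2
  funext ξ
  unfold dm pa
  ring

lemma DD_smul (c : ℝ) (U : Spc → Spc) (j l : Fin 3) (x : Spc) :
    DD (c • U) j l x = c * DD U j l x := by
  unfold DD
  rw [← Complex.re_ofReal_mul, ← FF_smul, cc_smul]
  congr 2
  funext ξ
  unfold dm pa
  ring

lemma FFre_SP {a : Lam → ℂ} (ha : Rapid a) : SP (fun x => (FF a x).re) :=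
  ⟨Complex.reCLM.contDiff.comp (FF_contDiff ha), fun x k => by simp only; rw [FF_per a x k]⟩

lemma FFre_pd {a : Lam → ℂ} (ha : Rapid a) (i : Fin 3) (x : Spc) :
    pd i (fun x => (FF a x).re) x = (FF (dm i a) x).re := by
  rw [← FF_pd ha i x]
  exact pd_clm Complex.reCLM (FF_hasFDerivAt ha x).differentiableAt i

lemma DD_SP {U : Spc → Spc} (hU : SP U) (j l : Fin 3) : SP (DD U j l) :=
  FFre_SP ((cc_rapid hU l).pa.dm j)

lemma DD_pd {U : Spc → Spc} (hU : SP U) (i j l : Fin 3) (x : Spc) :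
    pd i (DD U j l) x = (FF (dm i (dm j (pa (cc U l)))) x).re :=
  FFre_pd ((cc_rapid hU l).pa.dm j) i x

lemma DD_pd' {U : Spc → Spc} (hU : SP U) (i j l : Fin 3) (x : Spc) :
    DD (pd i U) j l x = pd i (DD U j l) x := by
  rw [DD_pd hU]
  unfold DD
  rw [cc_pd hU, dm_pa, dm_comm]

lemma T0_comp_SP {U : Spc → Spc} (hU : SP U) (j l : Fin 3) : SP (fun x => T0 U x j l) := by
  constructor
  · unfold T0
    refine ((DD_SP hU j l).1.add (DD_SP hU l j).1).sub ?_
    split_ifs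
    · exact ContDiff.sum fun p _ => (DD_SP hU p p).1
    · exact contDiff_const
  · intro x k
    simp only [T0]
    rw [(DD_SP hU j l).2 x k, (DD_SP hU l j).2 x k]
    simp_rw [fun p => (DD_SP hU p p).2 x k]

lemma T0_SP {U : Spc → Spc} (hU : SP U) : SP (T0 U) := by
  constructor
  · exact contDiff_pi.2 fun j => contDiff_pi.2 fun l => (T0_comp_SP hU j l).1
  · intro x k
    funext j l
    exact (T0_comp_SP hU j l).2 x k

/-- formula for the derivatives of the components -/
lemma T0_comp_pd {U : Spc → Spc} (hU : SP U) (i j l : Fin 3) (x : Spc) :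
    pd i (fun y => T0 U y j l) x =
      pd i (DD U j l) x + pd i (DD U l j) x - if j = l then ∑ p, pd i (DD U p p) x else 0 := by
  have h := fun j l => ((DD_SP hU j l).diff x).hasFDerivAt
  by_cases hjl : j = l
  · have h1 := ((h j l).add (h l j)).sub (HasFDerivAt.fun_sum (u := Finset.univ) fun p _ => h p p)
    have h2 : (fun y => T0 U y j l) = DD U j l + DD U l j - fun y => ∑ p, DD U p p y := by
      funext y; simp [T0, hjl]
    unfold pd
    rw [h2, h1.fderiv]
    simp [hjl]
  · have h1 := (h j l).add (h l j)
    have h2 : (fun y => T0 U y j l) = DD U j l + DD U l j := by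
      funext y; simp [T0, hjl]
    unfold pd
    rw [h2, h1.fderiv]
    simp [hjl]

/-- component projection of tensors -/
def tL (j l : Fin 3) : (Fin 3 → Fin 3 → ℝ) →L[ℝ] ℝ :=
  (ContinuousLinearMap.proj l : (Fin 3 → ℝ) →L[ℝ] ℝ).comp
    (ContinuousLinearMap.proj j : (Fin 3 → Fin 3 → ℝ) →L[ℝ] (Fin 3 → ℝ))

lemma T0_pd_comp {U : Spc → Spc} (hU : SP U) (i j l : Fin 3) (x : Spc) :
    pd i (T0 U) x j l = pd i (fun y => T0 U y j l) x :=
  (pd_clm (tL j l) ((T0_SP hU).diff x) i).symm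

lemma T0_commute {U : Spc → Spc} (hU : SP U) (i : Fin 3) : T0 (pd i U) = pd i (T0 U) := by
  funext x j l
  rw [T0_pd_comp hU, T0_comp_pd hU]
  unfold T0
  simp_rw [DD_pd' hU]

lemma T0_symm (U : Spc → Spc) (x : Spc) (j l : Fin 3) : T0 U x j l = T0 U x l j := by
  unfold T0
  rw [add_comm]
  simp only [eq_comm]

lemma T0_div {U : Spc → Spc} (hU : SP U) (x : Spc) (l : Fin 3) :
    ∑ j, pd j (fun y => T0 U y j l) x = U x l - ∫ y in Tdom, U y l := by
  simp_rw [T0_comp_pd hU, DD_pd hU]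
  rw [Finset.sum_sub_distrib, Finset.sum_add_distrib, Finset.sum_ite_eq' Finset.univ l]
  simp only [Finset.mem_univ, if_true]
  have h1 : ∀ p, dm l (dm p (pa (cc U p))) = dm p (dm l (pa (cc U p))) := fun p => dm_comm _ _ _
  simp_rw [h1, add_sub_cancel_right]
  rw [← Complex.re_sum, laplace (cc_rapid hU l)]
  have h2 : FF (cc U l) x = U x l := FF_coef (cU_SP hU l) x
  have h3 : cc U l 0 = ((∫ y in Tdom, U y l : ℝ) : ℂ) := by
    unfold cc coef cU
    simp_rw [neg_zero, ee_zero, one_mul]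
    exact integral_complex_ofReal
  rw [h2, h3, ← Complex.ofReal_sub, Complex.ofReal_re]

lemma DD_mean {U : Spc → Spc} (hU : SP U) (j l : Fin 3) : ∫ x in Tdom, DD U j l x = 0 := by
  have hr := (cc_rapid hU l).pa
  have h := FFre_SP hr
  have := integral_pd (h.cd 1) h.2 j
  simp_rw [FFre_pd hr] at this
  exact this

lemma T0_mean {U : Spc → Spc} (hU : SP U) (j l : Fin 3) : ∫ x in Tdom, T0 U x j l = 0 := by
  have hi : ∀ j l, Integrable (DD U j l) (volume.restrict Tdom) := fun j l =>
    integrable_of_cont (DD_SP hU j l).1.continuous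
  unfold T0
  by_cases h : j = l
  · simp only [h, if_true]
    have h2 : Integrable (fun x => DD U l l x + DD U l l x) (volume.restrict Tdom) :=
      (hi l l).add (hi l l)
    rw [integral_sub h2 (integrable_finsetSum _ fun p _ => hi p p),
      integral_add (hi l l) (hi l l), integral_finsetSum _ fun p _ => hi p p]
    simp [DD_mean hU]
  · simp only [h, if_false, sub_zero]
    rw [integral_add (hi j l) (hi l j)]
    simp [DD_mean hU]


end

section

variable {E : Type*} [NormedAddCommGroup E] [NormedSpace ℝ E]

lemma int_pow_le {ι : Type*} [Fintype ι] {f : ι → Spc → ℝ} {g : Spc → ℝ}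
    (hf : ∀ i, Continuous (f i)) (hf0 : ∀ i x, 0 ≤ f i x) (hg : Continuous g) (hg0 : ∀ x, 0 ≤ g x)
    (h : ∀ x, g x ≤ ∑ i, f i x) :
    ∫ x in Tdom, g x ^ 4 ≤ (Fintype.card ι : ℝ) ^ 3 * ∑ i, ∫ x in Tdom, f i x ^ 4 := by
  have h0 : ∀ i, Integrable (fun x => f i x ^ 4) (volume.restrict Tdom) := fun i =>
    integrable_of_cont ((hf i).pow 4)
  rw [← integral_finsetSum _ fun i _ => h0 i, ← integral_const_mul]
  refine integral_mono (integrable_of_cont (hg.pow 4))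
    (integrable_of_cont (continuous_const.mul (continuous_finsetSum _ fun i _ => (hf i).pow 4)))
    fun x => ?_
  have h1 : (∑ i, f i x) ^ 4 ≤ (Fintype.card ι : ℝ) ^ 3 * ∑ i, f i x ^ 4 := by
    rcases isEmpty_or_nonempty ι with hι | hι
    · simp
    · have := pow_sum_div_card_le_sum_pow (s := (Finset.univ : Finset ι)) (f := fun i => f i x)
        (fun i _ => hf0 i x) 3
      rw [div_le_iff₀ (by positivity)] at this
      rw [mul_comm]
      simpa using this
  exact (pow_le_pow_left₀ (hg0 x) (h x) 4).trans h1

/-- the rank one map `e ↦ (v ↦ vᵢ e)` -/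
def Li (i : Fin 3) : E →L[ℝ] (Spc →L[ℝ] E) :=
  ContinuousLinearMap.smulRightL ℝ Spc E (ContinuousLinearMap.proj i)

lemma Li_apply (i : Fin 3) (e : E) (v : Spc) : Li i e v = v i • e := rfl

lemma Li_norm (i : Fin 3) : ‖(Li i : E →L[ℝ] (Spc →L[ℝ] E))‖ ≤ 1 := by
  refine ContinuousLinearMap.opNorm_le_bound _ zero_le_one fun e => ?_
  refine ContinuousLinearMap.opNorm_le_bound _ (by positivity) fun v => ?_
  rw [Li_apply, norm_smul, one_mul, mul_comm]
  exact mul_le_mul_of_nonneg_left (norm_le_pi_norm v i) (norm_nonneg _)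

lemma fderiv_eq_sum (f : Spc → E) : fderiv ℝ f = fun x => ∑ i, Li i (pd i f x) := by
  funext x
  ext v
  have hv : v = ∑ i, v i • (Pi.single i (1 : ℝ) : Spc) := by
    funext j
    simp [Finset.sum_apply, Pi.single_apply]
  conv_lhs => rw [hv]
  rw [map_sum]
  simp only [map_smul, _root_.sum_apply, Li_apply]
  rfl

lemma iter_succ_le {f : Spc → E} (hf : SP f) (k : ℕ) (x : Spc) :
    ‖iteratedFDeriv ℝ (k + 1) f x‖ ≤ ∑ i, ‖iteratedFDeriv ℝ k (pd i f) x‖ := by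
  rw [← norm_iteratedFDeriv_fderiv, fderiv_eq_sum]
  have h1 : ∀ i ∈ Finset.univ, ContDiff ℝ k (fun x => Li i (pd i f x)) := fun i _ =>
    (Li (E := E) i).contDiff.comp ((hf.pd i).cd k)
  rw [iteratedFDeriv_sum h1, Finset.sum_apply]
  refine (norm_sum_le _ _).trans (Finset.sum_le_sum fun i _ => ?_)
  have := (Li i : E →L[ℝ] _).norm_iteratedFDeriv_comp_left (f := pd i f) (x := x)
    ((hf.pd i).cd k).contDiffAt (n := k) le_rfl
  refine this.trans ?_
  exact mul_le_of_le_one_left (norm_nonneg _) (Li_norm i)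

lemma iter_pd_le {f : Spc → E} (hf : SP f) (k : ℕ) (i : Fin 3) (x : Spc) :
    ‖iteratedFDeriv ℝ k (pd i f) x‖ ≤ ‖iteratedFDeriv ℝ (k + 1) f x‖ := by
  rw [← norm_iteratedFDeriv_fderiv]
  have h1 : ContDiff ℝ k (fderiv ℝ f) := (hf.cd (k + 1)).fderiv_right (by norm_cast)
  have := (ContinuousLinearMap.apply ℝ E (Pi.single i (1 : ℝ) : Spc)).norm_iteratedFDeriv_comp_left
    (f := fderiv ℝ f) (x := x) h1.contDiffAt (n := k) le_rfl
  refine this.trans (mul_le_of_le_one_left (norm_nonneg _) ?_)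
  refine ContinuousLinearMap.opNorm_le_bound _ zero_le_one fun L => ?_
  rw [one_mul]
  refine (L.le_opNorm _).trans ?_
  rw [Pi.norm_single]
  simp

lemma iter_cont {f : Spc → E} (hf : SP f) (k : ℕ) :
    Continuous fun x => ‖iteratedFDeriv ℝ k f x‖ :=
  ((hf.cd k).continuous_iteratedFDeriv le_rfl).norm

lemma iter_int {f : Spc → E} (hf : SP f) (k : ℕ) :
    ∫ x in Tdom, ‖iteratedFDeriv ℝ (k + 1) f x‖ ^ 4 ≤
      27 * ∑ i, ∫ x in Tdom, ‖iteratedFDeriv ℝ k (pd i f) x‖ ^ 4 := by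
  have := int_pow_le (fun i => iter_cont (hf.pd i) k) (fun _ _ => norm_nonneg _)
    (iter_cont hf (k + 1)) (fun _ => norm_nonneg _) (iter_succ_le hf k)
  refine this.trans (le_of_eq ?_)
  norm_num

lemma iter_pd_int {f : Spc → E} (hf : SP f) (k : ℕ) (i : Fin 3) :
    ∫ x in Tdom, ‖iteratedFDeriv ℝ k (pd i f) x‖ ^ 4 ≤
      ∫ x in Tdom, ‖iteratedFDeriv ℝ (k + 1) f x‖ ^ 4 :=
  integral_mono (integrable_of_cont ((iter_cont (hf.pd i) k).pow 4))
    (integrable_of_cont ((iter_cont hf (k + 1)).pow 4))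
    fun x => pow_le_pow_left₀ (norm_nonneg _) (iter_pd_le hf k i x) 4

lemma FF_rapid_cont {a : Lam → ℂ} (ha : Rapid a) : Continuous fun x => ‖FF a x‖ :=
  (FF_contDiff ha).continuous.norm

lemma cz {U : Spc → Spc} (hU : SP U) (i p q : Fin 3) :
    ∫ x in Tdom, ‖FF (dm i (dm p (pa (cc U q)))) x‖ ^ 4 ≤
      KR ^ 2 * ∫ x in Tdom, ‖U x‖ ^ 4 := by
  have hr := cc_rapid hU q
  have hK := KR_nonneg
  have h1 := riesz (hr.rz p) i
  have h2 := riesz hr p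
  have h3 : ∫ x in Tdom, ‖FF (cc U q) x‖ ^ 4 ≤ ∫ x in Tdom, ‖U x‖ ^ 4 := by
    refine integral_mono (integrable_of_cont ((FF_rapid_cont hr).pow 4))
      (integrable_of_cont (hU.1.continuous.norm.pow 4)) fun x => ?_
    refine pow_le_pow_left₀ (norm_nonneg _) ?_ 4
    rw [show FF (cc U q) x = U x q from FF_coef (cU_SP hU q) x, Complex.norm_real]
    exact norm_le_pi_norm (U x) q
  rw [dm_dm_pa]
  calc _ ≤ KR * (KR * ∫ x in Tdom, ‖FF (cc U q) x‖ ^ 4) :=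
        h1.trans (mul_le_mul_of_nonneg_left h2 hK)
    _ ≤ KR * (KR * ∫ x in Tdom, ‖U x‖ ^ 4) := by gcongr
    _ = _ := by ring

lemma sum_aux {A D : Fin 3 → Fin 3 → ℝ} (hD : ∀ p q, |D p q| ≤ A p q) (j l : Fin 3) :
    |D j l + D l j - if j = l then ∑ p, D p p else 0| ≤ 3 * ∑ r : Fin 3 × Fin 3, A r.1 r.2 := by
  obtain ⟨S, hS⟩ : ∃ S, S = ∑ r : Fin 3 × Fin 3, A r.1 r.2 := ⟨_, rfl⟩
  have hA : ∀ p q, 0 ≤ A p q := fun p q => (abs_nonneg _).trans (hD p q)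
  have hS0 : 0 ≤ S := by rw [hS]; exact Finset.sum_nonneg fun _ _ => hA _ _
  rw [← hS]
  have hD1 : ∀ p q, |D p q| ≤ S := fun p q => by
    rw [hS]
    exact (hD p q).trans (Finset.single_le_sum (f := fun r : Fin 3 × Fin 3 => A r.1 r.2)
      (fun _ _ => hA _ _) (Finset.mem_univ (p, q)))
  have hD2 : |∑ p, D p p| ≤ S := by
    refine (Finset.abs_sum_le_sum_abs _ _).trans ?_
    rw [hS, Fintype.sum_prod_type]
    refine Finset.sum_le_sum fun p _ => (hD p p).trans ?_
    exact Finset.single_le_sum (f := fun q => A p q) (fun _ _ => hA _ _) (Finset.mem_univ p)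
  have h1 := abs_le.1 (hD1 j l)
  have h2 := abs_le.1 (hD1 l j)
  have h3 := abs_le.1 hD2
  rw [abs_le]
  split_ifs <;> constructor <;> linarith

lemma T0_pd_le {U : Spc → Spc} (hU : SP U) (i : Fin 3) (x : Spc) :
    ‖pd i (T0 U) x‖ ≤ ∑ r : Fin 3 × Fin 3, 3 * ‖FF (dm i (dm r.1 (pa (cc U r.2)))) x‖ := by
  rw [← Finset.mul_sum]
  have hD : ∀ p q, |pd i (DD U p q) x| ≤ ‖FF (dm i (dm p (pa (cc U q)))) x‖ := fun p q => by
    rw [DD_pd hU]; exact Complex.abs_re_le_norm _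
  have h0 : 0 ≤ 3 * ∑ r : Fin 3 × Fin 3, ‖FF (dm i (dm r.1 (pa (cc U r.2)))) x‖ :=
    mul_nonneg (by norm_num) (Finset.sum_nonneg fun _ _ => norm_nonneg _)
  refine (pi_norm_le_iff_of_nonneg h0).2 fun j => ?_
  refine (pi_norm_le_iff_of_nonneg h0).2 fun l => ?_
  rw [T0_pd_comp hU, T0_comp_pd hU, Real.norm_eq_abs]
  exact sum_aux (A := fun p q => ‖FF (dm i (dm p (pa (cc U q)))) x‖)
    (D := fun p q => pd i (DD U p q) x) hD j l

lemma T0_base {U : Spc → Spc} (hU : SP U) (i : Fin 3) :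
    ∫ x in Tdom, ‖pd i (T0 U) x‖ ^ 4 ≤
      (9 ^ 3 * (9 * (81 * KR ^ 2))) * ∫ x in Tdom, ‖U x‖ ^ 4 := by
  have hr := fun q => cc_rapid hU q
  have := int_pow_le (ι := Fin 3 × Fin 3)
    (f := fun r x => 3 * ‖FF (dm i (dm r.1 (pa (cc U r.2)))) x‖)
    (fun r => continuous_const.mul (FF_rapid_cont (((hr r.2).pa.dm r.1).dm i)))
    (fun _ _ => by positivity) ((T0_SP hU).pd i).1.continuous.norm (fun _ => norm_nonneg _)
    (T0_pd_le hU i)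
  refine this.trans ?_
  have h1 : ∀ r : Fin 3 × Fin 3,
      ∫ x in Tdom, (3 * ‖FF (dm i (dm r.1 (pa (cc U r.2)))) x‖) ^ 4 ≤
        81 * (KR ^ 2 * ∫ x in Tdom, ‖U x‖ ^ 4) := by
    intro r
    simp_rw [mul_pow]
    rw [integral_const_mul]
    have := cz hU i r.1 r.2
    norm_num
    exact this
  have h2 := Finset.sum_le_sum fun r (_ : r ∈ Finset.univ) => h1 r
  rw [Finset.sum_const] at h2
  simp only [Finset.card_univ, Fintype.card_prod, Fintype.card_fin, nsmul_eq_mul] at h2 ⊢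
  push_cast at h2 ⊢
  linarith

lemma T0_bound (k : ℕ) : ∃ C : ℝ, 0 ≤ C ∧ ∀ U : Spc → Spc, SP U →
    ∫ x in Tdom, ‖iteratedFDeriv ℝ (k + 1) (T0 U) x‖ ^ 4 ≤
      C * ∫ x in Tdom, ‖iteratedFDeriv ℝ k U x‖ ^ 4 := by
  induction k with
  | zero =>
    refine ⟨27 * (3 * (9 ^ 3 * (9 * (81 * KR ^ 2)))), by positivity, fun U hU => ?_⟩
    have h := iter_int (T0_SP hU) 0
    simp only [norm_iteratedFDeriv_zero] at h ⊢
    have h2 := Finset.sum_le_sum fun i (_ : i ∈ Finset.univ) => T0_base hU i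
    rw [Finset.sum_const] at h2
    simp only [Finset.card_univ, Fintype.card_fin, nsmul_eq_mul] at h2
    push_cast at h2
    linarith
  | succ k ih =>
    obtain ⟨C, hC, ih⟩ := ih
    refine ⟨27 * (3 * C), by positivity, fun U hU => ?_⟩
    have h := iter_int (T0_SP hU) (k + 1)
    have h1 : ∀ i, ∫ x in Tdom, ‖iteratedFDeriv ℝ (k + 1) (pd i (T0 U)) x‖ ^ 4 ≤
        C * ∫ x in Tdom, ‖iteratedFDeriv ℝ (k + 1) U x‖ ^ 4 := by
      intro i
      rw [← T0_commute hU]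
      exact (ih _ (hU.pd i)).trans (mul_le_mul_of_nonneg_left (iter_pd_int hU k i) hC)
    have h2 := Finset.sum_le_sum fun i (_ : i ∈ Finset.univ) => h1 i
    rw [Finset.sum_const] at h2
    simp only [Finset.card_univ, Fintype.card_fin, nsmul_eq_mul] at h2
    push_cast at h2
    linarith

lemma T0_add {U W : Spc → Spc} (hU : SP U) (hW : SP W) : T0 (U + W) = T0 U + T0 W := by
  funext x j l
  simp only [T0, Pi.add_apply, DD_add hU hW, Finset.sum_add_distrib]
  split_ifs <;> ring

lemma T0_smul (c : ℝ) (U : Spc → Spc) : T0 (c • U) = c • T0 U := by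
  funext x j l
  simp only [T0, Pi.smul_apply, DD_smul, ← Finset.mul_sum, smul_eq_mul]
  split_ifs <;> ring

/-- the space of smooth periodic fields -/
def VV : Submodule ℝ (Spc → Spc) where
  carrier := {U | SP U}
  add_mem' := fun {U W} hU hW => ⟨hU.1.add hW.1, fun x k => by
    simp only [Pi.add_apply]; rw [hU.2 x k, hW.2 x k]⟩
  zero_mem' := ⟨contDiff_const, fun _ _ => rfl⟩
  smul_mem' := fun c U hU => ⟨contDiff_const.smul hU.1, fun x k => by
    simp only [Pi.smul_apply]; rw [hU.2 x k]⟩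

/-- the operator as a linear map -/
def TV : VV →ₗ[ℝ] (Spc → Fin 3 → Fin 3 → ℝ) where
  toFun U := T0 U.1
  map_add' U W := T0_add U.2 W.2
  map_smul' c U := T0_smul c U.1

lemma exists_T : ∃ T : (Spc → Spc) →ₗ[ℝ] (Spc → Fin 3 → Fin 3 → ℝ),
    ∀ U, SP U → T U = T0 U := by
  obtain ⟨T, hT⟩ := TV.exists_extend
  exact ⟨T, fun U hU => LinearMap.congr_fun hT ⟨U, hU⟩⟩

end

end InvDiv

/-- There is a linear order −1 inverse `R` for the divergence operator on
symmetric tensors on 𝕋³: `∂ⱼ R[U]ʲˡ = Uˡ − ∫Uˡ`, `∫R[U] = 0`, with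
`‖∇^{k+1}R[U]‖_{L⁴} ≤ C_k ‖∇^k U‖_{L⁴}`. -/
theorem inverse_divergence_operator :
    ∃ T : (Spc → Spc) →ₗ[ℝ] (Spc → Fin 3 → Fin 3 → ℝ),
      (∀ U : Spc → Spc, ContDiff ℝ (⊤ : ℕ∞) U → Per U →
        (ContDiff ℝ (⊤ : ℕ∞) (T U) ∧ Per (T U) ∧
         (∀ x j l, T U x j l = T U x l j) ∧
         (∀ x l, (∑ j, pd j (fun y => T U y j l) x) = U x l - ∫ y in Tdom, U y l) ∧
         (∀ j l, (∫ x in Tdom, T U x j l) = 0))) ∧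
      (∀ k : ℕ, ∃ Ck : ℝ, 0 < Ck ∧
        ∀ U : Spc → Spc, ContDiff ℝ (⊤ : ℕ∞) U → Per U →
          (∫ x in Tdom, ‖iteratedFDeriv ℝ (k + 1) (T U) x‖ ^ (4 : ℝ)) ^ ((1 : ℝ)/4)
            ≤ Ck * (∫ x in Tdom, ‖iteratedFDeriv ℝ k U x‖ ^ (4 : ℝ)) ^ ((1 : ℝ)/4)) := by
  obtain ⟨T, hT⟩ := InvDiv.exists_T
  refine ⟨T, fun U h1 h2 => ?_, fun k => ?_⟩
  · have hU : InvDiv.SP U := ⟨h1, h2⟩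
    rw [hT U hU]
    exact ⟨(InvDiv.T0_SP hU).1, (InvDiv.T0_SP hU).2, InvDiv.T0_symm U, InvDiv.T0_div hU,
      InvDiv.T0_mean hU⟩
  · obtain ⟨C, hC, hb⟩ := InvDiv.T0_bound k
    refine ⟨(C + 1) ^ ((1 : ℝ) / 4), by positivity, fun U h1 h2 => ?_⟩
    have hU : InvDiv.SP U := ⟨h1, h2⟩
    rw [hT U hU]
    have h := hb U hU
    simp only [Real.rpow_ofNat]
    have hn : 0 ≤ ∫ x in Tdom, ‖iteratedFDeriv ℝ k U x‖ ^ 4 :=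
      integral_nonneg fun x => by positivity
    rw [← Real.mul_rpow (by positivity) hn]
    refine Real.rpow_le_rpow (integral_nonneg fun x => by positivity) ?_ (by norm_num)
    nlinarith
end
end
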